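/- Let d ≥ 2 and let B be a collision kernel satisfying the standing assumptions (1.1) and the Lipschitz assumption (1.2). Let p ∈ (2,∞), μ_0 ∈ 𝒮(p), and let (μ_t)_{t≥0} be the unique locally bounded measure solution in 𝒮(p) of the spatially homogeneous Boltzmann equation starting from μ_0. Let ε ∈ (0,1], λ ≥ ∫|v|^p μ_0(dv) and T ∈ [0,∞). Then there exist constants α = α(d,p) > 0 and C = C(B,d,ε,λ,p,T) < ∞ such that, for all N ∈ ℕ and any Kac process (μ_t^N)_{t≥0} in 𝒮_N with ∫|v|^p μ_0^N(dv) ≤ λ, with probability exceeding 1 − ε one has W(μ_t^N, μ_t) ≤ C (W(μ_0^N, μ_0) + N^{−α}) for all t ∈ [0,T]. Moreover, for p > 8 and d ≥ 3 one can take α = 1/d, and for p > 8 and d = 2 the estimate holds with N^{−α} replaced by N^{−1/2} log N. -/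

import Mathlib

open MeasureTheory ProbabilityTheory Filter
open scoped ENNReal NNReal RealInnerProductSpace

noncomputable section

abbrev Vd (d : ℕ) := EuclideanSpace ℝ (Fin d)

namespace KacModel

variable {d : ℕ}

/-- Post-collision velocity `v' = (v+v*)/2 + |v-v*|σ/2`. -/
def postV (v vs σ : Vd d) : Vd d := (2:ℝ)⁻¹ • (v + vs) + ((2:ℝ)⁻¹ * ‖v - vs‖) • σ

/-- Post-collision velocity `v'_* = (v+v*)/2 - |v-v*|σ/2`. -/
def postVs (v vs σ : Vd d) : Vd d := (2:ℝ)⁻¹ • (v + vs) - ((2:ℝ)⁻¹ * ‖v - vs‖) • σ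

/-- The unit sphere `S^{d-1}` regarded as a subset of `ℝ^d`. -/
def unitSphere (d : ℕ) : Set (Vd d) := {σ | ‖σ‖ = 1}

/-- Standing assumptions (1.1) on a collision kernel, regarded as a family of
measures on `ℝ^d` carried by the unit sphere. -/
structure IsCollisionKernel (B : Vd d → Measure (Vd d)) : Prop where
  measurable : ∀ s : Set (Vd d), MeasurableSet s → Measurable fun v => B v s
  prob : ∀ u : Vd d, ‖u‖ = 1 → IsProbabilityMeasure (B u)
  support : ∀ u : Vd d, ‖u‖ = 1 → B u ((unitSphere d \ {u, -u})ᶜ) = 0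
  scaling : ∀ (c : ℝ), 0 ≤ c → ∀ u : Vd d, ‖u‖ = 1 →
    B (c • u) = ENNReal.ofReal c • B u
  symm : ∀ (R : Vd d ≃ₗᵢ[ℝ] Vd d) (u : Vd d), ‖u‖ = 1 → B (R u) = (B u).map R

/-- Total variation distance between two finite measures (dual formulation). -/
def tvDist {E : Type*} [MeasurableSpace E] (μ ν : Measure E) : ℝ :=
  ⨆ f : {f : E → ℝ // Measurable f ∧ ∀ x, |f x| ≤ 1},
    ((∫ x, f.1 x ∂μ) - ∫ x, f.1 x ∂ν)

/-- The Lipschitz assumption (1.2). -/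
def IsLipschitzKernel (B : Vd d → Measure (Vd d)) (κ : ℝ) : Prop :=
  1 ≤ κ ∧ ∀ v v' : Vd d, tvDist (B v) (B v') ≤ κ * ‖v - v'‖

/-- The Boltzmann sphere 𝒮. -/
def boltzmannSphere (d : ℕ) : Set (Measure (Vd d)) :=
  {μ | IsProbabilityMeasure μ ∧ (∫ v, v ∂μ) = 0 ∧ (∫ v, ‖v‖ ^ 2 ∂μ) = 1}

/-- 𝒮_N : normalized empirical measures in the Boltzmann sphere. -/
def empiricalSphere (d N : ℕ) : Set (Measure (Vd d)) :=
  {μ | μ ∈ boltzmannSphere d ∧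
    ∃ x : Fin N → Vd d, μ = (N : ℝ≥0∞)⁻¹ • ∑ i, Measure.dirac (x i)}

/-- The class ℱ of test functions. -/
def testF (d : ℕ) : Set (Vd d → ℝ) :=
  {f | (∀ v, |f v / (1 + ‖v‖ ^ 2)| ≤ 1) ∧
    ∀ v v', |f v / (1 + ‖v‖ ^ 2) - f v' / (1 + ‖v'‖ ^ 2)| ≤ ‖v - v'‖}

/-- The weighted Wasserstein distance W. -/
def Wdist (μ ν : Measure (Vd d)) : ℝ :=
  ⨆ f : testF d, ((∫ v, (f : Vd d → ℝ) v ∂μ) - ∫ v, (f : Vd d → ℝ) v ∂ν)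

/-- The p-th moment `∫ |v|^p dμ`, as a lower integral. -/
def momentL (p : ℝ) (μ : Measure (Vd d)) : ℝ≥0∞ :=
  ∫⁻ v, (‖v‖₊ : ℝ≥0∞) ^ p ∂μ

/-- Total variation measure |μ - ν| of the difference of two finite measures. -/
def tvMeasure {E : Type*} [MeasurableSpace E] (μ ν : Measure E) : Measure E :=
  (μ - ν) + (ν - μ)

/-- The post-collision update `μ^{v,v_*,σ}` of an empirical measure. -/
def collUpdate (N : ℕ) (μ : Measure (Vd d)) (v vs σ : Vd d) : Measure (Vd d) :=
  μ + (N : ℝ≥0∞)⁻¹ • (Measure.dirac (postV v vs σ) + Measure.dirac (postVs v vs σ))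
    - (N : ℝ≥0∞)⁻¹ • (Measure.dirac v + Measure.dirac vs)

/-- The generator 𝒢 of the Kac process. -/
def kacGen (B : Vd d → Measure (Vd d)) (N : ℕ) (F : Measure (Vd d) → ℝ)
    (μ : Measure (Vd d)) : ℝ :=
  N * ∫ v, (∫ vs, (∫ σ, (F (collUpdate N μ v vs σ) - F μ) ∂(B (v - vs))) ∂μ) ∂μ

/-- A Kac process with collision kernel `B` and particle number `N`:
a càdlàg adapted 𝒮_N-valued process solving the martingale problem for 𝒢. -/
structure IsKacProcess {Ω : Type*} [m : MeasurableSpace Ω]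
    (B : Vd d → Measure (Vd d)) (N : ℕ) (P : Measure Ω)
    (𝓕 : Filtration ℝ m) (μp : ℝ → Ω → Measure (Vd d)) : Prop where
  mem : ∀ t ω, μp t ω ∈ empiricalSphere d N
  adapted : ∀ f ∈ testF d, Adapted 𝓕 fun t ω => ∫ v, f v ∂(μp t ω)
  rightCont : ∀ ω, ∀ f ∈ testF d, ∀ t : ℝ,
    ContinuousWithinAt (fun s => ∫ v, f v ∂(μp s ω)) (Set.Ici t) t
  leftLim : ∀ ω, ∀ f ∈ testF d, ∀ t : ℝ, 0 < t →
    ∃ L : ℝ, Tendsto (fun s => ∫ v, f v ∂(μp s ω)) (nhdsWithin t (Set.Iio t)) (nhds L)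
  martingale : ∀ G : Measure (Vd d) → ℝ, Measurable G → (∃ M : ℝ, ∀ ν, |G ν| ≤ M) →
    Martingale (fun t ω => G (μp t ω) - ∫ s in Set.Ioc (0:ℝ) t, kacGen B N G (μp s ω)) 𝓕 P

/-- `⟨f, Q(μ,ν)⟩`, the Boltzmann collision integral. -/
def QInt (B : Vd d → Measure (Vd d)) (f : Vd d → ℝ) (μ ν : Measure (Vd d)) : ℝ :=
  ∫ v, (∫ vs, (∫ σ, (f (postV v vs σ) + f (postVs v vs σ) - f v - f vs) ∂(B (v - vs))) ∂ν) ∂μ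

/-- Measure solution of the spatially homogeneous Boltzmann equation, started at time τ. -/
def IsBoltzmannSolutionFrom (B : Vd d → Measure (Vd d)) (τ : ℝ)
    (μt : ℝ → Measure (Vd d)) : Prop :=
  (∀ t, τ ≤ t → μt t ∈ boltzmannSphere d) ∧
  ∀ f : Vd d → ℝ, Measurable f → (∃ M, ∀ v, |f v| ≤ M) → HasCompactSupport f →
    ∀ t, τ ≤ t →
      (∫ v, f v ∂(μt t)) = (∫ v, f v ∂(μt τ)) + ∫ s in Set.Ioc τ t, QInt B f (μt s) (μt s)

/-- Measure solution of the spatially homogeneous Boltzmann equation (start time 0). -/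
def IsBoltzmannSolution (B : Vd d → Measure (Vd d)) (μt : ℝ → Measure (Vd d)) : Prop :=
  IsBoltzmannSolutionFrom B 0 μt

/-- Local boundedness in 𝒮(p) from time τ on. -/
def LocBddMomentFrom (p τ : ℝ) (μt : ℝ → Measure (Vd d)) : Prop :=
  ∀ T, τ ≤ T → ∃ M : ℝ≥0∞, M ≠ ⊤ ∧ ∀ t ∈ Set.Icc τ T, momentL p (μt t) ≤ M

/-- Sample mean. -/
def sampleMean {Ω : Type*} {N : ℕ} (Vs : Fin N → Ω → Vd d) (ω : Ω) : Vd d :=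
  (N : ℝ)⁻¹ • ∑ i, Vs i ω

/-- Sample mean square. -/
def sampleQ {Ω : Type*} {N : ℕ} (Vs : Fin N → Ω → Vd d) (ω : Ω) : ℝ :=
  (N : ℝ)⁻¹ * ∑ i, ‖Vs i ω‖ ^ 2

/-- Sample variance. -/
def sampleS {Ω : Type*} {N : ℕ} (Vs : Fin N → Ω → Vd d) (ω : Ω) : ℝ :=
  sampleQ Vs ω - ‖sampleMean Vs ω‖ ^ 2

/-- The rescaled empirical distribution μ̃^N. -/
def rescaledEmpirical {Ω : Type*} {N : ℕ} (Vs : Fin N → Ω → Vd d)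
    (μdef : Measure (Vd d)) (ω : Ω) : Measure (Vd d) :=
  if 0 < sampleS Vs ω then
    (N : ℝ≥0∞)⁻¹ • ∑ i, Measure.dirac
      ((Real.sqrt (sampleS Vs ω))⁻¹ • (Vs i ω - sampleMean Vs ω))
  else μdef

/-- The N-sample empirical distribution. -/
def empMeasure {Ω : Type*} {N : ℕ} (Vs : Fin N → Ω → Vd d) (ω : Ω) : Measure (Vd d) :=
  (N : ℝ≥0∞)⁻¹ • ∑ i, Measure.dirac (Vs i ω)

end KacModel

open KacModel

namespace KacP
variable {d : ℕ}
set_option linter.unusedSectionVars false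
local notation:max "jb" x:max => 1 + ‖x‖
local notation:max "FV" x:max => Vd x → ℝ
local notation:max "MV" x:max => Measure (Vd x)
local notation "r2" => (2:ℝ)
local notation "li" => by linarith
local notation "po" => by positivity
local notation "nq" => by norm_num
local notation "fp" => by fun_prop
local notation "mll" => mul_le_mul_of_nonneg_left

section
class CK (B : Vd d → MV d) : Prop where
  hd : 2 ≤ d
  hB : IsCollisionKernel B

lemma exists_unit (hd : 2 ≤ d) : ∃ u : Vd d, ‖u‖ = 1 :=
  ⟨EuclideanSpace.single (⟨0, by omega⟩ : Fin d) (1:ℝ), by simp⟩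

lemma norm_inv_smul {v : Vd d} (h : v ≠ 0) : ‖‖v‖⁻¹ • v‖ = 1 := by
  rw [norm_smul, norm_inv, norm_norm, inv_mul_cancel₀ (norm_ne_zero_iff.2 h)]

variable (B : Vd d → MV d) [hC : CK B]

lemma B_zero : B 0 = 0 := by
  obtain ⟨u, hu⟩ := exists_unit (CK.hd B)
  have := (CK.hB (B := B)).scaling 0 le_rfl u hu
  simpa using this

def bk : Kernel (Vd d) (Vd d) where
  toFun v := B (‖v‖⁻¹ • v)
  measurable' := (Measure.measurable_of_measurable_coe _ (CK.hB (B := B)).measurable).comp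
    fp

lemma bk_apply (v : Vd d) : bk B v = B (‖v‖⁻¹ • v) := rfl

lemma bk_prob {v : Vd d} (h : v ≠ 0) : IsProbabilityMeasure (bk B v) :=
  (CK.hB (B := B)).prob _ (norm_inv_smul h)

lemma bk_zero : bk B 0 = 0 := by rw [bk_apply]; simp [B_zero]

instance : IsFiniteKernel (bk B) := ⟨1, by simp, fun v => by
  by_cases h : v = 0
  · simp [h, bk_zero]
  · have := bk_prob B h; simp⟩

lemma B_eq (v : Vd d) : B v = ENNReal.ofReal ‖v‖ • bk B v := by
  by_cases h : v = 0
  · simp [h, B_zero]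
  · have := (CK.hB (B := B)).scaling ‖v‖ (norm_nonneg v) _ (norm_inv_smul h)
    rwa [smul_smul, mul_inv_cancel₀ (norm_ne_zero_iff.2 h), one_smul] at this

instance (v : Vd d) : IsFiniteMeasure (B v) := by
  rw [B_eq B v]
  exact Measure.smul_finite _ ENNReal.ofReal_ne_top

lemma bk_sphere (v : Vd d) : ∀ᵐ σ ∂(bk B v), ‖σ‖ = 1 := by
  by_cases h : v = 0
  · simp [h, bk_zero]
  · have h1 := (CK.hB (B := B)).support _ (norm_inv_smul h)
    rw [ae_iff, bk_apply]
    refine measure_mono_null ?_ h1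
    intro σ hσ h2
    exact hσ h2.1

lemma B_sphere (v : Vd d) : ∀ᵐ σ ∂(B v), ‖σ‖ = 1 := by
  rw [B_eq B v]; exact Measure.ae_smul_measure (bk_sphere B v) _

lemma B_int_eq (v : Vd d) (h : FV d) : ∫ σ, h σ ∂(B v) = ‖v‖ * ∫ σ, h σ ∂(bk B v) := by
  rw [B_eq B v, integral_smul_measure, ENNReal.toReal_ofReal (norm_nonneg v), smul_eq_mul]

lemma B_real_univ (v : Vd d) : (B v).real Set.univ = ‖v‖ := by
  by_cases h : v = 0
  · simp [h, B_zero]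
  · have := bk_prob B h
    rw [B_eq B v]; simp [Measure.real]

lemma B_int_const (v : Vd d) (c : ℝ) : ∫ _, c ∂(B v) = ‖v‖ * c := by
  rw [integral_const, B_real_univ, smul_eq_mul]

lemma B_integrable {v : Vd d} {h : FV d} {c : ℝ} (hm : Measurable h)
    (hb : ∀ σ, ‖σ‖ = 1 → |h σ| ≤ c) : Integrable h (B v) :=
  Integrable.of_bound hm.aestronglyMeasurable c
    ((B_sphere B v).mono fun σ hσ => by simpa using hb σ hσ)

lemma B_int_mono {v : Vd d} {h k : FV d} (hh : Integrable h (B v)) (hk : Integrable k (B v))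
    (hb : ∀ σ, ‖σ‖ = 1 → h σ ≤ k σ) : ∫ σ, h σ ∂(B v) ≤ ∫ σ, k σ ∂(B v) :=
  integral_mono_ae hh hk ((B_sphere B v).mono hb)

lemma B_int_abs_le {v : Vd d} {h : FV d} {c : ℝ}
    (hb : ∀ σ, ‖σ‖ = 1 → |h σ| ≤ c) : |∫ σ, h σ ∂(B v)| ≤ ‖v‖ * c := by
  rw [← B_real_univ B v, mul_comm]
  exact norm_integral_le_of_norm_le_const (f := h) (C := c) ((B_sphere B v).mono hb)

lemma B_int_le {v : Vd d} {h : FV d} {c : ℝ} (hh : Integrable h (B v))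
    (hb : ∀ σ, ‖σ‖ = 1 → h σ ≤ c) : ∫ σ, h σ ∂(B v) ≤ ‖v‖ * c := by
  rw [← B_int_const B v c]
  exact B_int_mono B hh (integrable_const c) hb

lemma B_meas {α : Type*} [MeasurableSpace α] {u : α → Vd d} (hu : Measurable u)
    {h : α → FV d} (hm : Measurable (Function.uncurry h)) :
    Measurable fun a => ∫ σ, h a σ ∂(B (u a)) := by
  simp_rw [B_int_eq]
  refine hu.norm.mul ?_
  have := StronglyMeasurable.integral_kernel_prod_right' (κ := (bk B).comap u hu)
    (f := Function.uncurry h) hm.stronglyMeasurable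
  simpa [Kernel.comap_apply] using this.measurable

/-- the B_neg symmetry -/
lemma B_int_neg (v : Vd d) {h : FV d} (hm : Measurable h) :
    ∫ σ, h σ ∂(B (-v)) = ∫ σ, h (-σ) ∂(B v) := by
  by_cases h0 : v = 0
  · simp [h0, B_zero]
  · rw [B_int_eq B, B_int_eq B v, norm_neg, bk_apply, bk_apply, norm_neg, smul_neg]
    have := (CK.hB (B := B)).symm (LinearIsometryEquiv.neg ℝ) _ (norm_inv_smul h0)
    rw [LinearIsometryEquiv.coe_neg] at this
    rw [show -(‖v‖⁻¹ • v) = (fun x => -x) (‖v‖⁻¹ • v) from rfl, this,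
      integral_map fp hm.aestronglyMeasurable]

variable {B} in
lemma B_tv {κ : ℝ} (hL : IsLipschitzKernel B κ) (v v' : Vd d) {h : FV d} {c : ℝ} (hc : 0 ≤ c)
    (hm : Measurable h) (hb : ∀ σ, ‖σ‖ = 1 → |h σ| ≤ c) :
    ∫ σ, h σ ∂(B v) - ∫ σ, h σ ∂(B v') ≤ c * (κ * ‖v - v'‖) := by
  classical
  rcases hc.eq_or_lt with rfl | hc
  · have h0 : ∀ u : Vd d, ∫ σ, h σ ∂(B u) = 0 := fun u => by
      have := B_int_abs_le B (v := u) hb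
      rw [mul_zero] at this
      exact abs_eq_zero.1 (le_antisymm this (abs_nonneg _))
    simp [h0]
  let g : FV d := fun σ => if ‖σ‖ = 1 then c⁻¹ * h σ else 0
  have hgm : Measurable g := Measurable.ite (measurableSet_eq_fun measurable_norm measurable_const)
    (hm.const_mul _) measurable_const
  have hg1 : ∀ x, |g x| ≤ 1 := by
    intro x
    by_cases hx : ‖x‖ = 1
    · simp only [g, hx, if_true, abs_mul, abs_inv, abs_of_pos hc]
      rw [inv_mul_le_iff₀ hc, mul_one]; exact hb x hx
    · simp [g, hx]
  have hgi : ∀ u : Vd d, ∫ σ, g σ ∂(B u) = c⁻¹ * ∫ σ, h σ ∂(B u) := fun u => by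
    rw [← integral_const_mul]
    exact integral_congr_ae ((B_sphere B u).mono fun σ hσ => by simp [g, hσ])
  have hbd : BddAbove (Set.range fun f : {f : FV d // Measurable f ∧ ∀ x, |f x| ≤ 1} =>
      ((∫ x, f.1 x ∂(B v)) - ∫ x, f.1 x ∂(B v'))) := by
    refine ⟨‖v‖ * 1 + ‖v'‖ * 1, ?_⟩
    rintro _ ⟨f, rfl⟩
    have h1 := abs_le.1 (B_int_abs_le B (v := v) (h := f.1) (c := 1) fun σ _ => f.2.2 σ)
    have h2 := abs_le.1 (B_int_abs_le B (v := v') (h := f.1) (c := 1) fun σ _ => f.2.2 σ)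
    simp only; linarith
  have := (le_ciSup hbd ⟨g, hgm, hg1⟩).trans (hL.2 v v')
  simp only [hgi] at this
  rw [← mul_sub, inv_mul_le_iff₀ hc] at this
  exact this
end

section
lemma postV_swap (v vs σ : Vd d) : postV vs v σ = postV v vs σ := by
  simp [postV, add_comm, norm_sub_rev]
lemma postVs_swap (v vs σ : Vd d) : postVs vs v σ = postVs v vs σ := by
  simp [postVs, add_comm, norm_sub_rev]
lemma postV_neg (v vs σ : Vd d) : postV v vs (-σ) = postVs v vs σ := by
  simp [postVs, postV, sub_eq_add_neg]
lemma postVs_neg (v vs σ : Vd d) : postVs v vs (-σ) = postV v vs σ := by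
  simp [postVs, postV]

lemma postV_sq {σ : Vd d} (hσ : ‖σ‖ = 1) (v vs : Vd d) :
    ‖postV v vs σ‖ ^ 2 = (‖v‖ ^ 2 + ‖vs‖ ^ 2) / 2 + ‖v - vs‖ * ⟪v + vs, σ⟫ / 2 := by
  have h1 := norm_add_sq_real v vs
  have h2 := norm_sub_sq_real v vs
  rw [postV, norm_add_sq_real, real_inner_smul_left, real_inner_smul_right, norm_smul, norm_smul,
    hσ, Real.norm_eq_abs, Real.norm_eq_abs, mul_pow, mul_pow, sq_abs, sq_abs]
  linear_combination (1/4) * h1 + (1/4) * h2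

lemma postVs_sq {σ : Vd d} (hσ : ‖σ‖ = 1) (v vs : Vd d) :
    ‖postVs v vs σ‖ ^ 2 = (‖v‖ ^ 2 + ‖vs‖ ^ 2) / 2 - ‖v - vs‖ * ⟪v + vs, σ⟫ / 2 := by
  rw [← postV_neg, postV_sq (by simpa using hσ), inner_neg_right]; ring

lemma energy {σ : Vd d} (hσ : ‖σ‖ = 1) (v vs : Vd d) :
    ‖postV v vs σ‖ ^ 2 + ‖postVs v vs σ‖ ^ 2 = ‖v‖ ^ 2 + ‖vs‖ ^ 2 := by
  rw [postV_sq hσ, postVs_sq hσ]; ring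

lemma postV_le {σ : Vd d} (hσ : ‖σ‖ = 1) (v vs : Vd d) : ‖postV v vs σ‖ ≤ ‖v‖ + ‖vs‖ := by
  refine le_of_sq_le_sq ?_ po
  nlinarith [energy hσ v vs, norm_nonneg v, norm_nonneg vs, sq_nonneg ‖postVs v vs σ‖,
    mul_nonneg (norm_nonneg v) (norm_nonneg vs)]

lemma postVs_le {σ : Vd d} (hσ : ‖σ‖ = 1) (v vs : Vd d) : ‖postVs v vs σ‖ ≤ ‖v‖ + ‖vs‖ := by
  rw [← postV_neg]; exact postV_le (by simpa using hσ) v vs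

lemma postV_lip {σ : Vd d} (hσ : ‖σ‖ = 1) (v v' vs : Vd d) :
    ‖postV v vs σ - postV v' vs σ‖ ≤ ‖v - v'‖ := by
  have : postV v vs σ - postV v' vs σ = r2⁻¹ • (v - v')
      + (r2⁻¹ * (‖v - vs‖ - ‖v' - vs‖)) • σ := by
    simp only [postV]; module
  rw [this]
  refine (norm_add_le _ _).trans ?_
  rw [norm_smul, norm_smul, hσ, norm_mul]
  have h := abs_norm_sub_norm_le (v - vs) (v' - vs)
  rw [sub_sub_sub_cancel_right] at h
  simp only [Real.norm_eq_abs, abs_inv, Nat.abs_ofNat]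
  linarith

lemma postVs_lip {σ : Vd d} (hσ : ‖σ‖ = 1) (v v' vs : Vd d) :
    ‖postVs v vs σ - postVs v' vs σ‖ ≤ ‖v - v'‖ := by
  rw [← postV_neg, ← postV_neg]; exact postV_lip (by simpa using hσ) v v' vs

def Dl (f : FV d) (v vs σ : Vd d) : ℝ := f (postV v vs σ) + f (postVs v vs σ) - f v - f vs

def cQ (B : Vd d → MV d) (f : FV d) (v vs : Vd d) : ℝ := ∫ σ, Dl f v vs σ ∂(B (v - vs))

lemma postV_meas : Measurable fun z : (Vd d × Vd d) × Vd d => postV z.1.1 z.1.2 z.2 := by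
  unfold postV; fun_prop
lemma postVs_meas : Measurable fun z : (Vd d × Vd d) × Vd d => postVs z.1.1 z.1.2 z.2 := by
  unfold postVs; fun_prop

lemma Dl_meas {f : FV d} (hf : Measurable f) :
    Measurable (Function.uncurry fun (z : Vd d × Vd d) σ => Dl f z.1 z.2 σ) := by
  unfold Dl Function.uncurry
  exact (((hf.comp postV_meas).add (hf.comp postVs_meas)).sub fp).sub fp

lemma Dl_meas1 {f : FV d} (hf : Measurable f) (v vs : Vd d) : Measurable (Dl f v vs) := by
  have h1 : Measurable (fun σ => postV v vs σ) := by unfold postV; fun_prop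
  have h2 : Measurable (fun σ => postVs v vs σ) := by unfold postVs; fun_prop
  exact (((hf.comp h1).add (hf.comp h2)).sub measurable_const).sub measurable_const

variable (B : Vd d → MV d) [hC : CK B]

lemma cQ_meas {f : FV d} (hf : Measurable f) :
    Measurable fun z : Vd d × Vd d => cQ B f z.1 z.2 :=
  B_meas B (u := fun z : Vd d × Vd d => z.1 - z.2) fp (Dl_meas hf)

lemma cQ_symm {f : FV d} (hf : Measurable f) (v vs : Vd d) : cQ B f vs v = cQ B f v vs := by
  unfold cQ
  rw [← neg_sub v vs, B_int_neg B _ (Dl_meas1 hf _ _)]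
  congr 1; ext σ
  simp only [Dl, postV_neg, postVs_neg, postV_swap, postVs_swap]; ring

/-- measurable and locally bounded -/
structure LB (f : FV d) : Prop where
  m : Measurable f
  b : ∀ R : ℝ, ∃ c, ∀ v, ‖v‖ ≤ R → |f v| ≤ c

lemma LB.of_bdd {f : FV d} (hf : Measurable f) {c : ℝ} (h : ∀ v, |f v| ≤ c) : LB f :=
  ⟨hf, fun _ => ⟨c, fun v _ => h v⟩⟩

lemma LB.of_le {f : FV d} (hf : Measurable f) {c q : ℝ} (hc : 0 ≤ c) (hq : 0 ≤ q)
    (h : ∀ v, |f v| ≤ c * (jb v) ^ q) : LB f :=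
  ⟨hf, fun R => ⟨c * (1 + R) ^ q, fun v hv => (h v).trans (by gcongr)⟩⟩

lemma LB.of_cont {f : FV d} (hf : Continuous f) : LB f :=
  ⟨hf.measurable, fun R => by
    obtain ⟨c, hc⟩ := (isCompact_closedBall (0 : Vd d) R).exists_bound_of_continuousOn hf.continuousOn
    exact ⟨c, fun v hv => hc v (by simpa using hv)⟩⟩

lemma LB.add {f g : FV d} (hf : LB f) (hg : LB g) : LB (fun v => f v + g v) :=
  ⟨hf.m.add hg.m, fun R => by
    obtain ⟨a, ha⟩ := hf.b R
    obtain ⟨b, hb⟩ := hg.b R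
    exact ⟨a + b, fun v hv => (abs_add_le _ _).trans (add_le_add (ha v hv) (hb v hv))⟩⟩

lemma LB.mul {f g : FV d} (hf : LB f) (hg : LB g) : LB (fun v => f v * g v) :=
  ⟨hf.m.mul hg.m, fun R => by
    obtain ⟨a, ha⟩ := hf.b R
    obtain ⟨b, hb⟩ := hg.b R
    refine ⟨a * b, fun v hv => ?_⟩
    rw [abs_mul]
    exact mul_le_mul (ha v hv) (hb v hv) (abs_nonneg _) ((abs_nonneg _).trans (ha v hv))⟩

lemma LB.const (c : ℝ) : LB (fun _ : Vd d => c) := LB.of_bdd measurable_const fun _ => le_rfl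

lemma LB.smul {f : FV d} (hf : LB f) (c : ℝ) : LB (fun v => c * f v) := (LB.const c).mul hf

lemma LB.sub {f g : FV d} (hf : LB f) (hg : LB g) : LB (fun v => f v - g v) := by
  simpa [sub_eq_add_neg] using hf.add (hg.smul (-1))

lemma LB.sum {ι : Type*} (s : Finset ι) {f : ι → FV d} (hf : ∀ i ∈ s, LB (f i)) :
    LB (fun v => ∑ i ∈ s, f i v) := by
  classical
  induction s using Finset.induction_on with
  | empty => simpa using LB.const 0
  | insert a s ha ih =>
    simp only [Finset.sum_insert ha]
    exact (hf a (by simp)).add (ih fun i hi => hf i (by simp [hi]))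

lemma Dl_bdd {f : FV d} (hf : LB f) (v vs : Vd d) :
    ∃ c, ∀ σ, ‖σ‖ = 1 → |Dl f v vs σ| ≤ c := by
  obtain ⟨c, hc⟩ := hf.b (‖v‖ + ‖vs‖)
  refine ⟨4 * c, fun σ hσ => ?_⟩
  have h1 := abs_le.1 (hc _ (postV_le hσ v vs))
  have h2 := abs_le.1 (hc _ (postVs_le hσ v vs))
  have h3 := abs_le.1 (hc v (by linarith [norm_nonneg vs]))
  have h4 := abs_le.1 (hc vs (by linarith [norm_nonneg v]))
  rw [Dl, abs_le]; constructor <;> linarith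

lemma Dl_int {f : FV d} (hf : LB f) (v vs : Vd d) : Integrable (Dl f v vs) (B (v - vs)) := by
  obtain ⟨c, hc⟩ := Dl_bdd hf v vs
  exact B_integrable B (Dl_meas1 hf.m v vs) hc

lemma cQ_add {f g : FV d} (hf : LB f) (hg : LB g) (v vs : Vd d) :
    cQ B (fun x => f x + g x) v vs = cQ B f v vs + cQ B g v vs := by
  unfold cQ
  rw [← integral_add (Dl_int B hf v vs) (Dl_int B hg v vs)]
  congr 1; ext σ; simp only [Dl]; ring

lemma cQ_smul (f : FV d) (c : ℝ) (v vs : Vd d) :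
    cQ B (fun x => c * f x) v vs = c * cQ B f v vs := by
  unfold cQ
  rw [← integral_const_mul]
  congr 1; ext σ; simp only [Dl]; ring

lemma cQ_abs_le {f : FV d} {c : ℝ} {v vs : Vd d} (h : ∀ σ, ‖σ‖ = 1 → |Dl f v vs σ| ≤ c) :
    |cQ B f v vs| ≤ ‖v - vs‖ * c := B_int_abs_le B h

/-- energy conservation -/
lemma Dl_sq {σ : Vd d} (hσ : ‖σ‖ = 1) (f : FV d) (c : ℝ) (v vs : Vd d) :
    Dl (fun x => f x + c * ‖x‖ ^ 2) v vs σ = Dl f v vs σ := by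
  simp only [Dl]; linear_combination c * energy hσ v vs

lemma cQ_sq (f : FV d) (c : ℝ) (v vs : Vd d) :
    cQ B (fun x => f x + c * ‖x‖ ^ 2) v vs = cQ B f v vs :=
  integral_congr_ae ((B_sphere B _).mono fun _ hσ => Dl_sq hσ f c v vs)

lemma U_post {q : ℝ} (hq : 0 ≤ q) {x v vs : Vd d} (hx : ‖x‖ ≤ ‖v‖ + ‖vs‖) :
    (jb x) ^ q ≤ 2 ^ q * ((jb v) ^ q + (jb vs) ^ q) := by
  wlog h : ‖vs‖ ≤ ‖v‖ generalizing v vs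
  · rw [add_comm ((jb v) ^ q)]; exact this li (le_of_not_ge h)
  calc (jb x) ^ q ≤ (2 * (jb v)) ^ q := by gcongr; linarith
    _ = 2 ^ q * (jb v) ^ q := Real.mul_rpow nq po
    _ ≤ _ := by gcongr; linarith [Real.rpow_nonneg (show 0 ≤ 1 + ‖vs‖ by positivity) q]

lemma Dl_abs_U {f : FV d} {c q : ℝ} (hc : 0 ≤ c) (hq : 0 ≤ q)
    (h : ∀ v, |f v| ≤ c * (jb v) ^ q) {v vs σ : Vd d} (hσ : ‖σ‖ = 1) :
    |Dl f v vs σ| ≤ c * (2 * 2 ^ q + 1) * ((jb v) ^ q + (jb vs) ^ q) := by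
  have h1 := abs_le.1 ((h _).trans (mll (U_post hq (postV_le hσ v vs)) hc))
  have h2 := abs_le.1 ((h _).trans (mll (U_post hq (postVs_le hσ v vs)) hc))
  have h3 := abs_le.1 (h v)
  have h4 := abs_le.1 (h vs)
  rw [Dl, abs_le]; constructor <;> linarith

lemma norm_sub_le_U (v vs : Vd d) : ‖v - vs‖ ≤ (jb v) * (jb vs) := by
  nlinarith [norm_sub_le v vs, mul_nonneg (norm_nonneg v) (norm_nonneg vs)]

lemma U_succ (v : Vd d) (q : ℝ) : (jb v) ^ (q + 1) = (jb v) ^ q * (jb v) := by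
  rw [Real.rpow_add po, Real.rpow_one]

lemma U_pos (v : Vd d) (q : ℝ) : 0 < (jb v) ^ q := by positivity

lemma cQ_abs_U {f : FV d} {c q : ℝ} (hc : 0 ≤ c) (hq : 0 ≤ q)
    (h : ∀ v, |f v| ≤ c * (jb v) ^ q) (v vs : Vd d) :
    |cQ B f v vs| ≤ c * (2 * 2 ^ q + 1) *
      ((jb v) ^ (q + 1) * (jb vs) + (jb v) * (jb vs) ^ (q + 1)) := by
  refine (cQ_abs_le B fun σ hσ => Dl_abs_U hc hq h hσ).trans ?_
  have := mul_le_mul_of_nonneg_right (norm_sub_le_U v vs)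
    (show 0 ≤ c * (2 * 2 ^ q + 1) * ((jb v) ^ q + (jb vs) ^ q) by positivity)
  refine this.trans (le_of_eq ?_)
  rw [U_succ, U_succ]; ring
end

section
/-! general measurability -/
lemma int_meas {α E : Type*} [MeasurableSpace α] [MeasurableSpace E] {μ : α → Measure E}
    (hμ : Measurable μ) (hp : ∀ a, IsProbabilityMeasure (μ a)) {h : α → E → ℝ}
    (hm : Measurable (Function.uncurry h)) : Measurable fun a => ∫ x, h a x ∂(μ a) := by
  let κ : Kernel α E := ⟨μ, hμ⟩
  have : IsMarkovKernel κ := ⟨hp⟩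
  exact (StronglyMeasurable.integral_kernel_prod_right' (κ := κ)
    (f := Function.uncurry h) hm.stronglyMeasurable).measurable

lemma QInt_eq (B : Vd d → MV d) (f : FV d) (μ ν : MV d) :
    QInt B f μ ν = ∫ v, ∫ vs, cQ B f v vs ∂ν ∂μ := rfl

lemma Q_meas (B : Vd d → MV d) [CK B] {α : Type*} [MeasurableSpace α]
    {μ : α → MV d}
    (hμ : Measurable μ) (hp : ∀ a, IsProbabilityMeasure (μ a)) {f : FV d} (hf : Measurable f) :
    Measurable fun a => QInt B f (μ a) (μ a) := by
  simp only [QInt_eq]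
  refine int_meas hμ hp (h := fun a v => ∫ vs, cQ B f v vs ∂(μ a)) ?_
  exact int_meas (α := α × Vd d) (μ := fun z => μ z.1) (hμ.comp measurable_fst) (fun z => hp _)
    (h := fun z vs => cQ B f z.2 vs)
    ((cQ_meas B hf).comp ((measurable_snd.comp measurable_fst).prodMk measurable_snd))

/-- weighted moment -/
def mU (q : ℝ) (μ : MV d) : ℝ := ∫ v, (jb v) ^ q ∂μ

/-- integrability of weight -/
abbrev IU (q : ℝ) (μ : MV d) : Prop := Integrable (fun v : Vd d => (jb v) ^ q) μ

lemma U_meas (q : ℝ) : Measurable fun v : Vd d => (jb v) ^ q := by fun_prop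

lemma one_le_U (v : Vd d) {q : ℝ} (hq : 0 ≤ q) : 1 ≤ (jb v) ^ q :=
  Real.one_le_rpow (by linarith [norm_nonneg v]) hq

lemma U_mono (v : Vd d) {q r : ℝ} (h : q ≤ r) : (jb v) ^ q ≤ (jb v) ^ r :=
  Real.rpow_le_rpow_of_exponent_le (by linarith [norm_nonneg v]) h

lemma mU_nonneg (q : ℝ) (μ : MV d) : 0 ≤ mU q μ := integral_nonneg fun v => (U_pos v q).le

lemma int_of_U {f : FV d} {c q : ℝ} {μ : MV d} (hf : Measurable f)
    (h : ∀ v, |f v| ≤ c * (jb v) ^ q) (hμ : IU q μ) : Integrable f μ :=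
  (hμ.const_mul c).mono' hf.aestronglyMeasurable (ae_of_all _ fun v => by simpa using h v)

lemma IU_mono {q r : ℝ} (h : q ≤ r) {μ : MV d} (hμ : IU r μ) : IU q μ :=
  int_of_U (c := 1) (U_meas q) (fun v => by
    rw [abs_of_pos (U_pos v q), one_mul]; exact U_mono v h) hμ

lemma mU_mono {q r : ℝ} (h : q ≤ r) {μ : MV d} (hμ : IU r μ) : mU q μ ≤ mU r μ :=
  integral_mono (IU_mono h hμ) hμ fun v => U_mono v h

lemma abs_int_le_U {f : FV d} {c q : ℝ} {μ : MV d}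
    (h : ∀ v, |f v| ≤ c * (jb v) ^ q) (hμ : IU q μ) : |∫ v, f v ∂μ| ≤ c * mU q μ := by
  rw [mU, ← integral_const_mul]
  exact norm_integral_le_of_norm_le (f := f) (hμ.const_mul c) (ae_of_all _ h)


lemma BS_prob {μ : MV d} (h : μ ∈ boltzmannSphere d) : IsProbabilityMeasure μ := h.1

lemma BS_int2 {μ : MV d} (h : μ ∈ boltzmannSphere d) : Integrable (fun v : Vd d => ‖v‖ ^ 2) μ := by
  by_contra hc
  have := h.2.2
  rw [integral_undef hc] at this
  exact zero_ne_one this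

lemma BS_IU2 {μ : MV d} (h : μ ∈ boltzmannSphere d) : IU 2 μ := by
  have := h.1
  refine (((integrable_const r2).add ((BS_int2 h).const_mul 2))).mono' (U_meas 2).aestronglyMeasurable
    (ae_of_all _ fun v => ?_)
  rw [Real.norm_eq_abs, abs_of_pos (U_pos v 2), Real.rpow_two]
  simp only [Pi.add_apply]
  nlinarith [sq_nonneg (1 - ‖v‖)]

lemma BS_IU1 {μ : MV d} (h : μ ∈ boltzmannSphere d) : IU 1 μ := IU_mono nq (BS_IU2 h)

lemma BS_mU2 {μ : MV d} (h : μ ∈ boltzmannSphere d) : mU 2 μ ≤ 4 := by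
  have := h.1
  have : ∫ v, (2 + 2 * ‖v‖ ^ 2) ∂μ = 4 := by
    rw [integral_add (integrable_const _) ((BS_int2 h).const_mul 2), integral_const_mul, h.2.2]
    simp; norm_num
  rw [← this]
  refine integral_mono (BS_IU2 h) ((integrable_const _).add ((BS_int2 h).const_mul 2)) fun v => ?_
  simp only [Real.rpow_two]
  nlinarith [sq_nonneg (1 - ‖v‖)]

lemma BS_mU1 {μ : MV d} (h : μ ∈ boltzmannSphere d) : mU 1 μ ≤ 4 := (mU_mono nq (BS_IU2 h)).trans (BS_mU2 h)

lemma BS_one_le {μ : MV d} (h : μ ∈ boltzmannSphere d) {q : ℝ} (hq : 0 ≤ q) (hI : IU q μ) : 1 ≤ mU q μ := by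
  have := h.1
  have : ∫ _ : Vd d, (1:ℝ) ∂μ = 1 := by simp
  rw [← this]
  exact integral_mono (integrable_const _) hI fun v => one_le_U v hq

/-! integrals of cQ-like functions against product measure -/
lemma prod_bound_int {μ ν : MV d} [IsProbabilityMeasure μ] [IsProbabilityMeasure ν]
    {h : Vd d × Vd d → ℝ} (hm : Measurable h) {c q : ℝ} (hq : 0 ≤ q)
    (hb : ∀ v vs, |h (v, vs)| ≤ c * ((jb v) ^ (q + 1) * (jb vs) + (jb v) * (jb vs) ^ (q + 1)))
    (hμ : IU (q + 1) μ) (hν : IU (q + 1) ν) :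
    Integrable h (μ.prod ν) ∧
      |∫ z, h z ∂(μ.prod ν)| ≤ c * (mU (q + 1) μ * mU 1 ν + mU 1 μ * mU (q + 1) ν) := by
  have h1 : Integrable (fun v : Vd d => 1 + ‖v‖) μ := by
    have := IU_mono (q := 1) li hμ
    unfold IU at this; simpa only [Real.rpow_one] using this
  have h2 : Integrable (fun v : Vd d => 1 + ‖v‖) ν := by
    have := IU_mono (q := 1) li hν
    unfold IU at this; simpa only [Real.rpow_one] using this
  have i1 := hμ.mul_prod h2
  have i2 := h1.mul_prod hν
  have i3 := (i1.add i2).const_mul c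
  refine ⟨i3.mono' hm.aestronglyMeasurable (ae_of_all _ fun z => hb z.1 z.2), ?_⟩
  have := norm_integral_le_of_norm_le (f := h) i3 (ae_of_all _ fun z => hb z.1 z.2)
  refine this.trans (le_of_eq ?_)
  rw [integral_const_mul]
  simp only [Pi.add_apply]
  rw [integral_add i1 i2, integral_prod_mul (fun v : Vd d => (jb v) ^ (q + 1)) (fun v : Vd d => 1 + ‖v‖),
     integral_prod_mul (fun v : Vd d => 1 + ‖v‖) (fun v : Vd d => (jb v) ^ (q + 1))]
  simp only [mU, Real.rpow_one]

variable (B : Vd d → MV d) [hC : CK B]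

lemma cQ_prod {μ ν : MV d} [IsProbabilityMeasure μ] [IsProbabilityMeasure ν]
    {f : FV d} (hm : Measurable f) {c q : ℝ} (hc : 0 ≤ c) (hq : 0 ≤ q)
    (hb : ∀ v, |f v| ≤ c * (jb v) ^ q) (hμ : IU (q + 1) μ) (hν : IU (q + 1) ν) :
    Integrable (fun z : Vd d × Vd d => cQ B f z.1 z.2) (μ.prod ν) ∧
    QInt B f μ ν = ∫ z, cQ B f z.1 z.2 ∂(μ.prod ν) ∧
      |QInt B f μ ν| ≤ c * (2 * 2 ^ q + 1) * (mU (q + 1) μ * mU 1 ν + mU 1 μ * mU (q + 1) ν) := by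
  obtain ⟨h1, h2⟩ := prod_bound_int (h := fun z : Vd d × Vd d => cQ B f z.1 z.2) (cQ_meas B hm) hq
    (fun v vs => cQ_abs_U B hc hq hb v vs) hμ hν
  have h3 : QInt B f μ ν = ∫ z, cQ B f z.1 z.2 ∂(μ.prod ν) := by
    rw [integral_prod _ h1, QInt_eq]
  exact ⟨h1, h3, by rw [h3]; exact h2⟩
end

section
def ww (v : Vd d) : ℝ := 1 + ‖v‖ ^ 2

lemma ww_one (v : Vd d) : 1 ≤ ww v := by unfold ww; nlinarith [sq_nonneg ‖v‖]

def FP (d : ℕ) : Set (FV d) :=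
  {f | (∀ v, |f v| ≤ ww v) ∧ ∀ v v', |f v - f v'| ≤ ‖v - v'‖ * (ww v + ww v')}

def F3 (d : ℕ) (R : ℝ) : Set (FV d) :=
  {g | (∀ v, |g v| ≤ (jb v) ^ 3) ∧
    (∀ v v', |g v - g v'| ≤ ‖v - v'‖ * ((jb v) ^ 3 + (1 + ‖v'‖) ^ 3)) ∧ ∀ v, R < ‖v‖ → g v = 0}

lemma cont_of_loclip {f : FV d} {G : FV d} (hG : Continuous G)
    (h : ∀ v v', |f v - f v'| ≤ ‖v - v'‖ * (G v + G v')) : Continuous f := by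
  rw [continuous_iff_continuousAt]
  intro x
  rw [ContinuousAt, tendsto_iff_dist_tendsto_zero]
  have : Continuous fun y : Vd d => ‖y - x‖ * (G y + G x) := by fun_prop
  exact squeeze_zero (g := fun y : Vd d => ‖y - x‖ * (G y + G x)) (fun _ => dist_nonneg)
    (fun y => h y x) (by simpa using this.tendsto x)

lemma FP.cont {f : FV d} (hf : f ∈ FP d) : Continuous f :=
  cont_of_loclip (G := ww) (by unfold ww; fun_prop) hf.2

lemma F3.cont {R : ℝ} {f : FV d} (hf : f ∈ F3 d R) : Continuous f :=
  cont_of_loclip (G := fun v => (jb v) ^ 3) fp hf.2.1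

lemma ww_le_U (v : Vd d) : ww v ≤ (jb v) ^ r2 := by
  rw [Real.rpow_two, ww]; nlinarith [norm_nonneg v]

lemma FP.leU {f : FV d} (hf : f ∈ FP d) (v : Vd d) : |f v| ≤ 1 * (jb v) ^ r2 := by
  rw [one_mul]; exact (hf.1 v).trans (ww_le_U v)

def cut (K : ℝ) (v : Vd d) : ℝ := max 0 (min 1 (2 - ‖v‖ / K))

lemma cut_nonneg (K : ℝ) (v : Vd d) : 0 ≤ cut K v := le_max_left _ _
lemma cut_le_one (K : ℝ) (v : Vd d) : cut K v ≤ 1 := max_le zero_le_one (min_le_left _ _)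
lemma cut_eq_zero {K : ℝ} (hK : 0 < K) {v : Vd d} (h : 2 * K ≤ ‖v‖) : cut K v = 0 := by
  refine max_eq_left ((min_le_right _ _).trans ?_)
  have : 2 ≤ ‖v‖ / K := by rwa [le_div_iff₀ hK]
  linarith
lemma cut_eq_one {K : ℝ} (hK : 0 < K) {v : Vd d} (h : ‖v‖ ≤ K) : cut K v = 1 := by
  have : ‖v‖ / K ≤ 1 := by rwa [div_le_one hK]
  rw [cut, min_eq_left li, max_eq_right zero_le_one]
lemma cut_cont (K : ℝ) : Continuous (cut K : FV d) := by unfold cut; fun_prop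
lemma cut_lip {K : ℝ} (hK : 0 < K) (v v' : Vd d) : |cut K v - cut K v'| ≤ ‖v - v'‖ / K := by
  unfold cut
  refine (abs_max_sub_max_le_max _ _ _ _).trans ?_
  have h2 := abs_min_sub_min_le_max (1:ℝ) (2 - ‖v‖ / K) 1 (2 - ‖v'‖ / K)
  have h3 : |2 - ‖v‖ / K - (2 - ‖v'‖ / K)| ≤ ‖v - v'‖ / K := by
    rw [show 2 - ‖v‖ / K - (2 - ‖v'‖ / K) = (‖v'‖ - ‖v‖) / K by ring, abs_div, abs_of_pos hK]
    gcongr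
    rw [abs_sub_comm]; exact abs_norm_sub_norm_le v v'
  have h0 : (0:ℝ) ≤ ‖v - v'‖ / K := by positivity
  simp only [sub_self, abs_zero] at h2 ⊢
  exact max_le h0 (h2.trans (max_le h0 h3))

lemma cut_norm {K : ℝ} (hK : 0 < K) (v vs : Vd d) : cut K v * cut K vs * ‖v - vs‖ ≤ 4 * K := by
  have a := cut_nonneg K v
  have b := cut_nonneg K vs
  rcases le_or_gt (2 * K) ‖v‖ with h | h
  · rw [cut_eq_zero hK h]; simp; positivity
  rcases le_or_gt (2 * K) ‖vs‖ with h' | h'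
  · rw [cut_eq_zero hK h']; simp; positivity
  have h3 : cut K v * cut K vs ≤ 1 := mul_le_one₀ (cut_le_one K v) b (cut_le_one K vs)
  have h4 : ‖v - vs‖ ≤ 4 * K := (norm_sub_le _ _).trans li
  calc _ ≤ 1 * ‖v - vs‖ := by gcongr
    _ ≤ _ := by linarith

lemma Dl_FP {f : FV d} (hf : f ∈ FP d) {v vs σ : Vd d} (hσ : ‖σ‖ = 1) :
    |Dl f v vs σ| ≤ 2 * (ww v + ww vs) := by
  have e := energy hσ v vs
  have h1 := abs_le.1 (hf.1 (postV v vs σ))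
  have h2 := abs_le.1 (hf.1 (postVs v vs σ))
  have h3 := abs_le.1 (hf.1 v)
  have h4 := abs_le.1 (hf.1 vs)
  unfold ww at *
  rw [Dl, abs_le]; constructor <;> linarith

variable (B : Vd d → MV d) [hC : CK B]

lemma cQ_FP {f : FV d} (hf : f ∈ FP d) (v vs : Vd d) :
    |cQ B f v vs| ≤ ‖v - vs‖ * (2 * (ww v + ww vs)) := cQ_abs_le B fun _ hσ => Dl_FP hf hσ

lemma w_aux (v vs : Vd d) : ww vs ≤ (jb vs) ^ 3 ∧ ‖v - vs‖ * ww vs ≤ 2 * (jb vs) ^ 3 * ww v ∧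
    ‖v - vs‖ * ww v ≤ (jb v) ^ 3 * (jb vs) ^ 3 ∧ ww v ≤ (jb v) ^ 3 := by
  have a := norm_nonneg v
  have b := norm_nonneg vs
  have h := norm_sub_le_U v vs
  have c : ∀ x : Vd d, ww x ≤ (jb x) ^ 2 := fun x => by unfold ww; nlinarith [norm_nonneg x]
  have c3 : ∀ x : Vd d, (jb x) ^ 2 ≤ (jb x) ^ 3 := fun x =>
    pow_le_pow_right₀ (by linarith [norm_nonneg x]) nq
  have e : 1 + ‖v‖ ≤ 2 * ww v := by unfold ww; nlinarith
  have w0 := ww_one vs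
  have w1 := ww_one v
  refine ⟨(c vs).trans (c3 vs), ?_, ?_, (c v).trans (c3 v)⟩
  · calc ‖v - vs‖ * ww vs ≤ ((2 * ww v) * (jb vs)) * (jb vs) ^ 2 := by
          gcongr
          · exact h.trans (by gcongr)
          · exact c vs
      _ = _ := by ring
  · calc ‖v - vs‖ * ww v ≤ ((jb v) * (jb vs)) * (jb v) ^ 2 := by
          gcongr; exact c v
      _ = (jb v) ^ 3 * (jb vs) ^ 1 := by ring
      _ ≤ _ := by gcongr <;> [linarith; norm_num]

variable {B} in
lemma core {κ : ℝ} (hL : IsLipschitzKernel B κ) {f : FV d} (hf : f ∈ FP d) {K : ℝ} (hK : 0 < K)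
    {v v' : Vd d} (vs : Vd d) (hv : ‖v'‖ ≤ ‖v‖) :
    |cut K v * cut K vs * cQ B f v vs - cut K v' * cut K vs * cQ B f v' vs
      + cut K v * cut K vs * ‖v - vs‖ * (f v - f v')| ≤
    (cut K v * cut K vs * ‖v - vs‖ + (12 + 2 * κ) * (jb vs) ^ 3) * (‖v - v'‖ * (ww v + ww v')) := by
  have hfm := (FP.cont hf).measurable
  have hLB := LB.of_cont (FP.cont hf)
  have hκ := hL.1
  set a := cut K v * cut K vs with ha
  set D := ‖v - v'‖ with hD
  have a0 : 0 ≤ a := mul_nonneg (cut_nonneg _ _) (cut_nonneg _ _)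
  have a1 : a ≤ 1 := mul_le_one₀ (cut_le_one K v) (cut_nonneg _ _) (cut_le_one K vs)
  have D0 : 0 ≤ D := norm_nonneg _
  have w0 := ww_one vs
  have w1 := ww_one v
  have w2 := ww_one v'
  obtain ⟨g1, g2, -, -⟩ := w_aux v vs
  have p3 : (1:ℝ) ≤ (jb vs) ^ 3 := one_le_pow₀ (by linarith [norm_nonneg vs])
  have i1 := Dl_int B hLB v vs
  have i2 : Integrable (Dl f v' vs) (B (v - vs)) := by
    obtain ⟨c, hc⟩ := Dl_bdd hLB v' vs
    exact B_integrable B (Dl_meas1 hfm v' vs) hc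
  have e1 : |cQ B f v vs - ∫ σ, Dl f v' vs σ ∂(B (v - vs)) + ‖v - vs‖ * (f v - f v')| ≤
      ‖v - vs‖ * (D * (ww v + ww v' + 2 * ww vs)) := by
    have : cQ B f v vs - ∫ σ, Dl f v' vs σ ∂(B (v - vs)) + ‖v - vs‖ * (f v - f v') =
        ∫ σ, (Dl f v vs σ - Dl f v' vs σ + (f v - f v')) ∂(B (v - vs)) := by
      rw [integral_add (f := fun σ => Dl f v vs σ - Dl f v' vs σ) (i1.sub i2) (integrable_const _),
        integral_sub i1 i2, B_int_const B]; rfl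
    rw [this]
    refine B_int_abs_le B fun σ hσ => ?_
    have k1 := hf.2 (postV v vs σ) (postV v' vs σ)
    have k2 := hf.2 (postVs v vs σ) (postVs v' vs σ)
    have q1 := ww_one (postV v vs σ)
    have q2 := ww_one (postV v' vs σ)
    have q3 := ww_one (postVs v vs σ)
    have q4 := ww_one (postVs v' vs σ)
    have k1' := abs_le.1 (k1.trans (mul_le_mul_of_nonneg_right (postV_lip hσ v v' vs) li))
    have k2' := abs_le.1 (k2.trans (mul_le_mul_of_nonneg_right (postVs_lip hσ v v' vs) li))
    have en : D * ((ww (postV v vs σ) + ww (postV v' vs σ)) + (ww (postVs v vs σ) + ww (postVs v' vs σ)))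
        = D * (ww v + ww v' + 2 * ww vs) := by
      have e1 := energy hσ v vs
      have e2 := energy hσ v' vs
      congr 1; unfold ww; linarith
    rw [mul_add] at en
    simp only [Dl]
    rw [abs_le]; constructor <;> linarith [k1'.1, k1'.2, k2'.1, k2'.2]
  have e2 : |(∫ σ, Dl f v' vs σ ∂(B (v - vs))) - cQ B f v' vs| ≤ 2 * (ww v' + ww vs) * (κ * D) := by
    have c0 : 0 ≤ 2 * (ww v' + ww vs) := by linarith
    have t1 := B_tv hL (v - vs) (v' - vs) c0 (Dl_meas1 hfm v' vs) (fun σ hσ => Dl_FP hf hσ)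
    have t2 := B_tv hL (v' - vs) (v - vs) c0 (Dl_meas1 hfm v' vs) (fun σ hσ => Dl_FP hf hσ)
    rw [sub_sub_sub_cancel_right] at t1 t2
    rw [norm_sub_rev] at t2
    rw [abs_le, cQ]; constructor <;> linarith
  have e3 : |(a - cut K v' * cut K vs) * cQ B f v' vs| ≤ 4 * D * (2 * (ww v' + ww vs)) := by
    rcases le_or_gt (2 * K) ‖v'‖ with h | h
    · rw [ha, cut_eq_zero hK h, cut_eq_zero hK (h.trans hv)]; simp; positivity
    rcases le_or_gt (2 * K) ‖vs‖ with h' | h'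
    · rw [ha, cut_eq_zero hK h']; simp; positivity
    have h4 : ‖v' - vs‖ ≤ 4 * K := (norm_sub_le _ _).trans li
    have b1 : |a - cut K v' * cut K vs| ≤ D / K := by
      rw [ha, ← sub_mul, abs_mul, abs_of_nonneg (cut_nonneg K vs)]
      calc _ ≤ D / K * 1 := mul_le_mul (cut_lip hK v v') (cut_le_one _ _) (cut_nonneg _ _) po
        _ = _ := mul_one _
    rw [abs_mul]
    calc _ ≤ D / K * (4 * K * (2 * (ww v' + ww vs))) := by
          gcongr
          exact (cQ_FP B hf v' vs).trans (by gcongr)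
      _ = _ := by field_simp
  have id : a * cQ B f v vs - cut K v' * cut K vs * cQ B f v' vs + a * ‖v - vs‖ * (f v - f v') =
      a * (cQ B f v vs - ∫ σ, Dl f v' vs σ ∂(B (v - vs)) + ‖v - vs‖ * (f v - f v')) +
      a * ((∫ σ, Dl f v' vs σ ∂(B (v - vs))) - cQ B f v' vs) +
      (a - cut K v' * cut K vs) * cQ B f v' vs := by ring
  rw [id]
  refine (abs_add_three _ _ _).trans ?_
  rw [abs_mul a, abs_mul a, abs_of_nonneg a0]
  have E1 := mll e1 a0
  have E2 : a * |(∫ σ, Dl f v' vs σ ∂(B (v - vs))) - cQ B f v' vs| ≤ 1 * (2 * (ww v' + ww vs) * (κ * D)) :=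
    mul_le_mul a1 e2 (abs_nonneg _) zero_le_one
  set P := (jb vs) ^ 3
  have g2a : a * (‖v - vs‖ * ww vs) ≤ 2 * P * ww v := by
    calc _ ≤ 1 * (‖v - vs‖ * ww vs) := by gcongr
      _ ≤ _ := by linarith
  have g3 : ww v' + ww vs ≤ P * (ww v + ww v') := by nlinarith
  have G2 := mll g2a D0
  have G3 := mll g3 D0
  have G3' := mll G3 (by linarith : 0 ≤ κ)
  have G4 : 0 ≤ D * (P * ww v') := by positivity
  nlinarith [E1, E2, e3, G2, G3, G3', G4]

def AK (K : ℝ) (f : FV d) (ρ : MV d) (v : Vd d) : ℝ :=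
  ∫ vs, cut K v * cut K vs * cQ B f v vs ∂ρ

lemma rpow3 (v : Vd d) : (jb v) ^ (3:ℝ) = (jb v) ^ 3 := by norm_cast

lemma int_U3 {ρ : MV d} [IsProbabilityMeasure ρ] (hρ : IU 3 ρ) {k : FV d} {a C b : ℝ}
    (h : ∀ vs, |k vs| ≤ (a + C * (jb vs) ^ 3) * b) : |∫ vs, k vs ∂ρ| ≤ (a + C * mU 3 ρ) * b := by
  have i := ((integrable_const (μ := ρ) a).add (hρ.const_mul C)).mul_const b
  refine (norm_integral_le_of_norm_le (f := k) i (ae_of_all _ fun vs => ?_)).trans (le_of_eq ?_)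
  · simp only [Pi.add_apply, rpow3]; exact h vs
  · rw [integral_mul_const]
    simp only [Pi.add_apply]
    rw [integral_add (integrable_const _) (hρ.const_mul C), integral_const_mul, mU]; simp

lemma AK_bd {f : FV d} (hf : f ∈ FP d) (K : ℝ) (v vs : Vd d) :
    |cut K v * cut K vs * cQ B f v vs| ≤ (0 + 6 * (jb vs) ^ 3) * (jb v) ^ 3 := by
  have a0 : 0 ≤ cut K v * cut K vs := mul_nonneg (cut_nonneg _ _) (cut_nonneg _ _)
  have a1 : cut K v * cut K vs ≤ 1 := mul_le_one₀ (cut_le_one K v) (cut_nonneg _ _) (cut_le_one K vs)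
  rw [abs_mul, abs_of_nonneg a0]
  obtain ⟨g1, g2, g3, g4⟩ := w_aux v vs
  calc _ ≤ 1 * (‖v - vs‖ * (2 * (ww v + ww vs))) := mul_le_mul a1 (cQ_FP B hf v vs) (abs_nonneg _) zero_le_one
    _ ≤ _ := by
      have := mll g4 (show 0 ≤ 2 * (jb vs) ^ 3 by positivity)
      linarith

lemma AK_int {f : FV d} (hf : f ∈ FP d) (K : ℝ) (v : Vd d) {ρ : MV d}
    [IsProbabilityMeasure ρ] (hρ : IU 3 ρ) :
    Integrable (fun vs => cut K v * cut K vs * cQ B f v vs) ρ := by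
  refine int_of_U (c := 6 * (jb v) ^ 3) (q := 3) ?_ (fun vs => ?_) hρ
  · exact (measurable_const.mul (cut_cont K).measurable).mul
      ((cQ_meas B (FP.cont hf).measurable).comp (measurable_const.prodMk measurable_id))
  · rw [rpow3]; exact (AK_bd B hf K v vs).trans (le_of_eq (by ring))

variable {B} in
lemma AK_diss {κ : ℝ} (hL : IsLipschitzKernel B κ) {f : FV d} (hf : f ∈ FP d) {K l : ℝ} (hK : 0 < K)
    (hl : 4 * K ≤ l) {ρ : MV d} [IsProbabilityMeasure ρ] (hρ : IU 3 ρ) :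
    (∀ v, |l * f v + AK B K f ρ v| ≤ (l + (12 + 2 * κ) * mU 3 ρ) * ww v) ∧
    ∀ v v', |(l * f v + AK B K f ρ v) - (l * f v' + AK B K f ρ v')| ≤
      (l + (12 + 2 * κ) * mU 3 ρ) * (‖v - v'‖ * (ww v + ww v')) := by
  have hκ := hL.1
  have key : ∀ v, l * f v + AK B K f ρ v = ∫ vs, (l * f v + cut K v * cut K vs * cQ B f v vs) ∂ρ :=
    fun v => by rw [integral_add (integrable_const _) (AK_int B hf K v hρ)]; simp [AK]
  have keyi : ∀ v, Integrable (fun vs => l * f v + cut K v * cut K vs * cQ B f v vs) ρ :=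
    fun v => (integrable_const _).add (AK_int B hf K v hρ)
  constructor
  · intro v
    rw [key]
    refine int_U3 hρ fun vs => ?_
    set a := cut K v * cut K vs with ha
    have a0 : 0 ≤ a := mul_nonneg (cut_nonneg _ _) (cut_nonneg _ _)
    have a1 : a ≤ 1 := mul_le_one₀ (cut_le_one K v) (cut_nonneg _ _) (cut_le_one K vs)
    have a2 : a * ‖v - vs‖ ≤ 4 * K := cut_norm hK v vs
    have hLB := LB.of_cont (FP.cont hf)
    have e : |cQ B f v vs + ‖v - vs‖ * f v| ≤ ‖v - vs‖ * (ww v + 2 * ww vs) := by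
      have : cQ B f v vs + ‖v - vs‖ * f v = ∫ σ, (Dl f v vs σ + f v) ∂(B (v - vs)) := by
        rw [integral_add (Dl_int B hLB v vs) (integrable_const _), B_int_const B]; rfl
      rw [this]
      refine B_int_abs_le B fun σ hσ => ?_
      have e := energy hσ v vs
      have h1 := abs_le.1 (hf.1 (postV v vs σ))
      have h2 := abs_le.1 (hf.1 (postVs v vs σ))
      have h4 := abs_le.1 (hf.1 vs)
      unfold ww at *
      rw [Dl, abs_le]; constructor <;> linarith
    have id : l * f v + a * cQ B f v vs = (l - a * ‖v - vs‖) * f v + a * (cQ B f v vs + ‖v - vs‖ * f v) := by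
      ring
    rw [id]
    refine (abs_add_le _ _).trans ?_
    rw [abs_mul, abs_mul, abs_of_nonneg a0, abs_of_nonneg (by linarith : 0 ≤ l - a * ‖v - vs‖)]
    have E1 := mll (hf.1 v) (by linarith : 0 ≤ l - a * ‖v - vs‖)
    have E2 := mll e a0
    obtain ⟨-, g2, -, -⟩ := w_aux v vs
    have w0 := ww_one vs
    have w1 := ww_one v
    have g2a : a * (‖v - vs‖ * ww vs) ≤ 1 * (‖v - vs‖ * ww vs) := by gcongr
    have p0 : 0 ≤ (jb vs) ^ 3 * ww v := by positivity
    nlinarith [mul_nonneg (by linarith : 0 ≤ κ) p0]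
  · intro v v'
    wlog hv : ‖v'‖ ≤ ‖v‖ generalizing v v'
    · have := this v' v (le_of_not_ge hv)
      rwa [abs_sub_comm, norm_sub_rev, add_comm (ww v)]
    rw [key, key, ← integral_sub (keyi v) (keyi v')]
    refine int_U3 hρ fun vs => ?_
    have a2 := cut_norm hK v vs
    have c := core hL hf hK vs hv
    have E1 := mll (hf.2 v v') (by linarith : 0 ≤ l - cut K v * cut K vs * ‖v - vs‖)
    rw [← abs_of_nonneg (by linarith : 0 ≤ l - cut K v * cut K vs * ‖v - vs‖), ← abs_mul,
      abs_of_nonneg (by linarith : 0 ≤ l - cut K v * cut K vs * ‖v - vs‖)] at E1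
    have E := (abs_add_le _ _).trans (add_le_add E1 c)
    refine le_trans (le_of_eq ?_) (E.trans (le_of_eq ?_))
    · congr 1; ring
    · ring

variable {B} in
lemma AK_F3 {κ : ℝ} (hL : IsLipschitzKernel B κ) {f : FV d} (hf : f ∈ FP d) {K : ℝ} (hK : 0 < K)
    {ρ : MV d} [IsProbabilityMeasure ρ] (hρ : IU 3 ρ) :
    (∀ v, |AK B K f ρ v| ≤ (16 + 2 * κ) * mU 3 ρ * (jb v) ^ 3) ∧
    (∀ v v', |AK B K f ρ v - AK B K f ρ v'| ≤
      (16 + 2 * κ) * mU 3 ρ * (‖v - v'‖ * ((jb v) ^ 3 + (1 + ‖v'‖) ^ 3))) ∧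
    ∀ v, 2 * K < ‖v‖ → AK B K f ρ v = 0 := by
  have hκ := hL.1
  have m0 := mU_nonneg 3 ρ
  refine ⟨fun v => ?_, fun v v' => ?_, fun v hv => ?_⟩
  · refine (int_U3 hρ fun vs => AK_bd B hf K v vs).trans ?_
    gcongr; nlinarith
  · wlog hv : ‖v'‖ ≤ ‖v‖ generalizing v v'
    · have := this v' v (le_of_not_ge hv)
      rwa [abs_sub_comm, norm_sub_rev, add_comm ((jb v) ^ 3)]
    rw [AK, AK, ← integral_sub (AK_int B hf K v hρ) (AK_int B hf K v' hρ), ← zero_add ((16 + 2 * κ) * mU 3 ρ)]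
    refine int_U3 hρ fun vs => ?_
    rw [zero_add]
    have c := core hL hf hK vs hv
    have a0 : 0 ≤ cut K v * cut K vs := mul_nonneg (cut_nonneg _ _) (cut_nonneg _ _)
    have a1 : cut K v * cut K vs ≤ 1 := mul_le_one₀ (cut_le_one K v) (cut_nonneg _ _) (cut_le_one K vs)
    have w1 := ww_one v
    have w2 := ww_one v'
    obtain ⟨-, -, g3, g4⟩ := w_aux v vs
    obtain ⟨-, -, -, g5⟩ := w_aux v' vs
    set a := cut K v * cut K vs with ha
    have E1 : |a * ‖v - vs‖ * (f v - f v')| ≤ a * ‖v - vs‖ * (‖v - v'‖ * (ww v + ww v')) := by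
      rw [abs_mul, abs_of_nonneg po]
      exact mll (hf.2 v v') po
    have E2 : ‖v - vs‖ * (ww v + ww v') ≤ (jb vs) ^ 3 * (jb v) ^ 3 * 2 := by
      have : ww v' ≤ ww v := by unfold ww; gcongr
      nlinarith [mll this (norm_nonneg (v - vs))]
    have E3 : a * ‖v - vs‖ * (‖v - v'‖ * (ww v + ww v')) ≤
        ‖v - v'‖ * ((jb vs) ^ 3 * (jb v) ^ 3) * 2 := by
      calc _ = a * (‖v - v'‖ * (‖v - vs‖ * (ww v + ww v'))) := by ring
        _ ≤ 1 * (‖v - v'‖ * ((jb vs) ^ 3 * (jb v) ^ 3 * 2)) := by gcongr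
        _ = _ := by ring
    have E4 : (12 + 2 * κ) * (jb vs) ^ 3 * (‖v - v'‖ * (ww v + ww v')) ≤
       (12 + 2 * κ) * (jb vs) ^ 3 * (‖v - v'‖ * ((jb v) ^ 3 + (1 + ‖v'‖) ^ 3)) := by gcongr
    have E5 : (0:ℝ) ≤ (jb vs) ^ 3 * (‖v - v'‖ * (1 + ‖v'‖) ^ 3) := by positivity
    have t : ∀ x y : ℝ, |x| ≤ |x + y| + |y| := fun x y => by
      have := abs_sub (x + y) y; rwa [add_sub_cancel_right] at this
    refine (t _ (a * ‖v - vs‖ * (f v - f v'))).trans ((add_le_add c E1).trans ?_)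
    nlinarith
  · rw [AK, cut_eq_zero hK hv.le]; simp
end

open Set in
lemma exp_neg_lip {x y : ℝ} (hx : 0 ≤ x) (hy : 0 ≤ y) : |Real.exp (-x) - Real.exp (-y)| ≤ |x - y| := by
  wlog h : x ≤ y generalizing x y
  · rw [abs_sub_comm, abs_sub_comm x]; exact this hy hx (le_of_not_ge h)
  have h1 : Real.exp (-y) ≤ Real.exp (-x) := Real.exp_le_exp.2 li
  rw [abs_of_nonneg li, abs_of_nonpos li]
  have h2 : Real.exp (-x) * (1 - (y - x)) ≤ Real.exp (-y) := by
    have : Real.exp (-y) = Real.exp (-x) * Real.exp (x - y) := by rw [← Real.exp_add]; ring_nf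
    rw [this]
    gcongr
    linarith [Real.add_one_le_exp (x - y)]
  have h3 : Real.exp (-x) ≤ 1 := Real.exp_le_one_iff.2 li
  nlinarith [mul_nonneg (sub_nonneg.2 h3) (sub_nonneg.2 h)]

open Set AbsolutelyContinuousOnInterval in
lemma AC_exp_neg {f : ℝ → ℝ} {a b : ℝ} (hf : AbsolutelyContinuousOnInterval f a b)
    (h0 : ∀ x ∈ uIcc a b, 0 ≤ f x) : AbsolutelyContinuousOnInterval (fun x => Real.exp (-f x)) a b := by
  rw [absolutelyContinuousOnInterval_iff] at hf ⊢
  intro ε hε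
  obtain ⟨δ, hδ, h⟩ := hf ε hε
  refine ⟨δ, hδ, fun E hE hs => lt_of_le_of_lt (Finset.sum_le_sum fun i hi => ?_) (h E hE hs)⟩
  exact exp_neg_lip (h0 _ (hE.left i hi).left) (h0 _ (hE.left i hi).right)

open Set in
lemma gronwall {y k β : ℝ → ℝ} {T a l : ℝ} (hT : 0 ≤ T) (hl : 0 ≤ l) (hy : ContinuousOn y (Icc 0 T))
    (hk : IntervalIntegrable k volume 0 T) (hβ : IntervalIntegrable β volume 0 T)
    (hk0 : ∀ s, 0 ≤ k s) (hβ0 : ∀ s, 0 ≤ β s)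
    (h : ∀ t ∈ Icc 0 T, Real.exp (l * t) * y t ≤
      a + ∫ s in 0..t, Real.exp (l * s) * ((l + k s) * y s + β s)) :
    y T ≤ (a + ∫ s in 0..T, β s) * Real.exp (∫ s in 0..T, k s) := by
  have hu : uIcc 0 T = Icc 0 T := uIcc_of_le hT
  have T0 : (0:ℝ) ∈ uIcc 0 T := left_mem_uIcc
  set h1 : ℝ → ℝ := fun s => Real.exp (l * s) * ((l + k s) * y s + β s) with hh1
  have hi : IntervalIntegrable h1 volume 0 T := by
    refine IntervalIntegrable.continuousOn_mul ?_ fp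
    refine IntervalIntegrable.add ?_ hβ
    exact (((intervalIntegrable_const).add hk).mul_continuousOn (by rwa [hu]))
  have hlk : IntervalIntegrable (fun s => l + k s) volume 0 T := (intervalIntegrable_const).add hk
  set z : ℝ → ℝ := fun t => a + ∫ s in 0..t, h1 s with hz
  set L : ℝ → ℝ := fun t => ∫ s in 0..t, (l + k s) with hL
  have zAC : AbsolutelyContinuousOnInterval z 0 T := by
    refine AbsolutelyContinuousOnInterval.fun_add ?_ (hi.absolutelyContinuousOnInterval_intervalIntegral T0)
    exact (contDiffOn_const).absolutelyContinuousOnInterval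
  have L0 : ∀ x ∈ uIcc 0 T, 0 ≤ L x := fun x hx => by
    rw [hu] at hx
    exact intervalIntegral.integral_nonneg hx.1 fun s _ => by linarith [hk0 s]
  have IAC := AC_exp_neg (hlk.absolutelyContinuousOnInterval_intervalIntegral T0) L0
  have PAC : AbsolutelyContinuousOnInterval (fun x => z x * Real.exp (-L x)) 0 T := zAC.fun_mul IAC
  have ftc := PAC.integral_deriv_eq_sub
  have der : ∀ᵐ x, x ∈ uIoc 0 T → deriv (fun x => z x * Real.exp (-L x)) x ≤ β x := by
    filter_upwards [hi.ae_hasDerivAt_integral, hlk.ae_hasDerivAt_integral] with x e1 e2 hx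
    have hx' := uIoc_subset_uIcc hx
    have d1 : HasDerivAt z (h1 x) x := (e1 hx' 0 T0).const_add a
    have d2 : HasDerivAt L (l + k x) x := e2 hx' 0 T0
    have d3 : HasDerivAt (fun x => z x * Real.exp (-L x))
      (h1 x * Real.exp (-L x) + z x * (Real.exp (-L x) * -(l + k x))) x := d1.mul d2.neg.exp
    rw [d3.deriv]
    have hxx : x ∈ Icc 0 T := by rwa [hu] at hx'
    have h3 := h x hxx
    have h4 : 0 ≤ l + k x := by linarith [hk0 x]
    have h5 : Real.exp (-L x) * Real.exp (l * x) ≤ 1 := by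
      rw [← Real.exp_add, Real.exp_le_one_iff]
      have : L x = l * x + ∫ s in 0..x, k s := by
        rw [hL]; simp only
        rw [intervalIntegral.integral_add intervalIntegrable_const (hk.mono_set (by
          rw [hu, uIcc_of_le hxx.1]; exact Icc_subset_Icc_right hxx.2))]
        simp [mul_comm]
      have := intervalIntegral.integral_nonneg hxx.1 (μ := volume) fun s _ => hk0 s
      linarith
    have h6 := mul_le_mul_of_nonneg_right h5 (hβ0 x)
    have h7 := mll h3 (mul_nonneg (Real.exp_pos (-L x)).le h4)
    simp only [hh1] at *
    nlinarith
  have pint : IntervalIntegrable (deriv fun x => z x * Real.exp (-L x)) volume 0 T :=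
    PAC.boundedVariationOn.intervalIntegrable_deriv
  have le : z T * Real.exp (-L T) - z 0 * Real.exp (-L 0) ≤ ∫ s in 0..T, β s := by
    rw [← ftc]
    refine intervalIntegral.integral_mono_ae_restrict hT pint hβ ?_
    rw [EventuallyLE, ae_restrict_iff' measurableSet_Icc]
    have hn : ∀ᵐ x : ℝ, x ≠ 0 := by simp [ae_iff, measure_singleton]
    filter_upwards [der, hn] with x hx hn hx2
    exact hx (by rw [uIoc_of_le hT]; exact ⟨lt_of_le_of_ne hx2.1 hn.symm, hx2.2⟩)
  have z0 : z 0 = a := by simp [hz]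
  have LL0 : L 0 = 0 := by simp [hL]
  have LT : L T = l * T + ∫ s in 0..T, k s := by
    simp only [hL]
    rw [intervalIntegral.integral_add intervalIntegrable_const hk]; simp [mul_comm]
  rw [z0, LL0] at le
  simp only [neg_zero, Real.exp_zero, mul_one] at le
  have yT := h T ⟨hT, le_rfl⟩
  have le2 : z T ≤ (a + ∫ s in 0..T, β s) * Real.exp (L T) := by
    have : z T * Real.exp (-L T) * Real.exp (L T) = z T := by
      rw [mul_assoc, ← Real.exp_add]; simp
    rw [← this]; gcongr; linarith
  rw [LT, Real.exp_add] at le2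
  have := yT.trans le2
  have e0 := Real.exp_pos (l * T)
  refine le_of_mul_le_mul_left ?_ e0
  linarith

open Set
section
variable (B : Vd d → MV d) [hC : CK B]

lemma ibp {q : ℝ → ℝ} {x0 l t : ℝ} (hq : IntervalIntegrable q volume 0 t) :
    Real.exp (l * t) * (x0 + ∫ s in 0..t, q s) =
      x0 + ∫ s in 0..t, Real.exp (l * s) * (l * (x0 + ∫ r in 0..s, q r) + q s) := by
  have T0 : (0:ℝ) ∈ uIcc 0 t := left_mem_uIcc
  have zAC : AbsolutelyContinuousOnInterval (fun t => x0 + ∫ s in 0..t, q s) 0 t := by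
    refine AbsolutelyContinuousOnInterval.fun_add ?_ (hq.absolutelyContinuousOnInterval_intervalIntegral T0)
    exact (contDiffOn_const).absolutelyContinuousOnInterval
  have IAC : AbsolutelyContinuousOnInterval (fun t => Real.exp (l * t)) 0 t :=
    (ContDiff.contDiffOn fp).absolutelyContinuousOnInterval
  have ftc := (IAC.fun_mul zAC).integral_deriv_eq_sub
  simp only [mul_zero, Real.exp_zero, intervalIntegral.integral_same, add_zero, one_mul] at ftc
  rw [sub_eq_iff_eq_add'.1 ftc.symm]
  congr 1
  refine intervalIntegral.integral_congr_ae ?_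
  filter_upwards [hq.ae_hasDerivAt_integral] with x e1 hx
  have d1 := (e1 (uIoc_subset_uIcc hx) 0 T0).const_add x0
  have d2 : HasDerivAt (fun t => Real.exp (l * t)) (Real.exp (l * x) * l) x := by
    simpa using ((hasDerivAt_id x).const_mul l).exp
  rw [(d2.fun_mul d1).deriv]; ring

lemma QInt_lin {f g : FV d} (hf : Measurable f) (hg : Measurable g) {a b c : ℝ}
    (hfb : ∀ v, |f v| ≤ a * (jb v) ^ r2) (hgb : ∀ v, |g v| ≤ b * (jb v) ^ r2) (ha : 0 ≤ a) (hb : 0 ≤ b)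
    {μ : MV d} (hμ : μ ∈ boltzmannSphere d) (h3 : IU 3 μ) :
    QInt B (fun v => c * f v + g v) μ μ = c * QInt B f μ μ + QInt B g μ μ := by
  have := hμ.1
  have l1 : LB f := LB.of_le hf ha nq hfb
  have l2 : LB g := LB.of_le hg hb nq hgb
  have e3 : r2 + 1 = 3 := by norm_num
  obtain ⟨i1, q1, -⟩ := cQ_prod B hf ha (q := 2) nq hfb (by rwa [e3]) (by rwa [e3]) (μ := μ) (ν := μ)
  obtain ⟨i2, q2, -⟩ := cQ_prod B hg hb (q := 2) nq hgb (by rwa [e3]) (by rwa [e3]) (μ := μ) (ν := μ)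
  obtain ⟨i3, q3, -⟩ := cQ_prod B (f := fun v => c * f v + g v) fp (c := |c| * a + b) po (q := 2) nq
    (fun v => by
      refine (abs_add_le _ _).trans ?_
      rw [abs_mul, add_mul, mul_assoc]
      have := hfb v
      have := hgb v
      gcongr)
    (by rwa [e3]) (by rwa [e3]) (μ := μ) (ν := μ)
  rw [q1, q2, q3, ← integral_const_mul, ← integral_add (i1.const_mul c) i2]
  congr 1; ext z
  rw [cQ_add B (l1.smul c) l2, cQ_smul]

lemma tail_bd {f : FV d} (hf : f ∈ FP d) {K p : ℝ} (hK : 1 ≤ K) (hp : 2 ≤ p) (v vs : Vd d) :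
    |(1 - cut K v * cut K vs) * cQ B f v vs| ≤ 8 * K ^ (2 - p) *
      ((jb v) ^ (p + 1) * (jb vs) + (jb v) * (jb vs) ^ (p + 1)) := by
  have main : ∀ a b : ℝ, 1 ≤ b → b ≤ a → K ≤ a → (a + b) * (2 * (a ^ 2 + b ^ 2)) ≤ 8 * K ^ (2 - p) * (a ^ (p + 1) * b) := by
    intro a b hb hab hKa
    have a0 : 0 < a := by linarith
    have K0 : 0 < K := by linarith
    have : a ^ 3 = a ^ (2 - p) * a ^ (p + 1) := by
      rw [← Real.rpow_add a0, show 2 - p + (p + 1) = (3:ℕ) by push_cast; ring, Real.rpow_natCast]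
    have h2 : a ^ (2 - p) ≤ K ^ (2 - p) := Real.rpow_le_rpow_of_nonpos K0 hKa li
    calc (a + b) * (2 * (a ^ 2 + b ^ 2)) ≤ (a + a) * (2 * (a ^ 2 + a ^ 2)) := by gcongr
      _ = 8 * a ^ (2 - p) * (a ^ (p + 1) * 1) := by rw [mul_one, mul_assoc, ← this]; ring
      _ ≤ _ := by gcongr
  have a0 : 0 ≤ cut K v * cut K vs := mul_nonneg (cut_nonneg _ _) (cut_nonneg _ _)
  have a1 : cut K v * cut K vs ≤ 1 := mul_le_one₀ (cut_le_one K v) (cut_nonneg _ _) (cut_le_one K vs)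
  have p1 := U_pos v (p + 1)
  have p2 := U_pos vs (p + 1)
  have n1 := norm_nonneg v
  have n2 := norm_nonneg vs
  by_cases h : ‖v‖ ≤ K ∧ ‖vs‖ ≤ K
  · rw [cut_eq_one li h.1, cut_eq_one li h.2]; simp; positivity
  have hb : |(1 - cut K v * cut K vs) * cQ B f v vs| ≤
      ((jb v) + (jb vs)) * (2 * ((jb v) ^ 2 + (jb vs) ^ 2)) := by
    rw [abs_mul, abs_of_nonneg li]
    calc _ ≤ 1 * (‖v - vs‖ * (2 * (ww v + ww vs))) := by
          have := cQ_FP B hf v vs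
          gcongr; linarith
      _ ≤ _ := by
        rw [one_mul]; unfold ww
        have : ‖v - vs‖ ≤ (jb v) + (jb vs) := by linarith [norm_sub_le v vs]
        gcongr <;> nlinarith
  refine hb.trans ?_
  have Kp : 0 ≤ K ^ (2 - p) := by positivity
  rcases le_total ‖v‖ ‖vs‖ with hh | hh
  · have hK2 : K ≤ 1 + ‖vs‖ := by
      by_contra hc; exact h ⟨by linarith, by linarith⟩
    refine (le_of_eq (by ring)).trans ((main (jb vs) (jb v) li li hK2).trans ?_)
    rw [mul_comm ((jb vs) ^ (p + 1))]
    gcongr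
    have : 0 ≤ (jb v) ^ (p + 1) * (jb vs) := by positivity
    linarith
  · have hK2 : K ≤ 1 + ‖v‖ := by
      by_contra hc; exact h ⟨by linarith, by linarith⟩
    refine (main (jb v) (jb vs) li li hK2).trans ?_
    gcongr
    have : 0 ≤ (jb v) * (jb vs) ^ (p + 1) := by positivity
    linarith

lemma q_one {f : FV d} (hf : f ∈ FP d) {K p : ℝ} (hK : 1 ≤ K) (hp : 2 ≤ p)
    {μ : MV d} (hμ : μ ∈ boltzmannSphere d) (iμ : IU (p + 1) μ) :
    |QInt B f μ μ - ∫ v, AK B K f μ v ∂μ| ≤ 64 * K ^ (2 - p) * mU (p + 1) μ := by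
  have := hμ.1
  have iμ3 : IU (2 + 1) μ := IU_mono li iμ
  have hm := cQ_meas B (FP.cont hf).measurable
  have cm : Measurable fun z : Vd d × Vd d => cut K z.1 * cut K z.2 :=
    ((cut_cont K).measurable.comp measurable_fst).mul ((cut_cont K).measurable.comp measurable_snd)
  obtain ⟨i1, e1, -⟩ := cQ_prod B (FP.cont hf).measurable zero_le_one (q := 2) nq (FP.leU hf) iμ3 iμ3
  obtain ⟨i2, b2⟩ := prod_bound_int (μ := μ) (ν := μ) (h := fun z : Vd d × Vd d => (1 - cut K z.1 * cut K z.2) * cQ B f z.1 z.2)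
    ((measurable_const.sub cm).mul hm) (q := p) li (tail_bd B hf hK hp) iμ iμ
  have i3 : Integrable (fun z : Vd d × Vd d => cut K z.1 * cut K z.2 * cQ B f z.1 z.2) (μ.prod μ) := by
    refine (i1.sub i2).congr (ae_of_all _ fun z => ?_)
    simp only [Pi.sub_apply]; ring
  have : ∫ v, AK B K f μ v ∂μ = ∫ z, cut K z.1 * cut K z.2 * cQ B f z.1 z.2 ∂(μ.prod μ) := by
    rw [integral_prod _ i3]; rfl
  rw [this, e1, ← integral_sub i1 i3]
  have e : ∀ z : Vd d × Vd d, cQ B f z.1 z.2 - cut K z.1 * cut K z.2 * cQ B f z.1 z.2 =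
    (1 - cut K z.1 * cut K z.2) * cQ B f z.1 z.2 := fun z => by ring
  simp only [e]
  refine b2.trans ?_
  have h1 := BS_mU1 hμ
  have h2 := mU_nonneg (p + 1) μ
  have : 0 ≤ K ^ (2 - p) := by positivity
  calc _ ≤ 8 * K ^ (2 - p) * (mU (p + 1) μ * 4 + 4 * mU (p + 1) μ) := by gcongr
    _ = _ := by ring

lemma AK_meas {f : FV d} (hf : f ∈ FP d) (K : ℝ) (ρ : MV d) [IsProbabilityMeasure ρ] :
    Measurable (AK B K f ρ) := by
  have cm : Measurable fun z : Vd d × Vd d => cut K z.1 * cut K z.2 * cQ B f z.1 z.2 :=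
    (((cut_cont K).measurable.comp measurable_fst).mul ((cut_cont K).measurable.comp measurable_snd)).mul
      (cQ_meas B (FP.cont hf).measurable)
  exact int_meas (μ := fun _ => ρ) measurable_const (fun _ => inferInstance)
    (h := fun v vs => cut K v * cut K vs * cQ B f v vs) cm

lemma AK_swap {f : FV d} (hf : f ∈ FP d) (K : ℝ) {μ ν : MV d} [IsProbabilityMeasure μ]
    [IsProbabilityMeasure ν] (iμ : IU 3 μ) (iν : IU 3 ν) :
    ∫ v, AK B K f ν v ∂μ = ∫ v, AK B K f μ v ∂ν := by
  have e3 : r2 + 1 = 3 := by norm_num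
  obtain ⟨i1, -, -⟩ := cQ_prod B (FP.cont hf).measurable zero_le_one (q := 2) nq (FP.leU hf)
    (by rwa [e3]) (by rwa [e3]) (μ := μ) (ν := ν)
  unfold AK
  have cm : Measurable fun z : Vd d × Vd d => cut K z.1 * cut K z.2 :=
    ((cut_cont K).measurable.comp measurable_fst).mul ((cut_cont K).measurable.comp measurable_snd)
  have i : Integrable (Function.uncurry fun v vs => cut K v * cut K vs * cQ B f v vs) (μ.prod ν) := by
    refine i1.norm.mono' (cm.mul (cQ_meas B (FP.cont hf).measurable)).aestronglyMeasurable (ae_of_all _ fun z => ?_)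
    have a0 : 0 ≤ cut K z.1 * cut K z.2 := mul_nonneg (cut_nonneg _ _) (cut_nonneg _ _)
    have a1 : cut K z.1 * cut K z.2 ≤ 1 := mul_le_one₀ (cut_le_one K z.1) (cut_nonneg _ _) (cut_le_one K z.2)
    simp only [Function.uncurry, norm_mul]
    rw [← norm_mul, Real.norm_of_nonneg a0]
    exact mul_le_of_le_one_left (norm_nonneg _) a1
  rw [integral_integral_swap i]
  congr 1; ext v; congr 1; ext w
  rw [cQ_symm B (FP.cont hf).measurable]; ring
end

section
variable (B : Vd d → MV d) [hC : CK B]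

/-- good measure paths -/
structure GP (p T : ℝ) (ν : ℝ → MV d) : Prop where
  m : Measurable ν
  s : ∀ t, ν t ∈ boltzmannSphere d
  i : ∀ᵐ s ∂(volume.restrict (Ioc 0 T)), IU (p + 1) (ν s)
  k : IntervalIntegrable (fun s => mU (p + 1) (ν s)) volume 0 T

lemma GP.mono {p T t : ℝ} {ν : ℝ → MV d} (h : GP p T ν) (h0 : 0 ≤ t) (ht : t ≤ T) : GP p t ν where
  m := h.m
  s := h.s
  i := ae_restrict_of_ae_restrict_of_subset (Ioc_subset_Ioc_right ht) h.i
  k := h.k.mono_set (by rw [uIcc_of_le h0, uIcc_of_le (h0.trans ht)]; exact Icc_subset_Icc_right ht)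

lemma mU_meas {ν : ℝ → MV d} (h : Measurable ν) (hs : ∀ t, ν t ∈ boltzmannSphere d) (q : ℝ) :
    Measurable fun s => mU q (ν s) :=
  int_meas h (fun t => (hs t).1) (h := fun _ v => (jb v) ^ q) (by unfold Function.uncurry; fun_prop)

lemma ii_of_le {f g : ℝ → ℝ} {T : ℝ} (hT : 0 ≤ T) (hf : Measurable f) (hg : IntervalIntegrable g volume 0 T)
    (h : ∀ᵐ s ∂(volume.restrict (Ioc 0 T)), |f s| ≤ g s) : IntervalIntegrable f volume 0 T := by
  rw [intervalIntegrable_iff_integrableOn_Ioc_of_le hT] at hg ⊢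
  exact hg.mono' hf.aestronglyMeasurable h

lemma GP.k3 {p T : ℝ} {ν : ℝ → MV d} (h : GP p T ν) (hT : 0 ≤ T) (hp : 2 ≤ p) :
    IntervalIntegrable (fun s => mU 3 (ν s)) volume 0 T := by
  refine ii_of_le hT (mU_meas h.m h.s 3) h.k ?_
  filter_upwards [h.i] with s hs
  rw [abs_of_nonneg (mU_nonneg _ _)]
  exact mU_mono li hs

lemma GP.qb {p T : ℝ} {ν : ℝ → MV d} (h : GP p T ν) (hp : 2 ≤ p) {f : FV d}
    (hf : Measurable f) {c : ℝ} (hc : 0 ≤ c) (hb : ∀ v, |f v| ≤ c * (jb v) ^ r2) :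
    ∀ᵐ s ∂(volume.restrict (Ioc 0 T)), |QInt B f (ν s) (ν s)| ≤ 72 * c * mU 3 (ν s) := by
  filter_upwards [h.i] with s hs
  have := (h.s s).1
  have h3 : IU (2 + 1) (ν s) := IU_mono li hs
  obtain ⟨-, -, b⟩ := cQ_prod B hf hc (q := 2) nq hb h3 h3
  refine b.trans ?_
  rw [show r2 + 1 = 3 by norm_num, Real.rpow_two]
  have h1 := BS_mU1 (h.s s)
  have h2 := mU_nonneg 3 (ν s)
  calc _ ≤ c * (2 * 2 ^ 2 + 1) * (mU 3 (ν s) * 4 + 4 * mU 3 (ν s)) := by gcongr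
    _ = _ := by ring

lemma GP.qi {p T : ℝ} {ν : ℝ → MV d} (h : GP p T ν) (hT : 0 ≤ T) (hp : 2 ≤ p) {f : FV d}
    (hf : Measurable f) {c : ℝ} (hc : 0 ≤ c) (hb : ∀ v, |f v| ≤ c * (jb v) ^ r2) :
    IntervalIntegrable (fun s => QInt B f (ν s) (ν s)) volume 0 T :=
  ii_of_le hT (Q_meas B h.m (fun t => (h.s t).1) hf) ((h.k3 hT hp).const_mul _) (h.qb B hp hf hc hb)

def JJ (ν : ℝ → MV d) (t : ℝ) (f : FV d) : ℝ :=
  ∫ v, f v ∂(ν 0) + ∫ s in 0..t, QInt B f (ν s) (ν s)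

lemma JJ_lin {p t : ℝ} {ν : ℝ → MV d} (h : GP p t ν) (ht : 0 ≤ t) (hp : 2 ≤ p)
    {f g : FV d} (hf : Measurable f) (hg : Measurable g) {a b c : ℝ}
    (hfb : ∀ v, |f v| ≤ a * (jb v) ^ r2) (hgb : ∀ v, |g v| ≤ b * (jb v) ^ r2) (ha : 0 ≤ a) (hb : 0 ≤ b) :
    JJ B ν t (fun v => c * f v + g v) = c * JJ B ν t f + JJ B ν t g := by
  have i2 := BS_IU2 (h.s 0)
  have e1 : ∫ v, (c * f v + g v) ∂(ν 0) = c * ∫ v, f v ∂(ν 0) + ∫ v, g v ∂(ν 0) := by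
    rw [integral_add ((int_of_U hf hfb i2).const_mul c) (int_of_U hg hgb i2), integral_const_mul]
  have e2 : ∫ s in 0..t, QInt B (fun v => c * f v + g v) (ν s) (ν s) =
      c * (∫ s in 0..t, QInt B f (ν s) (ν s)) + ∫ s in 0..t, QInt B g (ν s) (ν s) := by
    rw [← intervalIntegral.integral_const_mul, ← intervalIntegral.integral_add
      ((h.qi B ht hp hf ha hfb).const_mul c) (h.qi B ht hp hg hb hgb)]
    simp only [intervalIntegral.integral_of_le ht]
    refine integral_congr_ae ?_
    filter_upwards [h.i] with s hs
    exact QInt_lin B hf hg hfb hgb ha hb (h.s s) (IU_mono li hs)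
  unfold JJ
  rw [e1, e2]; ring

lemma FP_zero : (fun _ => 0 : FV d) ∈ FP d :=
  ⟨fun v => by simpa using (ww_one v).trans' zero_le_one, fun v v' => by
    simp only [sub_self, abs_zero]; have := ww_one v; have := ww_one v'; positivity⟩

lemma F3_U2 {K : ℝ} (hK : 0 ≤ K) {g : FV d} (h1 : ∀ v, |g v| ≤ (jb v) ^ 3)
    (h2 : ∀ v, 2 * K < ‖v‖ → g v = 0) (v : Vd d) : |g v| ≤ (1 + 2 * K) * (jb v) ^ r2 := by
  have n := norm_nonneg v
  rw [Real.rpow_two]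
  rcases lt_or_ge (2 * K) ‖v‖ with h | h
  · rw [h2 v h]; simp; positivity
  · refine (h1 v).trans ?_
    rw [pow_succ, mul_comm]; gcongr

/-- pointwise estimate -/
lemma pt_est {κ : ℝ} (hL : IsLipschitzKernel B κ) {p s K b φ : ℝ} (hp : 2 ≤ p) (hK : 1 ≤ K) (hs : 0 ≤ s)
    {ν μ : ℝ → MV d} (hν : GP p s ν) (i1 : IU (p + 1) (ν s)) (i2 : IU (p + 1) (μ s)) (hμs : μ s ∈ boltzmannSphere d)
    (hb : ∀ g ∈ F3 d (2 * K), ∫ v, g v ∂(ν s) - JJ B ν s g ≤ b)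
    (hφ : ∀ f ∈ FP d, JJ B ν s f - ∫ v, f v ∂(μ s) ≤ φ) {f : FV d} (hf : f ∈ FP d) :
    8 * K * (JJ B ν s f - ∫ v, f v ∂(μ s)) + (QInt B f (ν s) (ν s) - QInt B f (μ s) (μ s)) ≤
      (8 * K + (12 + 2 * κ) * (mU 3 (ν s) + mU 3 (μ s))) * φ +
      ((16 + 2 * κ) * (mU 3 (ν s) + mU 3 (μ s)) * b + 64 * K ^ (2 - p) * (mU (p + 1) (ν s) + mU (p + 1) (μ s))) := by
  have pν := (hν.s s).1
  have pμ := hμs.1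
  have hκ := hL.1
  have K0 : 0 < K := by linarith
  have i13 : IU 3 (ν s) := IU_mono li i1
  have i23 : IU 3 (μ s) := IU_mono li i2
  have fm := (FP.cont hf).measurable
  set m := mU 3 (ν s) + mU 3 (μ s) with hm
  have m1 : 1 ≤ mU 3 (ν s) := BS_one_le (hν.s s) nq i13
  have m2 : 1 ≤ mU 3 (μ s) := BS_one_le hμs nq i23
  set G : FV d := fun v => AK B K f (ν s) v + AK B K f (μ s) v with hG
  have a1 := AK_F3 hL hf K0 i13
  have a2 := AK_F3 hL hf K0 i23
  have d1 := AK_diss hL hf K0 (le_refl (4 * K)) i13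
  have d2 := AK_diss hL hf K0 (le_refl (4 * K)) i23
  have Gm : Measurable G := (AK_meas B hf K _).add (AK_meas B hf K _)
  set c3 := (16 + 2 * κ) * m with hc3
  have c3p : 0 < c3 := by positivity
  set l := 8 * K + (12 + 2 * κ) * m with hl
  have lp : 0 < l := by positivity
  have absadd : ∀ {a b c e x : ℝ}, |a| ≤ c → |b| ≤ e → x = a + b → |x| ≤ c + e := by
    rintro a b c e x h1 h2 rfl; exact (abs_add_le a b).trans (add_le_add h1 h2)
  have scl : ∀ {c x y : ℝ}, 0 < c → |x| ≤ c * y → |c⁻¹ * x| ≤ y := by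
    intro c x y hc h
    rw [abs_mul, abs_of_pos (inv_pos.2 hc), inv_mul_le_iff₀ hc]; exact h
  have gF3 : (fun v => c3⁻¹ * G v) ∈ F3 d (2 * K) := by
    refine ⟨fun v => scl c3p ?_, fun v v' => ?_, fun v hv => ?_⟩
    · exact (absadd (a1.1 v) (a2.1 v) rfl).trans (le_of_eq (by rw [hc3, hm]; ring))
    · rw [← mul_sub]
      refine scl c3p ((absadd (a1.2.1 v v') (a2.2.1 v v') (by rw [hG]; ring)).trans (le_of_eq (by rw [hc3, hm]; ring)))
    · simp only [hG, a1.2.2 v hv, a2.2.2 v hv]; simp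
  have lF : (fun v => l⁻¹ * (8 * K * f v + G v)) ∈ FP d := by
    refine ⟨fun v => scl lp ?_, fun v v' => ?_⟩
    · exact (absadd (d1.1 v) (d2.1 v) (by rw [hG]; ring)).trans (le_of_eq (by rw [hl, hm]; ring))
    · rw [← mul_sub]
      exact scl lp ((absadd (d1.2 v v') (d2.2 v v') (by rw [hG]; ring)).trans (le_of_eq (by rw [hl, hm]; ring)))
  have gU : ∀ v, |G v| ≤ (c3 * (1 + 2 * K)) * (jb v) ^ r2 := fun v => by
    have := F3_U2 K0.le gF3.1 gF3.2.2 v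
    rw [abs_mul, abs_of_pos (inv_pos.2 c3p), inv_mul_le_iff₀ c3p] at this
    linarith
  have fU := FP.leU hf
  have zU : ∀ v : Vd d, |(0:ℝ)| ≤ 0 * (jb v) ^ r2 := fun v => by simp
  have z2 : ∀ (X : MV d), ∫ _ : Vd d, (0:ℝ) ∂X = 0 := fun X => by simp
  have hJz : JJ B ν s (fun _ => 0) = 0 := by
    have := JJ_lin B hν hs hp (c := 1) (f := fun _ : Vd d => (0:ℝ)) (g := fun _ => 0) measurable_const measurable_const zU zU le_rfl le_rfl
    simp only [mul_zero, add_zero, one_mul] at this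
    linarith
  have C2 : 0 ≤ c3 * (1 + 2 * K) := by positivity
  have J1 := JJ_lin B hν hs hp (c := c3⁻¹) Gm measurable_const gU zU C2 le_rfl
  have J2 := JJ_lin B hν hs hp (c := 8 * K) fm Gm fU gU zero_le_one C2
  have hHm : Measurable fun v => 8 * K * f v + G v := (fm.const_mul _).add Gm
  have hHU : ∀ v, |8 * K * f v + G v| ≤ l * (jb v) ^ r2 := fun v => by
    have := FP.leU lF v
    rw [abs_mul, abs_of_pos (inv_pos.2 lp), inv_mul_le_iff₀ lp] at this
    linarith
  have J3 := JJ_lin B hν hs hp (c := l⁻¹) hHm measurable_const hHU zU lp.le le_rfl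
  simp only [add_zero, hJz] at J1 J3
  have I2 := BS_IU2 hμs
  have e1 : ∫ v, (8 * K * f v + G v) ∂(μ s) = 8 * K * ∫ v, f v ∂(μ s) + ∫ v, G v ∂(μ s) := by
    rw [integral_add ((int_of_U fm fU I2).const_mul _) (int_of_U Gm gU I2), integral_const_mul]
  have f1 := hφ _ lF
  rw [J3, integral_const_mul, ← mul_sub, inv_mul_le_iff₀ lp, J2, e1] at f1
  have f2 := hb _ gF3
  rw [J1, integral_const_mul, ← mul_sub, inv_mul_le_iff₀ c3p] at f2
  have q1 := abs_le.1 (q_one B hf hK hp (hν.s s) i1)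
  have q2 := abs_le.1 (q_one B hf hK hp hμs i2)
  have sw := AK_swap B hf K i23 i13
  have int : ∀ {X Y : MV d} [IsProbabilityMeasure X] [IsProbabilityMeasure Y], IU 3 X → IU 3 Y → Integrable (AK B K f X) Y :=
    fun {X Y} _ _ hX hY => int_of_U (q := 3) (AK_meas B hf K _) (fun v => by rw [rpow3]; exact (AK_F3 hL hf K0 hX).1 v) hY
  have g1 : ∫ v, G v ∂(ν s) = ∫ v, AK B K f (ν s) v ∂(ν s) + ∫ v, AK B K f (μ s) v ∂(ν s) :=
    integral_add (int i13 i13) (int i23 i13)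
  have g2 : ∫ v, G v ∂(μ s) = ∫ v, AK B K f (ν s) v ∂(μ s) + ∫ v, AK B K f (μ s) v ∂(μ s) :=
    integral_add (int i13 i23) (int i23 i23)
  linarith [q1.2, q2.1]

theorem stability {κ : ℝ} (hL : IsLipschitzKernel B κ) {p T K b φ0 : ℝ} (hp : 2 ≤ p) (hK : 1 ≤ K) (hT : 0 ≤ T) (hb0 : 0 ≤ b)
    {ν μ : ℝ → MV d} (hν : GP p T ν) (hμ : GP p T μ)
    (heq : ∀ f ∈ FP d, ∀ t ∈ Icc 0 T, ∫ v, f v ∂(μ t) = JJ B μ t f)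
    (hb : ∀ g ∈ F3 d (2 * K), ∀ s ∈ Icc 0 T, ∫ v, g v ∂(ν s) - JJ B ν s g ≤ b)
    (h0 : ∀ f ∈ FP d, ∫ v, f v ∂(ν 0) - ∫ v, f v ∂(μ 0) ≤ φ0) {f : FV d} (hf : f ∈ FP d) :
    JJ B ν T f - ∫ v, f v ∂(μ T) ≤ (φ0 + ∫ s in 0..T, ((16 + 2 * κ) * (mU 3 (ν s) + mU 3 (μ s)) * b +
      64 * K ^ (2 - p) * (mU (p + 1) (ν s) + mU (p + 1) (μ s)))) *
      Real.exp (∫ s in 0..T, (12 + 2 * κ) * (mU 3 (ν s) + mU 3 (μ s))) := by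
  have hκ := hL.1
  have K0 : 0 < K := by linarith
  set E : ℝ → (FV d) → ℝ := fun t f => JJ B ν t f - ∫ v, f v ∂(μ t) with hE
  set k : ℝ → ℝ := fun s => mU 3 (ν s) + mU 3 (μ s) with hk
  have k0 : ∀ s, 0 ≤ k s := fun s => add_nonneg (mU_nonneg _ _) (mU_nonneg _ _)
  have ki : IntervalIntegrable k volume 0 T := (hν.k3 hT hp).add (hμ.k3 hT hp)
  set q : (FV d) → ℝ → ℝ := fun f s => QInt B f (ν s) (ν s) - QInt B f (μ s) (μ s) with hq
  have n1 := fun f (hf : f ∈ FP d) => hν.qi B hT hp (FP.cont hf).measurable zero_le_one (FP.leU hf)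
  have n2 := fun f (hf : f ∈ FP d) => hμ.qi B hT hp (FP.cont hf).measurable zero_le_one (FP.leU hf)
  have qi : ∀ f ∈ FP d, IntervalIntegrable (q f) volume 0 T := fun f hf => (n1 f hf).sub (n2 f hf)
  have sub : ∀ {t}, t ∈ Icc 0 T → uIcc 0 t ⊆ uIcc 0 T := fun {t} ht => by
    rw [uIcc_of_le hT, uIcc_of_le ht.1]; exact Icc_subset_Icc_right ht.2
  have qb : ∀ f ∈ FP d, ∀ᵐ s ∂(volume.restrict (Ioc 0 T)), |q f s| ≤ 72 * k s := fun f hf => by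
    filter_upwards [hν.qb B hp (FP.cont hf).measurable zero_le_one (FP.leU hf),
      hμ.qb B hp (FP.cont hf).measurable zero_le_one (FP.leU hf)] with s h1 h2
    refine (abs_sub _ _).trans ?_
    rw [hk]; linarith
  have Eeq : ∀ f ∈ FP d, ∀ t ∈ Icc 0 T, E t f = E 0 f + ∫ s in 0..t, q f s := by
    intro f hf t ht
    simp only [hE, hq]
    rw [heq f hf t ht, intervalIntegral.integral_sub ((n1 f hf).mono_set (sub ht)) ((n2 f hf).mono_set (sub ht))]
    simp only [JJ, intervalIntegral.integral_same]; ring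
  have Ed : ∀ f ∈ FP d, ∀ s ∈ Icc 0 T, ∀ t ∈ Icc 0 T, s ≤ t → |E t f - E s f| ≤ 72 * (∫ r in 0..t, k r) - 72 * ∫ r in 0..s, k r := by
    intro f hf s hs t ht hst
    rw [Eeq f hf t ht, Eeq f hf s hs, add_sub_add_left_eq_sub, intervalIntegral.integral_interval_sub_left
      ((qi f hf).mono_set (sub ht)) ((qi f hf).mono_set (sub hs)), ← mul_sub, intervalIntegral.integral_interval_sub_left
      (ki.mono_set (sub ht)) (ki.mono_set (sub hs)), ← intervalIntegral.integral_const_mul]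
    have hss : Ioc s t ⊆ Ioc 0 T := Ioc_subset_Ioc hs.1 ht.2
    refine intervalIntegral.norm_integral_le_of_norm_le (f := q f) (g := fun r => 72 * k r) hst ?_ ((ki.mono_set ?_).const_mul 72)
    · exact (ae_restrict_iff' measurableSet_Ioc).1 (ae_restrict_of_ae_restrict_of_subset hss (qb f hf))
    · rw [uIcc_of_le hst, uIcc_of_le hT]; exact Icc_subset_Icc hs.1 ht.2
  have E0b : ∀ f ∈ FP d, E 0 f ≤ φ0 := fun f hf => by
    simpa only [hE, JJ, intervalIntegral.integral_same, add_zero] using h0 f hf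
  set Λ : ℝ → ℝ := fun t => 72 * ∫ r in 0..t, k r with hΛ
  have Λ0 : Λ 0 = 0 := by simp [hΛ]
  have Z : (fun _ => 0 : FV d) ∈ FP d := FP_zero
  have bdd : ∀ t ∈ Icc 0 T, ∀ f ∈ FP d, E t f ≤ φ0 + Λ t := fun t ht f hf => by
    have := abs_le.1 (Ed f hf 0 ⟨le_rfl, hT⟩ t ht ht.1)
    have := E0b f hf
    have : Λ 0 = 0 := Λ0
    simp only [hΛ] at *
    linarith
  set φ : ℝ → ℝ := fun t => ⨆ f : FP d, E t f.1 with hφ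
  have bb : ∀ t ∈ Icc 0 T, BddAbove (range fun f : FP d => E t f.1) := fun t ht =>
    ⟨φ0 + Λ t, by rintro _ ⟨f, rfl⟩; exact bdd t ht f.1 f.2⟩
  have le : ∀ t ∈ Icc 0 T, ∀ f ∈ FP d, E t f ≤ φ t := fun t ht f hf => le_ciSup (bb t ht) (⟨f, hf⟩ : FP d)
  have ne : Nonempty (FP d) := ⟨⟨_, Z⟩⟩
  have φd : ∀ s ∈ Icc 0 T, ∀ t ∈ Icc 0 T, s ≤ t → |φ t - φ s| ≤ Λ t - Λ s := by
    intro s hs t ht hst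
    rw [abs_le]
    have : ∀ f : FP d, E t f.1 ≤ φ s + (Λ t - Λ s) := fun f => by
      have := (abs_le.1 (Ed f.1 f.2 s hs t ht hst)).2
      linarith [le s hs f.1 f.2]
    have h1 : φ t ≤ φ s + (Λ t - Λ s) := ciSup_le this
    have : ∀ f : FP d, E s f.1 ≤ φ t + (Λ t - Λ s) := fun f => by
      have := (abs_le.1 (Ed f.1 f.2 s hs t ht hst)).1
      linarith [le t ht f.1 f.2]
    have h2 : φ s ≤ φ t + (Λ t - Λ s) := ciSup_le this
    constructor <;> linarith
  have Λc : ContinuousOn Λ (Icc 0 T) := by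
    have : ContinuousOn (fun t => ∫ r in 0..t, k r) (uIcc 0 T) := intervalIntegral.continuousOn_primitive_interval' ki left_mem_uIcc
    rw [uIcc_of_le hT] at this
    exact continuousOn_const.mul this
  have φc : ContinuousOn φ (Icc 0 T) := by
    intro x hx
    have hc := Λc x hx
    rw [ContinuousWithinAt, tendsto_iff_dist_tendsto_zero] at hc ⊢
    refine squeeze_zero' (Eventually.of_forall fun _ => dist_nonneg) ?_ hc
    filter_upwards [self_mem_nhdsWithin] with y hy
    rw [Real.dist_eq, Real.dist_eq]
    rcases le_total x y with h | h
    · exact (φd x hx y hy h).trans (le_abs_self _)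
    · rw [abs_sub_comm, abs_sub_comm (Λ y)]; exact (φd y hy x hx h).trans (le_abs_self _)
  set β : ℝ → ℝ := fun s => (16 + 2 * κ) * k s * b + 64 * K ^ (2 - p) * (mU (p + 1) (ν s) + mU (p + 1) (μ s)) with hβ
  have βi : IntervalIntegrable β volume 0 T := ((ki.const_mul _).mul_const b).add ((hν.k.add hμ.k).const_mul _)
  have β0 : ∀ s, 0 ≤ β s := fun s => by
    have := k0 s
    have := mU_nonneg (p + 1) (ν s)
    have := mU_nonneg (p + 1) (μ s)
    simp only [hβ]; positivity
  have ineq : ∀ t ∈ Icc 0 T, Real.exp (8 * K * t) * φ t ≤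
      φ0 + ∫ s in 0..t, Real.exp (8 * K * s) * ((8 * K + (12 + 2 * κ) * k s) * φ s + β s) := by
    intro t ht
    have : ∀ f : FP d, Real.exp (8 * K * t) * E t f.1 ≤
      φ0 + ∫ s in 0..t, Real.exp (8 * K * s) * ((8 * K + (12 + 2 * κ) * k s) * φ s + β s) := by
      rintro ⟨f, hf⟩
      have qit := (qi f hf).mono_set (sub ht)
      simp only
      rw [Eeq f hf t ht, ibp qit]
      refine add_le_add (E0b f hf) ?_
      have hcE : ContinuousOn (fun s => E 0 f + ∫ r in 0..s, q f r) (uIcc 0 t) :=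
        continuousOn_const.add (intervalIntegral.continuousOn_primitive_interval' qit left_mem_uIcc)
      refine intervalIntegral.integral_mono_ae_restrict ht.1 ?_ ?_ ?_
      · refine IntervalIntegrable.continuousOn_mul ?_ fp
        exact (hcE.intervalIntegrable.const_mul _).add qit
      · refine IntervalIntegrable.continuousOn_mul ?_ fp
        refine IntervalIntegrable.add ?_ (βi.mono_set (sub ht))
        refine ((intervalIntegrable_const).add ((ki.mono_set (sub ht)).const_mul _)).mul_continuousOn ?_
        rw [uIcc_of_le ht.1]; exact φc.mono (Icc_subset_Icc_right ht.2)
      · have hn : ∀ᵐ x : ℝ, x ≠ 0 := by simp [ae_iff, measure_singleton]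
        have h1 := (ae_restrict_iff' measurableSet_Ioc).1 hν.i
        have h2 := (ae_restrict_iff' measurableSet_Ioc).1 hμ.i
        rw [EventuallyLE, ae_restrict_iff' measurableSet_Icc]
        filter_upwards [hn, h1, h2] with s hn h1 h2 hs
        have hsT : s ∈ Icc 0 T := ⟨hs.1, hs.2.trans ht.2⟩
        have hs' : s ∈ Ioc 0 T := ⟨lt_of_le_of_ne hs.1 hn.symm, hsT.2⟩
        refine mll ?_ (Real.exp_pos _).le
        rw [← Eeq f hf s hsT]
        exact pt_est B hL hp hK hs.1 (hν.mono hs.1 hsT.2) (h1 hs') (h2 hs') (hμ.s s) (fun g hg => hb g hg s hsT)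
          (le s hsT) hf
    have : φ t ≤ (Real.exp (8 * K * t))⁻¹ * (φ0 + ∫ s in 0..t, Real.exp (8 * K * s) * ((8 * K + (12 + 2 * κ) * k s) * φ s + β s)) :=
      ciSup_le fun f => by rw [le_inv_mul_iff₀ (Real.exp_pos _)]; exact this f
    rwa [le_inv_mul_iff₀ (Real.exp_pos _)] at this
  have := gronwall hT po φc (ki.const_mul (12 + 2 * κ)) βi (fun s => by have := k0 s; positivity) β0 ineq
  exact (le T ⟨hT, le_rfl⟩ f hf).trans this
end

section
lemma bern {q x y : ℝ} (hq : 1 ≤ q) (hx : 0 ≤ x) (hy : 0 ≤ y) : (x + y) ^ q - x ^ q ≤ q * y * (x + y) ^ (q - 1) := by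
  rcases (add_nonneg hx hy).eq_or_lt with h | h
  · have : y = 0 := by linarith
    subst this; simp
  have h1 := one_add_mul_self_le_rpow_one_add (s := -(y / (x + y))) (by
    rw [neg_le_neg_iff, div_le_one h]; linarith) hq
  have e : 1 + -(y / (x + y)) = x / (x + y) := by field_simp; ring
  rw [e, Real.div_rpow hx h.le, le_div_iff₀ (Real.rpow_pos_of_pos h q)] at h1
  have e2 : (x + y) ^ q = (x + y) ^ (q - 1) * (x + y) := by
    rw [← Real.rpow_add_one h.ne']; ring_nf
  have : (1 + q * -(y / (x + y))) * (x + y) ^ q = (x + y) ^ q - q * y * (x + y) ^ (q - 1) := by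
    rw [e2]; field_simp; ring
  linarith

lemma theta {r x y : ℝ} (hr : 0 < r) (hx : 0 ≤ x) (hy : 0 ≤ y) (hz : 0 < x + y) :
    x * x ^ r + y * y ^ r ≤ (x + y) * (x + y) ^ r - 2 * min r 1 * ((x + y) * (x + y) ^ r / (x + y) ^ 2) * (x * y) := by
  have key : ∀ a b : ℝ, 0 ≤ a → 0 ≤ b → 0 < a + b → a ^ r ≤ (a + b) ^ r * (1 - min r 1 * (b / (a + b))) := by
    intro a b ha hb hab
    have t0 : 0 ≤ a / (a + b) := by positivity
    have t1 : a / (a + b) ≤ 1 := by rw [div_le_one hab]; linarith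
    have e : 1 - b / (a + b) = a / (a + b) := by field_simp; ring
    have : (a / (a + b)) ^ r ≤ 1 - min r 1 * (b / (a + b)) := by
      rcases le_total r 1 with h | h
      · rw [min_eq_left h]
        have := rpow_one_add_le_one_add_mul_self (s := a / (a + b) - 1) li hr.le h
        rw [add_sub_cancel] at this
        rw [← e] at this ⊢
        linarith
      · rw [min_eq_right h, one_mul, e]
        calc _ ≤ (a / (a + b)) ^ (1:ℝ) := Real.rpow_le_rpow_of_exponent_ge' t0 t1 nq h
          _ = _ := Real.rpow_one _
    rw [Real.div_rpow ha hab.le, div_le_iff₀ (Real.rpow_pos_of_pos hab r)] at this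
    linarith
  have k1 := mll (key x y hx hy hz) hx
  have k2 := mll (key y x hy hx li) hy
  rw [add_comm y x] at k2
  refine (add_le_add k1 k2).trans (le_of_eq ?_)
  field_simp
  ring

def psi (r K x : ℝ) : ℝ := x * (min x K) ^ r

lemma psi_super {r K x y : ℝ} (hr : 0 < r) (hK : 0 ≤ K) (hx : 0 ≤ x) (hy : 0 ≤ y) :
    psi r K x + psi r K y ≤ psi r K (x + y) := by
  unfold psi
  rw [add_mul]
  have h1 : 0 ≤ min x K := le_min hx hK
  have h2 : 0 ≤ min y K := le_min hy hK
  gcongr <;> linarith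

lemma psi_nonneg {r K x : ℝ} (hK : 0 ≤ K) (hx : 0 ≤ x) : 0 ≤ psi r K x :=
  mul_nonneg hx (Real.rpow_nonneg (le_min hx hK) _)

lemma psi_diff {r K x y : ℝ} (hr : 0 < r) (hK : 0 ≤ K) (hy : 0 ≤ y) (hyx : y ≤ x) :
    psi r K (x + y) - psi r K x ≤ (1 + r) * 2 ^ r * y * x ^ r := by
  have hx : 0 ≤ x := hy.trans hyx
  have x1 : ∀ {a : ℝ}, 0 ≤ a → a * a ^ r = a ^ (1 + r) := fun {a} ha => by
    rw [Real.rpow_one_add' ha li]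
  have o2 : (1:ℝ) ≤ 2 ^ r := Real.one_le_rpow nq hr.le
  have p : 0 ≤ x ^ r := by positivity
  unfold psi
  rcases le_or_gt K x with h | h
  · rw [min_eq_right h, min_eq_right li]
    have : K ^ r ≤ x ^ r := by gcongr
    calc _ = 1 * 1 * y * K ^ r := by ring
      _ ≤ _ := by gcongr; linarith
  · rw [min_eq_left h.le]
    have : (x + y) * min (x + y) K ^ r ≤ (x + y) * (x + y) ^ r := by
      have : 0 ≤ min (x + y) K := le_min li hK
      gcongr; exact min_le_left _ _
    have b := bern (q := 1 + r) li hx hy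
    rw [← x1 hx, ← x1 (add_nonneg hx hy), show 1 + r - 1 = r by ring] at b
    have : (x + y) ^ r ≤ 2 ^ r * x ^ r := by
      rw [← Real.mul_rpow nq hx]; gcongr; linarith
    calc _ ≤ (1 + r) * y * (x + y) ^ r := by linarith
      _ ≤ (1 + r) * y * (2 ^ r * x ^ r) := by gcongr
      _ = _ := by ring

def fK (r K : ℝ) (v : Vd d) : ℝ := psi r K (‖v‖ ^ 2)

lemma fK_cont {r K : ℝ} (hr : 0 < r) : Continuous (fK r K : FV d) := by
  unfold fK psi
  exact (by fun_prop : Continuous fun v : Vd d => ‖v‖ ^ 2).mul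
    (Continuous.rpow_const fp (fun _ => Or.inr hr.le))

variable (B : Vd d → MV d) [hC : CK B]

lemma exists_c0 : ∃ c0 > 0, ∀ w : Vd d, ∫ σ, (‖w‖ ^ 2 - ⟪w, σ⟫ ^ 2) ∂(B w) = c0 * ‖w‖ ^ 3 := by
  obtain ⟨u0, hu0⟩ := exists_unit (CK.hd B)
  have hB := CK.hB (B := B)
  have hp := hB.prob u0 hu0
  have sph := B_sphere B u0
  refine ⟨∫ σ, (1 - ⟪u0, σ⟫ ^ 2) ∂(B u0), ?_, fun w => ?_⟩
  · have le : ∀ σ : Vd d, ‖σ‖ = 1 → ⟪u0, σ⟫ ^ 2 ≤ 1 := fun σ hσ => by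
      have := abs_real_inner_le_norm u0 σ
      rw [hu0, hσ, one_mul] at this
      exact (sq_le_one_iff_abs_le_one _).2 this
    have i : Integrable (fun σ => 1 - ⟪u0, σ⟫ ^ 2) (B u0) := B_integrable B (c := 1) fp (fun σ hσ => by
      have := le σ hσ
      rw [abs_le]; constructor <;> nlinarith [sq_nonneg (⟪u0, σ⟫)])
    rw [gt_iff_lt, integral_pos_iff_support_of_nonneg_ae (sph.mono fun σ hσ => by simpa using le σ hσ) i]
    have sup : ∀ᵐ σ ∂(B u0), σ ∈ Function.support fun σ => 1 - ⟪u0, σ⟫ ^ 2 := by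
      have h1 := hB.support u0 hu0
      have h2 : ∀ᵐ σ ∂(B u0), σ ∈ unitSphere d \ {u0, -u0} := h1
      filter_upwards [h2] with σ hσ
      rw [Function.mem_support]
      intro h0
      have hn : ‖σ‖ = 1 := hσ.1
      have : (⟪u0, σ⟫ - 1) * (⟪u0, σ⟫ + 1) = 0 := by nlinarith
      rcases mul_eq_zero.1 this with h | h
      · apply hσ.2; left
        exact ((inner_eq_one_iff_of_norm_eq_one (𝕜 := ℝ) hu0 hn).1 li).symm
      · apply hσ.2; right
        have := (inner_eq_one_iff_of_norm_eq_one (𝕜 := ℝ) (x := -u0) (y := σ) (by simpa using hu0) hn).1 (by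
          rw [inner_neg_left]; linarith)
        exact this.symm
    rw [measure_eq_measure_of_null_sdiff (subset_univ _) (by
      have : ((univ : Set (Vd d)) \ Function.support fun σ => 1 - ⟪u0, σ⟫ ^ 2) =
        {σ | ¬ σ ∈ Function.support fun σ => 1 - ⟪u0, σ⟫ ^ 2} := by ext; simp
      rw [this]; exact sup), measure_univ]
    exact one_pos
  · by_cases hw : w = 0
    · simp [hw, B_zero]
    set u := ‖w‖⁻¹ • w with hu
    have hu1 := norm_inv_smul hw
    have hwu : w = ‖w‖ • u := by rw [hu, smul_smul, mul_inv_cancel₀ (norm_ne_zero_iff.2 hw), one_smul]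
    let R := ((ℝ ∙ (u0 - u))ᗮ).reflection
    have hR : R u0 = u := Submodule.reflection_sub (by rw [hu0, hu1])
    have e := hB.symm R u0 hu0
    rw [hR] at e
    rw [B_int_eq, bk_apply, ← hu, e, integral_map (by exact R.continuous.measurable.aemeasurable) (by
      exact Continuous.aestronglyMeasurable fp)]
    have : ∀ σ, ‖w‖ ^ 2 - ⟪w, R σ⟫ ^ 2 = ‖w‖ ^ 2 * (1 - ⟪u0, σ⟫ ^ 2) := fun σ => by
      have : ⟪w, R σ⟫ = ‖w‖ * ⟪u0, σ⟫ := by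
        conv_lhs => rw [hwu]
        rw [← hR, inner_smul_left, LinearIsometryEquiv.inner_map_map]; rfl
      rw [this]; ring
    simp only [this]
    rw [integral_const_mul]; ring

lemma xy_post {σ : Vd d} (hσ : ‖σ‖ = 1) (v vs : Vd d) :
    ‖v - vs‖ ^ 2 * (‖v - vs‖ ^ 2 - ⟪v - vs, σ⟫ ^ 2) - 4 * ‖v - vs‖ ^ 2 * (‖vs‖ * (‖v‖ + ‖v - vs‖ + ‖vs‖)) ≤
      4 * (‖postV v vs σ‖ ^ 2 * ‖postVs v vs σ‖ ^ 2) := by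
  rw [postV_sq hσ, postVs_sq hσ]
  have h2 := norm_sub_sq_real v vs
  have e : v + vs = (v - vs) + r2 • vs := by rw [two_smul]; abel
  have e2 : ⟪v + vs, σ⟫ = ⟪v - vs, σ⟫ + 2 * ⟪vs, σ⟫ := by
    rw [e, inner_add_left, inner_smul_left]; rfl
  rw [e2]
  have i1 := abs_real_inner_le_norm (v - vs) σ
  have i2 := abs_real_inner_le_norm vs σ
  have i3 := abs_le.1 (abs_real_inner_le_norm v vs)
  rw [hσ, mul_one] at i1 i2
  have n1 := norm_nonneg v
  have n2 := norm_nonneg vs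
  have n3 := norm_nonneg (v - vs)
  generalize ⟪v - vs, σ⟫ = t at *
  generalize ⟪vs, σ⟫ = s at *
  generalize ⟪v, vs⟫ = m at *
  generalize ‖v - vs‖ = w at *
  generalize ‖v‖ = a at *
  generalize ‖vs‖ = b at *
  have j1 : t * s ≤ w * b := by
    calc t * s ≤ |t * s| := le_abs_self _
      _ = |t| * |s| := abs_mul _ _
      _ ≤ w * b := by gcongr
  have j2 : s ^ 2 ≤ b ^ 2 := by rw [← sq_abs]; gcongr
  have j3 : w ^ 4 - 4 * (a * b) * w ^ 2 ≤ (a ^ 2 + b ^ 2) ^ 2 := by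
    have : w ^ 2 - 2 * (a * b) ≤ a ^ 2 + b ^ 2 := by linarith
    have : (0:ℝ) ≤ a * b := by positivity
    rcases le_total (2 * (a * b)) (w ^ 2) with h | h
    · nlinarith
    · nlinarith [sq_nonneg (a ^ 2 + b ^ 2), sq_nonneg w]
  have w2 := sq_nonneg w
  nlinarith [mll j1 w2, mll j2 w2]

lemma pov_up {r : ℝ} (hr : 0 < r) {K : ℝ} (hK : 0 ≤ K) {v vs : Vd d} (h : ‖vs‖ ≤ ‖v‖) :
    ‖v - vs‖ * (psi r K (‖v‖ ^ 2 + ‖vs‖ ^ 2) - psi r K (‖v‖ ^ 2) - psi r K (‖vs‖ ^ 2)) ≤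
      2 * ((1 + r) * 2 ^ r) * (‖v‖ ^ 2 * (‖v‖ ^ 2) ^ r * ‖vs‖) := by
  have n1 := norm_nonneg v
  have n2 := norm_nonneg vs
  have h1 := psi_diff hr hK (sq_nonneg ‖vs‖) (x := ‖v‖ ^ 2) (by gcongr)
  have h2 := psi_nonneg (r := r) hK (sq_nonneg ‖vs‖)
  have p : 0 ≤ (‖v‖ ^ 2) ^ r := by positivity
  have h3 : ‖v - vs‖ ≤ 2 * ‖v‖ := (norm_sub_le _ _).trans li
  calc _ ≤ ‖v - vs‖ * ((1 + r) * 2 ^ r * ‖vs‖ ^ 2 * (‖v‖ ^ 2) ^ r) := by gcongr; linarith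
    _ ≤ 2 * ‖v‖ * ((1 + r) * 2 ^ r * (‖v‖ * ‖vs‖) * (‖v‖ ^ 2) ^ r) := by gcongr; nlinarith
    _ = _ := by ring

lemma pov_up1 {r : ℝ} (hr : 0 < r) {K : ℝ} (hK : 0 ≤ K) {v vs : Vd d} (h : ‖vs‖ ≤ ‖v‖) :
    cQ B (fK r K) v vs ≤ 2 * ((1 + r) * 2 ^ r) * (‖v‖ ^ 2 * (‖v‖ ^ 2) ^ r * ‖vs‖) := by
  refine (B_int_le B (Dl_int B (LB.of_cont (fK_cont hr)) v vs) (fun σ hσ => ?_)).trans (pov_up hr hK h)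
  unfold Dl fK
  have := psi_super hr hK (sq_nonneg ‖postV v vs σ‖) (sq_nonneg ‖postVs v vs σ‖)
  rw [energy hσ] at this
  linarith

lemma pov_gain {r : ℝ} (hr : 0 < r) {c0 : ℝ} (hc0 : 0 < c0)
    (H : ∀ w : Vd d, ∫ σ, (‖w‖ ^ 2 - ⟪w, σ⟫ ^ 2) ∂(B w) = c0 * ‖w‖ ^ 3) {K : ℝ} (hK : 0 ≤ K) {v vs : Vd d}
    (h1 : ‖vs‖ ≤ ‖v‖ / 4) (h2 : ‖vs‖ ≤ c0 / 40 * ‖v‖) (hz : ‖v‖ ^ 2 + ‖vs‖ ^ 2 ≤ K) :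
    cQ B (fK r K) v vs ≤ 2 * ((1 + r) * 2 ^ r) * (‖v‖ ^ 2 * (‖v‖ ^ 2) ^ r * ‖vs‖) -
      min r 1 * c0 / 128 * (‖v‖ ^ 2 * (‖v‖ ^ 2) ^ r * ‖v‖) := by
  have n1 := norm_nonneg v
  have n2 := norm_nonneg vs
  rcases n1.eq_or_lt with h0 | h0
  · have := pov_up1 B hr hK (v := v) (vs := vs) li
    rw [← h0] at this ⊢
    simpa using this
  set z := ‖v‖ ^ 2 + ‖vs‖ ^ 2 with hzd
  have z0 : 0 < z := by positivity
  set g := z * z ^ r / z ^ 2 with hg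
  have g0 : 0 ≤ g := by positivity
  set ρ := min r 1 with hρ
  have ρ0 : 0 < ρ := lt_min hr one_pos
  have pe : ∀ {x : ℝ}, x ≤ z → psi r K x = x * x ^ r := fun {x} hx => by rw [psi, min_eq_left (hx.trans hz)]
  have i1 : Integrable (fun σ => ‖postV v vs σ‖ ^ 2 * ‖postVs v vs σ‖ ^ 2) (B (v - vs)) :=
    B_integrable B (c := z ^ 2) (by unfold postV postVs; fun_prop) fun σ hσ => by
      have e := energy hσ v vs
      have s1 := sq_nonneg ‖postV v vs σ‖
      have s2 := sq_nonneg ‖postVs v vs σ‖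
      rw [abs_of_nonneg po]
      rw [← hzd] at e
      nlinarith
  have low : c0 * ‖v‖ ^ 5 / 64 ≤ ∫ σ, ‖postV v vs σ‖ ^ 2 * ‖postVs v vs σ‖ ^ 2 ∂(B (v - vs)) := by
    have i2 : Integrable (fun σ => ‖v - vs‖ ^ 2 - ⟪v - vs, σ⟫ ^ 2) (B (v - vs)) :=
      B_integrable B (c := ‖v - vs‖ ^ 2) fp fun σ hσ => by
        have := abs_real_inner_le_norm (v - vs) σ
        rw [hσ, mul_one] at this
        have h3 : ⟪v - vs, σ⟫ ^ 2 ≤ ‖v - vs‖ ^ 2 := by rw [← sq_abs]; gcongr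
        rw [abs_le]; constructor <;> nlinarith [sq_nonneg ⟪v - vs, σ⟫]
    have := B_int_mono B (v := v - vs) ((i2.const_mul (‖v - vs‖ ^ 2)).sub (integrable_const
      (4 * ‖v - vs‖ ^ 2 * (‖vs‖ * (‖v‖ + ‖v - vs‖ + ‖vs‖))))) (i1.const_mul 4) (fun σ hσ => xy_post hσ v vs)
    simp only [Pi.sub_apply] at this
    rw [integral_sub (i2.const_mul _) (integrable_const _), B_int_const, integral_const_mul, integral_const_mul, H] at this
    have w1 : 3 / 4 * ‖v‖ ≤ ‖v - vs‖ := by linarith [norm_sub_norm_le v vs]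
    have w2 : ‖v - vs‖ ≤ 5 / 4 * ‖v‖ := by linarith [norm_sub_le v vs]
    generalize ‖v - vs‖ = w at *
    have w0 : 0 ≤ w := by linarith
    have k1 : ‖vs‖ * (‖v‖ + w + ‖vs‖) ≤ c0 / 40 * ‖v‖ * (‖v‖ + 5 / 4 * ‖v‖ + ‖v‖ / 4) := by gcongr
    have k2 : (3 / 4 * ‖v‖) ^ 2 ≤ w ^ 2 := by gcongr
    have k3 : (3 / 4 * ‖v‖) ^ 3 ≤ w ^ 3 := by gcongr
    have k4 : c0 / 4 * ‖v‖ ^ 2 ≤ c0 * w ^ 2 - 4 * (‖vs‖ * (‖v‖ + w + ‖vs‖)) := by nlinarith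
    have k5 : (3 / 4 * ‖v‖) ^ 3 * (c0 / 4 * ‖v‖ ^ 2) ≤ w ^ 3 * (c0 * w ^ 2 - 4 * (‖vs‖ * (‖v‖ + w + ‖vs‖))) := by gcongr
    have k6 : 0 ≤ c0 * ‖v‖ ^ 5 := by positivity
    nlinarith
  have up : cQ B (fK r K) v vs ≤ ∫ σ, ((psi r K (‖v‖ ^ 2 + ‖vs‖ ^ 2) - psi r K (‖v‖ ^ 2) - psi r K (‖vs‖ ^ 2)) -
      2 * ρ * g * (‖postV v vs σ‖ ^ 2 * ‖postVs v vs σ‖ ^ 2)) ∂(B (v - vs)) := by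
    refine B_int_mono B (Dl_int B (LB.of_cont (fK_cont hr)) v vs) ((integrable_const _).sub (i1.const_mul _)) fun σ hσ => ?_
    have s1 := sq_nonneg ‖postV v vs σ‖
    have s2 := sq_nonneg ‖postVs v vs σ‖
    have e := energy hσ v vs
    rw [← hzd] at e
    have := theta hr s1 s2 (by rw [e]; exact z0)
    rw [e] at this
    unfold Dl fK
    rw [pe (x := ‖postV v vs σ‖ ^ 2) li, pe (x := ‖postVs v vs σ‖ ^ 2) li, ← hzd, pe (le_refl z)]
    linarith
  rw [integral_sub (integrable_const _) (i1.const_mul _), integral_const_mul, B_int_const] at up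
  have up2 := pov_up hr hK (v := v) (vs := vs) li
  have gl : ‖v‖ ^ 2 * (‖v‖ ^ 2) ^ r / (4 * ‖v‖ ^ 4) ≤ g := by
    rw [hg, div_le_div_iff₀ po po]
    have a1 : ‖v‖ ^ 2 ≤ z := by rw [hzd]; nlinarith
    have a2 : z ≤ 2 * ‖v‖ ^ 2 := by rw [hzd]; nlinarith
    calc _ ≤ (z * z ^ r) * (2 * ‖v‖ ^ 2) ^ 2 := by gcongr
      _ = _ := by ring
  have fin : ρ * c0 / 128 * (‖v‖ ^ 2 * (‖v‖ ^ 2) ^ r * ‖v‖) ≤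
      2 * ρ * g * ∫ σ, ‖postV v vs σ‖ ^ 2 * ‖postVs v vs σ‖ ^ 2 ∂(B (v - vs)) := by
    calc _ = 2 * ρ * (‖v‖ ^ 2 * (‖v‖ ^ 2) ^ r / (4 * ‖v‖ ^ 4)) * (c0 * ‖v‖ ^ 5 / 64) := by field_simp; norm_num
      _ ≤ _ := by gcongr
  linarith
end

section
variable (B : Vd d → MV d) [hC : CK B]

lemma sq_r (v : Vd d) {p : ℝ} (hp : 2 < p) : ‖v‖ ^ 2 * (‖v‖ ^ 2) ^ (p / 2 - 1) = ‖v‖ ^ p := by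
  have n := norm_nonneg v
  rw [← Real.rpow_one_add' po li, ← Real.rpow_natCast_mul n]
  congr 1; push_cast; ring

lemma p_succ {a p : ℝ} (ha : 0 ≤ a) (hp : 0 ≤ p) : a ^ (p + 1) = a ^ p * a := Real.rpow_add_one' ha li

open Classical in
lemma povzner {p : ℝ} (hp : 2 < p) : ∃ C ≥ 0, ∃ c > 0, ∀ K ≥ 0, ∀ v vs : Vd d,
    cQ B (fK (p / 2 - 1) K) v vs ≤ C * (‖v‖ ^ p * ‖vs‖ + ‖v‖ * ‖vs‖ ^ p) -
      if ‖v‖ ^ 2 + ‖vs‖ ^ 2 ≤ K then c * (‖v‖ ^ (p + 1) + ‖vs‖ ^ (p + 1)) else 0 := by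
  obtain ⟨c0, hc0, H⟩ := exists_c0 B
  set r := p / 2 - 1 with hr'
  have hr : 0 < r := by linarith
  set C1 := 2 * ((1 + r) * 2 ^ r) with hC1
  have C10 : 0 ≤ C1 := by positivity
  set c1 := min r 1 * c0 / 128 with hc1
  have c10 : 0 < c1 := by have : 0 < min r 1 := lt_min hr one_pos
                          positivity
  set δ := min (1 / 4) (c0 / 40) with hδ
  have δ0 : 0 < δ := lt_min nq po
  refine ⟨C1 + 2 * c1 / δ + c1, by positivity, c1, c10, fun K hK => ?_⟩
  have main : ∀ v vs : Vd d, ‖vs‖ ≤ ‖v‖ → cQ B (fK r K) v vs ≤ (C1 + 2 * c1 / δ + c1) * (‖v‖ ^ p * ‖vs‖ + ‖v‖ * ‖vs‖ ^ p) -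
      if ‖v‖ ^ 2 + ‖vs‖ ^ 2 ≤ K then c1 * (‖v‖ ^ (p + 1) + ‖vs‖ ^ (p + 1)) else 0 := by
    intro v vs h
    have n1 := norm_nonneg v
    have n2 := norm_nonneg vs
    have u := pov_up1 B hr hK h
    rw [sq_r v hp, ← hC1] at u
    have A0 : 0 ≤ ‖v‖ ^ p * ‖vs‖ := by positivity
    have B0 : 0 ≤ ‖v‖ * ‖vs‖ ^ p := by positivity
    have D0 : 0 ≤ 2 * c1 / δ := by positivity
    have s2 : ‖vs‖ ^ (p + 1) ≤ ‖v‖ * ‖vs‖ ^ p := by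
      rw [p_succ n2 li, mul_comm]; gcongr
    have s3 : ‖v‖ ^ (p + 1) = ‖v‖ ^ p * ‖v‖ := p_succ n1 li
    split_ifs with hz
    · rcases le_or_gt ‖vs‖ (δ * ‖v‖) with hd | hd
      · have g := pov_gain B hr hc0 H hK (v := v) (vs := vs)
          (hd.trans (by rw [div_eq_inv_mul]; gcongr; exact (min_le_left _ _).trans nq))
          (hd.trans (by gcongr; exact min_le_right _ _)) hz
        rw [sq_r v hp, ← hC1, ← hc1, ← s3] at g
        nlinarith [mll s2 c10.le, mul_nonneg D0 A0, mul_nonneg D0 B0, mul_nonneg C10 B0, mul_nonneg c10.le A0]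
      · have s4 : ‖v‖ ^ (p + 1) ≤ δ⁻¹ * (‖v‖ ^ p * ‖vs‖) := by
          rw [s3, le_inv_mul_iff₀ δ0]
          calc _ = ‖v‖ ^ p * (δ * ‖v‖) := by ring
            _ ≤ _ := by gcongr
        have s5 : c1 * ‖v‖ ^ (p + 1) ≤ c1 * (δ⁻¹ * (‖v‖ ^ p * ‖vs‖)) := by gcongr
        have e : 2 * c1 / δ = 2 * (c1 * δ⁻¹) := by ring
        rw [e] at D0 ⊢
        have : 0 ≤ c1 * δ⁻¹ := by positivity
        nlinarith [mll s2 c10.le, mul_nonneg this A0, mul_nonneg this B0, mul_nonneg C10 B0, mul_nonneg c10.le A0]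
    · nlinarith [mul_nonneg D0 A0, mul_nonneg D0 B0, mul_nonneg C10 B0, mul_nonneg c10.le A0, mul_nonneg c10.le B0]
  intro v vs
  rcases le_total ‖vs‖ ‖v‖ with h | h
  · exact main v vs h
  · have := main vs v h
    rw [cQ_symm B (fK_cont hr).measurable, add_comm (‖vs‖ ^ 2), add_comm (‖vs‖ ^ (p + 1))] at this
    refine this.trans (le_of_eq ?_)
    congr 2; ring

def gK (r K : ℝ) (v : Vd d) : ℝ := fK r K v + (-K ^ r) * ‖v‖ ^ 2

lemma gK_zero {r K : ℝ} {v : Vd d} (h : K ≤ ‖v‖ ^ 2) : gK r K v = 0 := by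
  unfold gK fK psi; rw [min_eq_right h]; ring

lemma gK_cont {r K : ℝ} (hr : 0 < r) : Continuous (gK r K : FV d) := by
  have := fK_cont (d := d) (K := K) hr
  unfold gK; fun_prop

lemma gK_bd {r K : ℝ} (hr : 0 < r) (hK : 0 ≤ K) (v : Vd d) : |gK r K v| ≤ K ^ r * K := by
  rcases le_or_gt K (‖v‖ ^ 2) with h | h
  · rw [gK_zero h, abs_zero]; positivity
  · unfold gK fK psi; rw [min_eq_left h.le]
    have : (‖v‖ ^ 2) ^ r ≤ K ^ r := by gcongr
    have : 0 ≤ (‖v‖ ^ 2) ^ r := by positivity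
    rw [show ‖v‖ ^ 2 * (‖v‖ ^ 2) ^ r + -K ^ r * ‖v‖ ^ 2 = -((K ^ r - (‖v‖ ^ 2) ^ r) * ‖v‖ ^ 2) by ring, abs_neg,
      abs_of_nonneg (mul_nonneg li po)]
    gcongr; linarith

lemma gK_supp {r K : ℝ} (hK : 0 ≤ K) : HasCompactSupport (gK r K : FV d) := by
  refine HasCompactSupport.of_support_subset_isCompact (isCompact_closedBall (0 : Vd d) (K + 1)) fun v hv => ?_
  rw [mem_closedBall_zero_iff]
  by_contra hc
  exact hv (gK_zero (by nlinarith))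

/-- truncated moment -/
def hK (p K : ℝ) : FV d := ({v : Vd d | ‖v‖ ^ 2 + 2 ≤ K}).indicator fun v => ‖v‖ ^ (p + 1)

lemma hK_meas (p K : ℝ) : Measurable (hK p K : FV d) :=
  Measurable.indicator fp (measurableSet_le fp fp)

lemma hK_nonneg (p K : ℝ) (v : Vd d) : 0 ≤ hK p K v := indicator_nonneg (fun v _ => by positivity) v

lemma hK_bd {p K : ℝ} (hp : 0 ≤ p) (hK0 : 0 ≤ K) (v : Vd d) : |hK p K v| ≤ (1 + K) ^ (p + 1) := by
  rw [abs_of_nonneg (hK_nonneg _ _ _)]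
  unfold hK
  by_cases hv : v ∈ {v : Vd d | ‖v‖ ^ 2 + 2 ≤ K}
  · rw [indicator_of_mem hv]
    have : ‖v‖ ≤ 1 + K := by
      have : ‖v‖ ^ 2 + 2 ≤ K := hv
      nlinarith [norm_nonneg v]
    gcongr
  · rw [indicator_of_notMem hv]; positivity

lemma half_mass {μ : MV d} (h : μ ∈ boltzmannSphere d) : 1 / 2 ≤ μ.real {v | ‖v‖ ^ 2 ≤ 2} := by
  have := h.1
  have ms : MeasurableSet {v : Vd d | ‖v‖ ^ 2 ≤ 2} := measurableSet_le fp fp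
  have h1 : ∫ v, (1 - ‖v‖ ^ 2 / 2) ∂μ ≤ ∫ v, ({v : Vd d | ‖v‖ ^ 2 ≤ 2}).indicator (fun _ => (1:ℝ)) v ∂μ := by
    refine integral_mono ((integrable_const _).sub ((BS_int2 h).div_const 2)) ((integrable_const _).indicator ms) fun v => ?_
    by_cases hv : v ∈ {v : Vd d | ‖v‖ ^ 2 ≤ 2}
    · rw [indicator_of_mem hv]; simp only; nlinarith [sq_nonneg ‖v‖]
    · rw [indicator_of_notMem hv]; simp only [Set.mem_ofPred_eq, not_le] at hv; simp only; linarith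
  rw [integral_indicator_const _ ms, integral_sub (integrable_const _) ((BS_int2 h).div_const 2), integral_div, h.2.2] at h1
  simp at h1 ⊢
  linarith

lemma pov_Q {p : ℝ} (hp : 2 < p) : ∃ C ≥ 0, ∃ c > 0, ∀ K ≥ 0, ∀ μ ∈ boltzmannSphere d, IU p μ →
    QInt B (gK (p / 2 - 1) K) μ μ ≤ C * mU p μ - c * ∫ v, hK p K v ∂μ := by
  obtain ⟨C, hC0, c, hc, H⟩ := povzner B hp
  refine ⟨C * 8, by positivity, c / 2, by positivity, fun K hK0 μ hμ hI => ?_⟩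
  have := hμ.1
  have hr : 0 < p / 2 - 1 := by linarith
  obtain ⟨i1, e1, -⟩ := cQ_prod B (gK_cont (K := K) hr).measurable (c := K ^ (p / 2 - 1) * K) po (q := 0) le_rfl
    (fun v => by rw [Real.rpow_zero, mul_one]; exact gK_bd hr hK0 v) (by rw [zero_add]; exact BS_IU1 hμ) (by rw [zero_add]; exact BS_IU1 hμ)
    (μ := μ) (ν := μ)
  set S : Set (Vd d) := {v | ‖v‖ ^ 2 ≤ 2} with hS
  have mS : MeasurableSet S := measurableSet_le fp fp
  have I1 : Integrable (fun v : Vd d => 1 + ‖v‖) μ := by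
    have := BS_IU1 hμ
    unfold IU at this; simpa only [Real.rpow_one] using this
  have j1 := hI.mul_prod I1
  have j2 := I1.mul_prod hI
  have hKi : Integrable (hK p K : FV d) μ :=
    Integrable.of_bound (hK_meas p K).aestronglyMeasurable _ (ae_of_all _ (hK_bd li hK0))
  have j3 := hKi.mul_prod ((integrable_const (μ := μ) (1:ℝ)).indicator mS)
  have j12 : Integrable (fun z : Vd d × Vd d => (1 + ‖z.1‖) ^ p * (1 + ‖z.2‖) + (1 + ‖z.1‖) * (1 + ‖z.2‖) ^ p) (μ.prod μ) := j1.add j2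
  have R : Integrable (fun z : Vd d × Vd d => C * ((1 + ‖z.1‖) ^ p * (1 + ‖z.2‖) + (1 + ‖z.1‖) * (1 + ‖z.2‖) ^ p)
    - c * (hK p K z.1 * S.indicator (fun _ => (1:ℝ)) z.2)) (μ.prod μ) := (j12.const_mul C).sub (j3.const_mul c)
  rw [e1]
  have := integral_mono i1 R (fun z => by
    obtain ⟨v, vs⟩ := z
    have h1 := H K hK0 v vs
    have e : cQ B (gK (p / 2 - 1) K) v vs = cQ B (fK (p / 2 - 1) K) v vs := cQ_sq B _ _ v vs
    simp only
    rw [e]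
    refine h1.trans ?_
    have n1 := norm_nonneg v
    have n2 := norm_nonneg vs
    have a1 : ‖v‖ ^ p ≤ (jb v) ^ p := by gcongr; linarith
    have a2 : ‖vs‖ ^ p ≤ (jb vs) ^ p := by gcongr; linarith
    have a3 : ‖v‖ ^ p * ‖vs‖ + ‖v‖ * ‖vs‖ ^ p ≤ (jb v) ^ p * (jb vs) + (jb v) * (jb vs) ^ p := by
      gcongr <;> linarith
    refine sub_le_sub (by gcongr) ?_
    have nn : 0 ≤ c * (‖v‖ ^ (p + 1) + ‖vs‖ ^ (p + 1)) := by positivity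
    by_cases hv : v ∈ {v : Vd d | ‖v‖ ^ 2 + 2 ≤ K}
    · by_cases hw : vs ∈ S
      · have hv' : ‖v‖ ^ 2 + 2 ≤ K := hv
        have hw' : ‖vs‖ ^ 2 ≤ 2 := hw
        rw [if_pos li, hK, indicator_of_mem hv, indicator_of_mem hw, mul_one]
        gcongr
        have : 0 ≤ ‖vs‖ ^ (p + 1) := by positivity
        linarith
      · rw [indicator_of_notMem hw, mul_zero, mul_zero]; split_ifs <;> linarith
    · rw [hK, indicator_of_notMem hv, zero_mul, mul_zero]; split_ifs <;> linarith)
  refine this.trans ?_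
  rw [integral_sub (j12.const_mul C) (j3.const_mul c), integral_const_mul, integral_const_mul, integral_add j1 j2, integral_prod_mul (fun v : Vd d => (jb v) ^ p) (fun v : Vd d => 1 + ‖v‖),
     integral_prod_mul (fun v : Vd d => 1 + ‖v‖) (fun v : Vd d => (jb v) ^ p), integral_prod_mul (hK p K)]
  have m1 := BS_mU1 hμ
  simp only [mU, Real.rpow_one] at m1 ⊢
  have m0 := mU_nonneg p μ
  unfold mU at m0
  have hm := half_mass hμ
  rw [integral_indicator_const _ mS, smul_eq_mul, mul_one]
  have : 0 ≤ ∫ v, hK p K v ∂μ := integral_nonneg (hK_nonneg p K)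
  have q1 : (∫ v : Vd d, (jb v) ^ p ∂μ) * ∫ v : Vd d, (jb v) ∂μ + (∫ v : Vd d, (jb v) ∂μ) * ∫ v : Vd d, (jb v) ^ p ∂μ
    ≤ 8 * ∫ v : Vd d, (jb v) ^ p ∂μ := by nlinarith
  have q2 : (∫ v, hK p K v ∂μ) / 2 ≤ (∫ v, hK p K v ∂μ) * μ.real S := by nlinarith
  nlinarith [mll q1 hC0, mll q2 hc.le]
end

section
variable (B : Vd d → MV d) [hC : CK B]

lemma U_le_pow {q : ℝ} (hq : 0 ≤ q) (v : Vd d) : (jb v) ^ q ≤ 2 ^ q * (1 + ‖v‖ ^ q) := by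
  have h0 := norm_nonneg v
  rcases le_total ‖v‖ 1 with h | h
  · calc (jb v) ^ q ≤ 2 ^ q := by gcongr; linarith
      _ ≤ _ := le_mul_of_one_le_right po (le_add_of_nonneg_right po)
  · calc (jb v) ^ q ≤ (2 * ‖v‖) ^ q := by gcongr; linarith
      _ = 2 ^ q * ‖v‖ ^ q := Real.mul_rpow nq h0
      _ ≤ _ := by gcongr; linarith

lemma momL_eq {q : ℝ} (hq : 0 ≤ q) (μ : MV d) : momentL q μ = ∫⁻ v, ENNReal.ofReal (‖v‖ ^ q) ∂μ := by
  refine lintegral_congr fun v => ?_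
  rw [← ENNReal.ofReal_rpow_of_nonneg (norm_nonneg v) hq, ofReal_norm]; rfl

lemma IU_of_pow {q : ℝ} (hq : 0 ≤ q) {μ : MV d} [IsProbabilityMeasure μ] (h : Integrable (fun v : Vd d => ‖v‖ ^ q) μ) :
    IU q μ ∧ mU q μ ≤ 2 ^ q * (1 + ∫ v, ‖v‖ ^ q ∂μ) := by
  have i : Integrable (fun v : Vd d => 2 ^ q * (1 + ‖v‖ ^ q)) μ := ((integrable_const 1).add h).const_mul _
  have hI : IU q μ := i.mono' (U_meas q).aestronglyMeasurable (ae_of_all _ fun v => by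
    rw [Real.norm_of_nonneg po]; exact U_le_pow hq v)
  refine ⟨hI, (integral_mono hI i (U_le_pow hq)).trans_eq ?_⟩
  rw [integral_const_mul, integral_add (integrable_const 1) h]; simp

lemma pow_of_momL {q : ℝ} (hq : 0 ≤ q) {μ : MV d} {M : ℝ} (hM : 0 ≤ M) (h : momentL q μ ≤ ENNReal.ofReal M) :
    Integrable (fun v : Vd d => ‖v‖ ^ q) μ ∧ ∫ v, ‖v‖ ^ q ∂μ ≤ M := by
  rw [momL_eq hq] at h
  have m : Measurable fun v : Vd d => ‖v‖ ^ q := by fun_prop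
  have nn : ∀ v : Vd d, 0 ≤ ‖v‖ ^ q := fun v => by positivity
  refine ⟨⟨m.aestronglyMeasurable, ?_⟩, ?_⟩
  · rw [hasFiniteIntegral_iff_ofReal (ae_of_all _ nn)]; exact h.trans_lt ENNReal.ofReal_lt_top
  · rw [integral_eq_lintegral_of_nonneg_ae (ae_of_all _ nn) m.aestronglyMeasurable]
    exact ENNReal.toReal_le_of_le_ofReal hM h

lemma mom_IU {q : ℝ} (hq : 0 ≤ q) {μ : MV d} [IsProbabilityMeasure μ] {M : ℝ} (hM : 0 ≤ M)
    (h : momentL q μ ≤ ENNReal.ofReal M) : IU q μ ∧ mU q μ ≤ 2 ^ q * (1 + M) := by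
  obtain ⟨h1, h2⟩ := pow_of_momL hq hM h
  obtain ⟨h3, h4⟩ := IU_of_pow hq h1
  exact ⟨h3, h4.trans (by gcongr)⟩

lemma prim_meas {g : ℝ → ℝ} {C : ℝ} (hg : ∀ s, 0 < s → |g s| ≤ C) : Measurable fun t => ∫ s in Ioc 0 t, g s := by
  classical
  set I : Set ℝ := {t | IntegrableOn g (Ioc 0 t)} with hI
  have hIc : I.OrdConnected := ⟨fun x _ y hy z hz => IntegrableOn.mono_set hy (Ioc_subset_Ioc_right hz.2)⟩
  have mI : MeasurableSet I := hIc.measurableSet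
  have hC : 0 ≤ C := (abs_nonneg _).trans (hg 1 one_pos)
  have key : ∀ x ∈ I, ∀ y ∈ I, x ≤ y → |(∫ s in Ioc 0 y, g s) - ∫ s in Ioc 0 x, g s| ≤ C * |y - x| := by
    intro x hx y hy hxy
    rcases le_total x 0 with h0 | h0
    · rw [Ioc_eq_empty (by simpa using h0 : ¬ (0:ℝ) < x), setIntegral_empty, sub_zero]
      have := norm_setIntegral_le_of_norm_le_const (μ := volume) (s := Ioc 0 y) (f := g) (C := C) measure_Ioc_lt_top (fun s hs => hg s hs.1)
      refine (Real.norm_eq_abs _ ▸ this).trans ?_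
      gcongr
      rw [measureReal_def, Real.volume_Ioc]
      rw [abs_of_nonneg li]
      rcases le_total 0 y with h | h
      · rw [ENNReal.toReal_ofReal li]; linarith
      · rw [ENNReal.ofReal_of_nonpos li]; simpa using hxy
    · have e : Ioc 0 y = Ioc 0 x ∪ Ioc x y := (Ioc_union_Ioc_eq_Ioc h0 hxy).symm
      rw [e, setIntegral_union (by rw [Set.disjoint_left]; intro a ha hb; exact absurd hb.1 (not_lt.2 ha.2)) measurableSet_Ioc hx
        (IntegrableOn.mono_set hy (Ioc_subset_Ioc_left h0)), add_sub_cancel_left]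
      have := norm_setIntegral_le_of_norm_le_const (μ := volume) (s := Ioc x y) (f := g) (C := C) measure_Ioc_lt_top (fun s hs => hg s (h0.trans_lt hs.1))
      refine (Real.norm_eq_abs _ ▸ this).trans ?_
      rw [measureReal_def, Real.volume_Ioc, ENNReal.toReal_ofReal li]
      exact mll (le_abs_self _) hC
  have hc : ContinuousOn (fun t => ∫ s in Ioc 0 t, g s) I := by
    have : LipschitzOnWith (Real.toNNReal C) (fun t => ∫ s in Ioc 0 t, g s) I := by
      refine LipschitzOnWith.of_dist_le_mul fun x hx y hy => ?_
      rw [Real.coe_toNNReal _ hC, Real.dist_eq, Real.dist_eq]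
      rcases le_total x y with h | h
      · rw [abs_sub_comm, abs_sub_comm x]; exact key x hx y hy h
      · exact key y hy x hx h
    exact this.continuousOn
  have e : (fun t => ∫ s in Ioc 0 t, g s) = I.piecewise (fun t => ∫ s in Ioc 0 t, g s) (fun _ => 0) := by
    funext t
    by_cases ht : t ∈ I
    · rw [piecewise_eq_of_mem _ _ _ ht]
    · rw [piecewise_eq_of_notMem _ _ _ ht]; exact integral_undef ht
  rw [e]
  exact ContinuousOn.measurable_piecewise hc continuousOn_const mI

lemma cpt_ind {A : Set (Vd d)} (n : ℕ) (f : FV d) : HasCompactSupport ((A ∩ Metric.closedBall 0 n).indicator f) :=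
  HasCompactSupport.of_support_subset_isCompact (isCompact_closedBall (0 : Vd d) n) fun _ hv =>
    (mem_of_indicator_ne_zero hv).2

lemma sol_meas {μ : ℝ → MV d} (h : IsBoltzmannSolution B μ) : Measurable fun t => μ (max t 0) := by
  refine Measure.measurable_of_measurable_coe _ fun A hA => ?_
  have hn : ∀ n : ℕ, Measurable fun t => μ (max t 0) (A ∩ Metric.closedBall 0 n) := fun n => by
    have mS : MeasurableSet (A ∩ Metric.closedBall (0 : Vd d) n) := hA.inter Metric.isClosed_closedBall.measurableSet
    set f : FV d := (A ∩ Metric.closedBall 0 n).indicator (fun _ => 1) with hf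
    have fm : Measurable f := measurable_const.indicator mS
    have fb : ∀ v, |f v| ≤ 1 := fun v => by
      rw [hf]; unfold indicator; split_ifs <;> simp
    have h2 := h.2 f fm ⟨1, fb⟩ (cpt_ind n _)
    have hq : ∀ s, 0 < s → |QInt B f (μ s) (μ s)| ≤ 1 * (2 * 2 ^ (0:ℝ) + 1) * (4 * 4 + 4 * 4) := fun s hs => by
      have hs := h.1 s hs.le
      have := hs.1
      have i1 := BS_IU1 hs
      have := (cQ_prod B fm (c := 1) zero_le_one (q := 0) le_rfl (fun v => by rw [Real.rpow_zero, mul_one]; exact fb v)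
        (by rw [zero_add]; exact i1) (by rw [zero_add]; exact i1) (μ := μ s) (ν := μ s)).2.2
      refine this.trans ?_
      rw [zero_add]
      have := BS_mU1 hs
      have := mU_nonneg 1 (μ s)
      gcongr
    have m1 := ((prim_meas hq).comp (measurable_id.max measurable_const : Measurable fun t : ℝ => max t 0)).const_add (∫ v, f v ∂(μ 0))
    have : (fun t => μ (max t 0) (A ∩ Metric.closedBall 0 n)) = fun t => ENNReal.ofReal (∫ v, f v ∂(μ (max t 0))) := by
      funext t
      have := (h.1 (max t 0) (le_max_right _ _)).1
      rw [hf, integral_indicator_const _ mS, smul_eq_mul, mul_one, ofReal_measureReal]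
    rw [this]
    refine Measurable.ennreal_ofReal ?_
    have e : (fun t => ∫ v, f v ∂(μ (max t 0))) = _ := funext fun t => h2 (max t 0) (le_max_right _ _)
    rw [e]; exact m1
  have : (fun t => μ (max t 0) A) = fun t => ⨆ n : ℕ, μ (max t 0) (A ∩ Metric.closedBall 0 n) := by
    funext t
    rw [← Monotone.measure_iUnion, ← inter_iUnion, Metric.iUnion_closedBall_nat, inter_univ]
    exact fun a b hab => inter_subset_inter_right _ (Metric.closedBall_subset_closedBall (by exact_mod_cast hab))
  rw [this]
  exact Measurable.iSup hn

/-- lower-integral bound on the `q`-th moment along a path -/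
lemma GP.of_lint {p T A : ℝ} (hp : 0 ≤ p) (hT : 0 ≤ T) {ν : ℝ → MV d} (hm : Measurable ν) (hs : ∀ t, ν t ∈ boltzmannSphere d)
    (h : ∫⁻ s in Ioc 0 T, ∫⁻ v, ENNReal.ofReal (‖v‖ ^ (p + 1)) ∂(ν s) ≤ ENNReal.ofReal A) : GP p T ν := by
  have mm : Measurable fun v : Vd d => ‖v‖ ^ (p + 1) := by fun_prop
  have nn : ∀ v : Vd d, 0 ≤ ‖v‖ ^ (p + 1) := fun v => by positivity
  have mL : Measurable fun s => ∫⁻ v, ENNReal.ofReal (‖v‖ ^ (p + 1)) ∂(ν s) :=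
    (Measure.measurable_lintegral mm.ennreal_ofReal).comp hm
  have hfin : ∫⁻ s in Ioc 0 T, ∫⁻ v, ENNReal.ofReal (‖v‖ ^ (p + 1)) ∂(ν s) ≠ ⊤ := (h.trans_lt ENNReal.ofReal_lt_top).ne
  have hae := ae_lt_top mL hfin
  have hae2 : ∀ᵐ s ∂(volume.restrict (Ioc 0 T)), Integrable (fun v : Vd d => ‖v‖ ^ (p + 1)) (ν s) :=
    hae.mono fun s hs => ⟨mm.aestronglyMeasurable, by rw [hasFiniteIntegral_iff_ofReal (ae_of_all _ nn)]; exact hs⟩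
  have hI : ∀ᵐ s ∂(volume.restrict (Ioc 0 T)), IU (p + 1) (ν s) := hae2.mono fun s h => by
    have := (hs s).1
    exact (IU_of_pow li h).1
  refine ⟨hm, hs, hI, ?_⟩
  have i1 : IntervalIntegrable (fun s => 2 ^ (p + 1) * (1 + (∫⁻ v, ENNReal.ofReal (‖v‖ ^ (p + 1)) ∂(ν s)).toReal)) volume 0 T := by
    rw [intervalIntegrable_iff_integrableOn_Ioc_of_le hT]
    exact ((integrable_const 1).add (integrable_toReal_of_lintegral_ne_top mL.aemeasurable hfin)).const_mul _
  refine ii_of_le hT (mU_meas hm hs _) i1 (hae2.mono fun s h => ?_)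
  have := (hs s).1
  rw [abs_of_nonneg (mU_nonneg _ _)]
  refine (IU_of_pow li h).2.trans_eq ?_
  rw [integral_eq_lintegral_of_nonneg_ae (ae_of_all _ nn) mm.aestronglyMeasurable]

lemma fK_le {p K : ℝ} (hp : 2 < p) (hK : 0 ≤ K) (v : Vd d) : 0 ≤ fK (p / 2 - 1) K v ∧ fK (p / 2 - 1) K v ≤ (jb v) ^ p := by
  have h0 := norm_nonneg v
  refine ⟨psi_nonneg hK po, ?_⟩
  unfold fK psi
  calc ‖v‖ ^ 2 * (min (‖v‖ ^ 2) K) ^ (p / 2 - 1) ≤ ((jb v) ^ 2) * ((jb v) ^ 2) ^ (p / 2 - 1) := by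
        gcongr
        · linarith
        · linarith
        · exact (min_le_left _ _).trans (by gcongr; linarith)
    _ = _ := by
      rw [← Real.rpow_natCast, ← Real.rpow_mul po, ← Real.rpow_add po]
      congr 1; push_cast; ring

lemma int_gK {p K : ℝ} (hp : 2 < p) (hK : 0 ≤ K) {μ : MV d} (hμ : μ ∈ boltzmannSphere d) (hI : IU p μ) :
    ∫ v, gK (p / 2 - 1) K v ∂μ = ∫ v, fK (p / 2 - 1) K v ∂μ - K ^ (p / 2 - 1) := by
  have hr : 0 < p / 2 - 1 := by linarith
  have i : Integrable (fK (p / 2 - 1) K) μ := int_of_U (c := 1) (fK_cont hr).measurable (fun v => by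
    rw [abs_of_nonneg (fK_le hp hK v).1, one_mul]; exact (fK_le hp hK v).2) hI
  unfold gK
  rw [integral_add i ((BS_int2 hμ).const_mul _), integral_const_mul, hμ.2.2]; ring

lemma int_fK {p K : ℝ} (hp : 2 < p) (hK : 0 ≤ K) {μ : MV d} (hI : IU p μ) :
    0 ≤ ∫ v, fK (p / 2 - 1) K v ∂μ ∧ ∫ v, fK (p / 2 - 1) K v ∂μ ≤ mU p μ := by
  have hr : 0 < p / 2 - 1 := by linarith
  have i : Integrable (fK (p / 2 - 1) K) μ := int_of_U (c := 1) (fK_cont hr).measurable (fun v => by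
    rw [abs_of_nonneg (fK_le hp hK v).1, one_mul]; exact (fK_le hp hK v).2) hI
  exact ⟨integral_nonneg fun v => (fK_le hp hK v).1, integral_mono i hI fun v => (fK_le hp hK v).2⟩
end

section
variable (B : Vd d → MV d) [hC : CK B]

lemma hK_mono {p K K' : ℝ} (h : K ≤ K') (v : Vd d) : hK p K v ≤ hK p K' v := by
  unfold hK
  exact indicator_le_indicator_of_subset (fun v hv => le_trans hv h) (fun v => by positivity) v

lemma hK_sup {p : ℝ} (v : Vd d) : ⨆ n : ℕ, ENNReal.ofReal (hK p n v) = ENNReal.ofReal (‖v‖ ^ (p + 1)) := by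
  refine le_antisymm (iSup_le fun n => ENNReal.ofReal_le_ofReal (indicator_le_self' (fun _ _ => by positivity) v)) ?_
  refine le_trans ?_ (le_iSup _ ⌈‖v‖ ^ 2 + 2⌉₊)
  unfold hK
  rw [indicator_of_mem (show v ∈ {w : Vd d | ‖w‖ ^ 2 + 2 ≤ (⌈‖v‖ ^ 2 + 2⌉₊ : ℝ)} from Nat.le_ceil (‖v‖ ^ 2 + 2))]

lemma lint_hK {p T A : ℝ} (hp : 0 ≤ p) {ν : ℝ → MV d} (hm : Measurable ν) (hs : ∀ t, ν t ∈ boltzmannSphere d)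
    (h : ∀ n : ℕ, ∫ s in Ioc 0 T, ∫ v, hK p n v ∂(ν s) ≤ A) :
    ∫⁻ s in Ioc 0 T, ∫⁻ v, ENNReal.ofReal (‖v‖ ^ (p + 1)) ∂(ν s) ≤ ENNReal.ofReal A := by
  have e1 : ∀ s, ∫⁻ v, ENNReal.ofReal (‖v‖ ^ (p + 1)) ∂(ν s) = ⨆ n : ℕ, ∫⁻ v, ENNReal.ofReal (hK p n v) ∂(ν s) := fun s => by
    rw [← lintegral_iSup (fun n => (hK_meas p n).ennreal_ofReal)
      (fun a b hab v => ENNReal.ofReal_le_ofReal (hK_mono (by exact_mod_cast hab) v))]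
    exact lintegral_congr fun v => (hK_sup v).symm
  simp_rw [e1]
  rw [lintegral_iSup (f := fun (n : ℕ) s => ∫⁻ v, ENNReal.ofReal (hK p n v) ∂(ν s)) (fun n => (Measure.measurable_lintegral (hK_meas p n).ennreal_ofReal).comp hm)
    (fun a b hab s => lintegral_mono fun v => ENNReal.ofReal_le_ofReal (hK_mono (by exact_mod_cast hab) v))]
  refine iSup_le fun n => ?_
  have hi : ∀ s, Integrable (hK p n : FV d) (ν s) := fun s => by
    have := (hs s).1
    exact Integrable.of_bound (hK_meas p n).aestronglyMeasurable _ (ae_of_all _ (hK_bd hp n.cast_nonneg))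
  have e2 : ∀ s, ∫⁻ v, ENNReal.ofReal (hK p n v) ∂(ν s) = ENNReal.ofReal (∫ v, hK p n v ∂(ν s)) := fun s =>
    (ofReal_integral_eq_lintegral_ofReal (hi s) (ae_of_all _ (hK_nonneg p n))).symm
  simp_rw [e2]
  have mI : Measurable fun s => ∫ v, hK p n v ∂(ν s) :=
    int_meas hm (fun s => (hs s).1) (h := fun _ v => hK p n v) ((hK_meas p n).comp measurable_snd)
  have hi2 : IntegrableOn (fun s => ∫ v, hK p n v ∂(ν s)) (Ioc 0 T) :=
    Measure.integrableOn_of_bounded (M := (1 + n) ^ (p + 1)) measure_Ioc_lt_top.ne mI.aestronglyMeasurable (ae_of_all _ fun s => by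
      have := (hs s).1
      refine (norm_integral_le_of_norm_le_const (ae_of_all _ (hK_bd hp n.cast_nonneg))).trans_eq ?_
      simp)
  rw [← ofReal_integral_eq_lintegral_ofReal hi2 (ae_of_all _ fun s => integral_nonneg (hK_nonneg p n))]
  exact ENNReal.ofReal_le_ofReal (h n)

lemma LBM {p T : ℝ} (hp : 2 < p) (hT : 0 ≤ T) {μ : ℝ → MV d} (hμ : ∀ t, 0 ≤ t → μ t ∈ boltzmannSphere d)
    (h : LocBddMomentFrom p 0 μ) : ∃ M ≥ 0, ∀ t ∈ Icc 0 T, IU p (μ t) ∧ mU p (μ t) ≤ M := by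
  obtain ⟨M, hM, H⟩ := h T hT
  refine ⟨2 ^ p * (1 + M.toReal), by positivity, fun t ht => ?_⟩
  have := (hμ t ht.1).1
  exact mom_IU li ENNReal.toReal_nonneg ((H t ht).trans (ENNReal.ofReal_toReal hM).ge)

lemma QInt_gK_bd {p K : ℝ} (hp : 2 < p) (hK : 0 ≤ K) {μ : MV d} (h : μ ∈ boltzmannSphere d) :
    |QInt B (gK (p / 2 - 1) K) μ μ| ≤ K ^ (p / 2 - 1) * K * (2 * 2 ^ (0:ℝ) + 1) * (4 * 4 + 4 * 4) := by
  have := h.1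
  have i1 := BS_IU1 h
  have := (cQ_prod B (gK_cont (K := K) (by linarith : 0 < p / 2 - 1)).measurable (c := K ^ (p / 2 - 1) * K) po (q := 0) le_rfl
    (fun v => by rw [Real.rpow_zero, mul_one]; exact gK_bd li hK v)
        (by rw [zero_add]; exact i1) (by rw [zero_add]; exact i1) (μ := μ) (ν := μ)).2.2
  refine this.trans ?_
  rw [zero_add]
  have := BS_mU1 h
  have := mU_nonneg 1 μ
  gcongr

lemma sol_GP {p T : ℝ} (hp : 2 < p) (hT : 0 ≤ T) {μ : ℝ → MV d} (h : IsBoltzmannSolution B μ)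
    (hb : LocBddMomentFrom p 0 μ) : GP p T (fun t => μ (max t 0)) := by
  have hm := sol_meas B h
  have hs : ∀ t, μ (max t 0) ∈ boltzmannSphere d := fun t => h.1 _ (le_max_right _ _)
  have hr : 0 < p / 2 - 1 := by linarith
  obtain ⟨M, hM0, hM⟩ := LBM hp hT h.1 hb
  obtain ⟨C, hC0, c, hc, H⟩ := pov_Q B hp
  refine GP.of_lint li hT hm hs (lint_hK (A := (C * M * T + M) / c) li hm hs fun n => ?_)
  have hn : (0:ℝ) ≤ n := n.cast_nonneg
  have e := h.2 (gK (p / 2 - 1) n) (gK_cont hr).measurable ⟨_, gK_bd hr hn⟩ (gK_supp hn) T hT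
  rw [int_gK hp hn (h.1 T hT) (hM T ⟨hT, le_rfl⟩).1, int_gK hp hn (h.1 0 le_rfl) (hM 0 ⟨le_rfl, hT⟩).1] at e
  have f1 := (int_fK hp hn (hM T ⟨hT, le_rfl⟩).1).1
  have f2 := (int_fK hp hn (hM 0 ⟨le_rfl, hT⟩).1).2.trans (hM 0 ⟨le_rfl, hT⟩).2
  have e2 : ∫ s in Ioc 0 T, QInt B (gK (p / 2 - 1) n) (μ s) (μ s) = ∫ s in Ioc 0 T, QInt B (gK (p / 2 - 1) n) (μ (max s 0)) (μ (max s 0)) :=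
    setIntegral_congr_fun measurableSet_Ioc fun s hs => by simp only [max_eq_left hs.1.le]
  have iQ : IntegrableOn (fun s => QInt B (gK (p / 2 - 1) n) (μ (max s 0)) (μ (max s 0))) (Ioc 0 T) :=
    Measure.integrableOn_of_bounded measure_Ioc_lt_top.ne
      (Q_meas B hm (fun a => (hs a).1) (gK_cont hr).measurable).aestronglyMeasurable (ae_of_all _ fun s => QInt_gK_bd B hp hn (hs s))
  have mI : Measurable fun s => ∫ v, hK p n v ∂(μ (max s 0)) :=
    int_meas hm (fun s => (hs s).1) (h := fun _ v => hK p n v) ((hK_meas p n).comp measurable_snd)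
  have hi2 : IntegrableOn (fun s => ∫ v, hK p n v ∂(μ (max s 0))) (Ioc 0 T) :=
    Measure.integrableOn_of_bounded (M := (1 + n) ^ (p + 1)) measure_Ioc_lt_top.ne mI.aestronglyMeasurable (ae_of_all _ fun s => by
      have := (hs s).1
      refine (norm_integral_le_of_norm_le_const (ae_of_all _ (hK_bd li hn))).trans_eq ?_
      simp)
  have e3 : ∫ s in Ioc 0 T, QInt B (gK (p / 2 - 1) n) (μ (max s 0)) (μ (max s 0)) ≤ ∫ s in Ioc 0 T, (C * M - c * ∫ v, hK p n v ∂(μ (max s 0))) := by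
    refine setIntegral_mono_on iQ ((integrable_const (C * M)).sub (hi2.const_mul c)) measurableSet_Ioc fun s hs' => ?_
    have h1 := hM s ⟨hs'.1.le, hs'.2⟩
    have h2 := H n hn _ (hs s) (by rw [max_eq_left hs'.1.le]; exact h1.1)
    refine h2.trans ?_
    rw [max_eq_left hs'.1.le]
    gcongr
    exact h1.2
  rw [integral_sub (integrable_const (C * M)) (hi2.const_mul c), integral_const_mul c, setIntegral_const] at e3
  simp only [measureReal_def, Real.volume_Ioc, sub_zero, ENNReal.toReal_ofReal hT, smul_eq_mul] at e3
  rw [e2] at e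
  rw [le_div_iff₀ hc]
  nlinarith

lemma sol_eq {p T : ℝ} (hp : 2 < p) (hT : 0 ≤ T) {μ : ℝ → MV d} (h : IsBoltzmannSolution B μ)
    (hb : LocBddMomentFrom p 0 μ) {f : FV d} (hf : f ∈ FP d) :
    ∫ v, f v ∂(μ (max T 0)) = JJ B (fun t => μ (max t 0)) T f := by
  have g := sol_GP B hp hT h hb
  have fm := (FP.cont hf).measurable
  set fn : ℕ → FV d := fun n => (univ ∩ Metric.closedBall (0 : Vd d) n).indicator f with hfn
  have mS : ∀ n : ℕ, MeasurableSet (univ ∩ Metric.closedBall (0 : Vd d) n) := fun n => MeasurableSet.univ.inter Metric.isClosed_closedBall.measurableSet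
  have fnm : ∀ n, Measurable (fn n) := fun n => fm.indicator (mS n)
  have fnle : ∀ n v, |fn n v| ≤ |f v| := fun n v => norm_indicator_le_norm_self f v
  have fnU : ∀ n v, |fn n v| ≤ 1 * (jb v) ^ r2 := fun n v => (fnle n v).trans (FP.leU hf v)
  have fnb : ∀ n, ∃ M, ∀ v, |fn n v| ≤ M := fun n => ⟨(1:ℝ) * (1 + n) ^ r2, fun v => by
    by_cases hv : v ∈ univ ∩ Metric.closedBall (0 : Vd d) n
    · have : ‖v‖ ≤ n := mem_closedBall_zero_iff.1 hv.2
      exact (fnU n v).trans (by gcongr)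
    · simp only [hfn]; rw [indicator_of_notMem hv, abs_zero]; positivity⟩
  have fnt : ∀ v, ∀ᶠ n in atTop, fn n v = f v := fun v => by
    filter_upwards [eventually_ge_atTop ⌈‖v‖⌉₊] with n hn
    exact indicator_of_mem (show v ∈ univ ∩ Metric.closedBall (0 : Vd d) n from ⟨mem_univ _, mem_closedBall_zero_iff.2 (Nat.ceil_le.1 hn)⟩) f
  have L : ∀ t, Tendsto (fun n => ∫ v, fn n v ∂(μ (max t 0))) atTop (nhds (∫ v, f v ∂(μ (max t 0)))) := fun t =>
    tendsto_integral_of_dominated_convergence (fun v => 1 * (jb v) ^ r2) (fun n => (fnm n).aestronglyMeasurable)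
      ((BS_IU2 (g.s t)).const_mul 1) (fun n => ae_of_all _ (fnU n)) (ae_of_all _ fun v => tendsto_const_nhds.congr' ((fnt v).mono fun n h => h.symm))
  have LQ : ∀ᵐ s ∂(volume.restrict (Ioc 0 T)), Tendsto (fun n => QInt B (fn n) (μ (max s 0)) (μ (max s 0))) atTop (nhds (QInt B f (μ (max s 0)) (μ (max s 0)))) := by
    filter_upwards [g.i] with s hs
    have := (g.s s).1
    have i3 : IU (r2 + 1) (μ (max s 0)) := IU_mono li hs
    have i1 := BS_IU1 (g.s s)
    rw [(cQ_prod B fm zero_le_one zero_le_two (FP.leU hf) i3 i3).2.1]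
    simp_rw [fun n => (cQ_prod B (fnm n) zero_le_one zero_le_two (fnU n) i3 i3).2.1]
    have I1 : Integrable (fun v : Vd d => 1 + ‖v‖) (μ (max s 0)) := by
      have := i1
      unfold IU at this; simpa only [Real.rpow_one] using this
    refine tendsto_integral_of_dominated_convergence (fun z => 1 * (2 * 2 ^ r2 + 1) *
        ((1 + ‖z.1‖) ^ (r2 + 1) * (1 + ‖z.2‖) + (1 + ‖z.1‖) * (1 + ‖z.2‖) ^ (r2 + 1)))
      (fun n => (cQ_meas B (fnm n)).aestronglyMeasurable) (((i3.mul_prod I1).add (I1.mul_prod i3)).const_mul _)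
      (fun n => ae_of_all _ fun z => cQ_abs_U B zero_le_one zero_le_two (fnU n) z.1 z.2) (ae_of_all _ fun z => ?_)
    refine tendsto_const_nhds.congr' ?_
    filter_upwards [eventually_ge_atTop ⌈‖z.1‖ + ‖z.2‖⌉₊] with n hn
    have hn := Nat.ceil_le.1 hn
    have he : ∀ x : Vd d, ‖x‖ ≤ ‖z.1‖ + ‖z.2‖ → fn n x = f x := fun x hx =>
      indicator_of_mem (show x ∈ univ ∩ Metric.closedBall (0 : Vd d) n from ⟨mem_univ _, mem_closedBall_zero_iff.2 (hx.trans hn)⟩) f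
    refine integral_congr_ae ((B_sphere B _).mono fun σ hσ => ?_)
    simp only [Dl]
    rw [he _ (postV_le hσ _ _), he _ (postVs_le hσ _ _), he _ (le_add_of_nonneg_right (norm_nonneg _)), he _ (le_add_of_nonneg_left (norm_nonneg _))]
  unfold JJ
  simp only [max_self]
  have e : ∀ n, ∫ v, fn n v ∂(μ (max T 0)) = ∫ v, fn n v ∂(μ 0) + ∫ s in 0..T, QInt B (fn n) (μ (max s 0)) (μ (max s 0)) := fun n => by
    rw [max_eq_left hT, h.2 (fn n) (fnm n) (fnb n) (cpt_ind n _) T hT, intervalIntegral.integral_of_le hT]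
    congr 1
    exact setIntegral_congr_fun measurableSet_Ioc fun s hs => by simp only [max_eq_left hs.1.le]
  refine tendsto_nhds_unique (L T) ?_
  simp_rw [e]
  have L0 := L 0
  simp only [max_self] at L0
  refine L0.add ?_
  simp_rw [intervalIntegral.integral_of_le hT]
  refine tendsto_integral_of_dominated_convergence (fun s => 72 * 1 * mU 3 (μ (max s 0)))
    (fun n => (Q_meas B g.m (fun a => (g.s a).1) (fnm n)).aestronglyMeasurable)
    (((intervalIntegrable_iff_integrableOn_Ioc_of_le hT).1 (g.k3 hT hp.le)).const_mul _)
    (fun n => g.qb B hp.le (fnm n) zero_le_one (fnU n)) LQ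
end

section
variable (B : Vd d → MV d) [hC : CK B]

lemma emp_integrable {N : ℕ} {ν : MV d} (h : ν ∈ empiricalSphere d N) (hN : N ≠ 0) (f : FV d) : Integrable f ν := by
  obtain ⟨-, x, rfl⟩ := h
  refine Integrable.smul_measure ?_ (by simpa using hN)
  rw [integrable_finsetSum_measure]
  exact fun i _ => integrable_dirac (by simp)

lemma emp_int {N : ℕ} (x : Fin N → Vd d) (f : FV d) :
    ∫ v, f v ∂((N : ℝ≥0∞)⁻¹ • ∑ i, Measure.dirac (x i)) = (N : ℝ)⁻¹ * ∑ i, f (x i) := by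
  rw [integral_smul_measure, integral_finsetSum_measure fun i _ => integrable_dirac (by simp)]
  simp

lemma emp_N {N : ℕ} {ν : MV d} (h : ν ∈ empiricalSphere d N) : 2 ≤ N := by
  obtain ⟨⟨h1, h2, h3⟩, x, rfl⟩ := h
  by_contra hc
  have : N = 0 ∨ N = 1 := by omega
  rcases this with rfl | rfl
  · have := h1.measure_univ
    simp at this
  · have e := emp_int x (fun v => ‖v‖ ^ 2)
    simp at e h2 h3
    rw [h2] at h3; simp at h3

lemma ae_emp {N : ℕ} (x : Fin N → Vd d) (c : ℝ≥0∞) {q : Vd d → Prop} (h : ∀ i, q (x i)) :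
    ∀ᵐ v ∂(c • ∑ i, Measure.dirac (x i)), q v := by
  refine Measure.ae_smul_measure ?_ _
  rw [ae_iff, Measure.finsetSum_apply]
  refine Finset.sum_eq_zero fun i _ => ?_
  rw [Measure.dirac_apply, indicator_of_notMem]
  exact fun hh => hh (h i)

lemma emp_ball {N : ℕ} {ν : MV d} (h : ν ∈ empiricalSphere d N) : ∀ᵐ v ∂ν, ‖v‖ ^ 2 ≤ N := by
  have hN := emp_N h
  obtain ⟨⟨h1, h2, h3⟩, x, rfl⟩ := h
  rw [emp_int] at h3
  refine ae_emp x _ fun i => ?_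
  have hN' : (0:ℝ) < N := by positivity
  rw [inv_mul_eq_iff_eq_mul₀ hN'.ne', mul_one] at h3
  rw [← h3]
  exact Finset.single_le_sum (f := fun i => ‖x i‖ ^ 2) (fun i _ => sq_nonneg _) (Finset.mem_univ i)

lemma emp_atom {N : ℕ} {ν : MV d} (h : ν ∈ empiricalSphere d N) : ∀ᵐ v ∂ν, (N : ℝ≥0∞)⁻¹ ≤ ν {v} := by
  obtain ⟨-, x, rfl⟩ := h
  refine ae_emp x _ fun i => ?_
  rw [Measure.smul_apply, Measure.finsetSum_apply, smul_eq_mul]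
  refine le_mul_of_one_le_right zero_le ?_
  refine le_trans ?_ (Finset.single_le_sum (f := fun j => Measure.dirac (x j) {x i}) (fun i _ => zero_le) (Finset.mem_univ i))
  simp

lemma coll_le {ν : MV d} {c : ℝ≥0∞} {v vs : Vd d} (hv : c ≤ ν {v}) (hw : c ≤ ν {vs}) (hne : v ≠ vs) :
    c • (Measure.dirac v + Measure.dirac vs) ≤ ν := by
  rw [Measure.le_iff]
  intro A hA
  have hd : ν (A ∩ {v}) + ν (A ∩ {vs}) ≤ ν A := by
    rw [← measure_union (by
      rw [Set.disjoint_left]; rintro a ⟨-, ha⟩ ⟨-, hb⟩; exact hne (ha.symm.trans hb)) (hA.inter (measurableSet_singleton _))]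
    exact measure_mono (union_subset inter_subset_left inter_subset_left)
  refine le_trans ?_ hd
  rw [Measure.smul_apply, Measure.add_apply, Measure.dirac_apply' _ hA, Measure.dirac_apply' _ hA, smul_eq_mul, mul_add]
  refine add_le_add ?_ ?_
  · by_cases hh : v ∈ A
    · rw [inter_eq_right.2 (singleton_subset_iff.2 hh)]; simpa [hh] using hv
    · simp [hh]
  · by_cases hh : vs ∈ A
    · rw [inter_eq_right.2 (singleton_subset_iff.2 hh)]; simpa [hh] using hw
    · simp [hh]

lemma coll_int {N : ℕ} {ν : MV d} (h : ν ∈ empiricalSphere d N) {v vs : Vd d} (hv : (N : ℝ≥0∞)⁻¹ ≤ ν {v})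
    (hw : (N : ℝ≥0∞)⁻¹ ≤ ν {vs}) (hne : v ≠ vs) (σ : Vd d) :
    IsProbabilityMeasure (collUpdate N ν v vs σ) ∧ ∀ f : FV d, Measurable f →
      ∫ x, f x ∂(collUpdate N ν v vs σ) = ∫ x, f x ∂ν + (N : ℝ)⁻¹ * Dl f v vs σ := by
  have hN : N ≠ 0 := by have := emp_N h; omega
  have hNt : (N : ℝ≥0∞)⁻¹ ≠ ⊤ := by simpa using hN
  have := h.1.1
  set ρ := (N : ℝ≥0∞)⁻¹ • (Measure.dirac v + Measure.dirac vs) with hρ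
  set π := (N : ℝ≥0∞)⁻¹ • (Measure.dirac (postV v vs σ) + Measure.dirac (postVs v vs σ)) with hπ
  have fρ : IsFiniteMeasure ρ := Measure.smul_finite _ hNt
  have fπ : IsFiniteMeasure π := Measure.smul_finite _ hNt
  have e : collUpdate N ν v vs σ + ρ = ν + π :=
    Measure.sub_add_cancel_of_le ((coll_le hv hw hne).trans (Measure.le_add_right le_rfl))
  constructor
  · constructor
    have h1 := congrArg (fun m : MV d => m univ) e
    simp only [Measure.add_apply, measure_univ, hρ, hπ, Measure.smul_apply, smul_eq_mul] at h1
    exact (ENNReal.add_left_inj (by finiteness)).1 h1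
  · intro f hf
    have iρ : Integrable f ρ := by
      refine Integrable.smul_measure ?_ hNt
      exact (integrable_dirac (by simp)).add_measure (integrable_dirac (by simp))
    have iπ : Integrable f π := by
      refine Integrable.smul_measure ?_ hNt
      exact (integrable_dirac (by simp)).add_measure (integrable_dirac (by simp))
    have iν := emp_integrable h hN f
    have ic : Integrable f (collUpdate N ν v vs σ) := (iν.add_measure iπ).mono_measure Measure.sub_le
    have h1 := congrArg (fun m : MV d => ∫ x, f x ∂m) e
    rw [integral_add_measure ic iρ, integral_add_measure iν iπ] at h1
    have h2 : ∫ x, f x ∂π = (N : ℝ)⁻¹ * (f (postV v vs σ) + f (postVs v vs σ)) := by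
      rw [hπ, integral_smul_measure, integral_add_measure (integrable_dirac (by simp)) (integrable_dirac (by simp))]; simp
    have h3 : ∫ x, f x ∂ρ = (N : ℝ)⁻¹ * (f v + f vs) := by
      rw [hρ, integral_smul_measure, integral_add_measure (integrable_dirac (by simp)) (integrable_dirac (by simp))]; simp
    rw [h2, h3] at h1
    unfold Dl
    linarith

/-- measurable clamped linear functional -/
def cl (c : ℝ) (f : FV d) (ν : MV d) : ℝ :=
  max (-c) (min c ((∫⁻ v, ENNReal.ofReal (f v) ∂ν).toReal - (∫⁻ v, ENNReal.ofReal (-f v) ∂ν).toReal))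

lemma cl_meas (c : ℝ) {f : FV d} (hf : Measurable f) : Measurable (cl c f) := by
  unfold cl
  have h1 := (Measure.measurable_lintegral hf.ennreal_ofReal).ennreal_toReal
  have h2 := (Measure.measurable_lintegral hf.neg.ennreal_ofReal).ennreal_toReal
  exact measurable_const.max (measurable_const.min (h1.sub h2))

lemma cl_bd {c : ℝ} (hc : 0 ≤ c) (f : FV d) (ν : MV d) : |cl c f ν| ≤ c :=
  abs_le.2 ⟨le_max_left _ _, max_le li (min_le_left _ _)⟩

lemma cl_eq {c : ℝ} {f : FV d} (hf : Measurable f) (hb : ∀ v, |f v| ≤ c) (ν : MV d) [IsProbabilityMeasure ν] :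
    cl c f ν = ∫ v, f v ∂ν := by
  have hi : Integrable f ν := Integrable.of_bound hf.aestronglyMeasurable c (ae_of_all _ hb)
  unfold cl
  rw [← integral_eq_lintegral_pos_part_sub_lintegral_neg_part hi]
  have : |∫ v, f v ∂ν| ≤ c := by
    refine (norm_integral_le_of_norm_le_const (f := f) (ae_of_all _ hb)).trans_eq ?_
    simp
  rw [min_eq_right (abs_le.1 this).2, max_eq_right (abs_le.1 this).1]

lemma kacGen_cl {N : ℕ} {ν : MV d} (h : ν ∈ empiricalSphere d N) {c : ℝ} {f : FV d} (hf : Measurable f)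
    (hb : ∀ v, |f v| ≤ c) (Φ : ℝ → ℝ) : kacGen B N (fun ν => Φ (cl c f ν)) ν =
      N * ∫ v, ∫ vs, ∫ σ, (Φ (∫ x, f x ∂ν + (N : ℝ)⁻¹ * Dl f v vs σ) - Φ (∫ x, f x ∂ν)) ∂(B (v - vs)) ∂ν ∂ν := by
  have := h.1.1
  unfold kacGen
  congr 1
  refine integral_congr_ae ((emp_atom h).mono fun v hv => integral_congr_ae ((emp_atom h).mono fun vs hw => ?_))
  rcases eq_or_ne v vs with rfl | hne
  · simp only [sub_self, B_zero B, integral_zero_measure]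
  · refine integral_congr_ae (ae_of_all _ fun σ => ?_)
    obtain ⟨h1, h2⟩ := coll_int h hv hw hne σ
    simp only
    rw [cl_eq hf hb, cl_eq hf hb, h2 f hf]

lemma kacGen_id {N : ℕ} {ν : MV d} (h : ν ∈ empiricalSphere d N) {c : ℝ} {f : FV d} (hf : Measurable f)
    (hb : ∀ v, |f v| ≤ c) : kacGen B N (cl c f) ν = QInt B f ν ν := by
  have hN : (N : ℝ) ≠ 0 := by have := emp_N h; positivity
  have := kacGen_cl B h hf hb id
  simp only [id, add_sub_cancel_left, integral_const_mul] at this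
  rw [show kacGen B N (cl c f) ν = kacGen B N (fun ν => cl c f ν) ν from rfl, this, ← mul_assoc, mul_inv_cancel₀ hN, one_mul]
  rfl

/-- square-field integral -/
def GQ (B : Vd d → MV d) (f : FV d) (ν : MV d) : ℝ :=
  ∫ v, ∫ vs, ∫ σ, (Dl f v vs σ) ^ 2 ∂(B (v - vs)) ∂ν ∂ν

lemma kacGen_sq {N : ℕ} {ν : MV d} (h : ν ∈ empiricalSphere d N) {c : ℝ} {f : FV d} (hf : Measurable f)
    (hb : ∀ v, |f v| ≤ c) : kacGen B N (fun ν => (cl c f ν) ^ 2) ν =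
      2 * (∫ v, f v ∂ν) * QInt B f ν ν + (N : ℝ)⁻¹ * GQ B f ν := by
  have hN0 : N ≠ 0 := by have := emp_N h; omega
  have hN : (N : ℝ) ≠ 0 := by positivity
  have := kacGen_cl B h hf hb (fun x => x ^ 2)
  rw [this]
  clear this
  generalize ∫ v, f v ∂ν = X
  have hD : ∀ v vs, ∃ c, ∀ σ, ‖σ‖ = 1 → |Dl f v vs σ| ≤ c := fun v vs => Dl_bdd (LB.of_bdd hf hb) v vs
  have hD1 : ∀ v vs, Integrable (Dl f v vs) (B (v - vs)) := fun v vs => Dl_int B (LB.of_bdd hf hb) v vs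
  have hD2 : ∀ v vs, Integrable (fun σ => Dl f v vs σ ^ 2) (B (v - vs)) := fun v vs => by
    obtain ⟨c, hc⟩ := hD v vs
    refine B_integrable B (c := c ^ 2) ((Dl_meas1 hf v vs).pow_const 2) fun σ hσ => ?_
    rw [abs_pow]; have := hc σ hσ; gcongr
  have e : ∀ v vs, ∫ σ, ((X + (N : ℝ)⁻¹ * Dl f v vs σ) ^ 2 - X ^ 2) ∂(B (v - vs)) =
      2 * X * (N : ℝ)⁻¹ * cQ B f v vs + ((N : ℝ)⁻¹) ^ 2 * ∫ σ, Dl f v vs σ ^ 2 ∂(B (v - vs)) := fun v vs => by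
    unfold cQ
    rw [← integral_const_mul, ← integral_const_mul, ← integral_add ((hD1 v vs).const_mul _) ((hD2 v vs).const_mul _)]
    congr 1; funext σ; ring
  simp_rw [e]
  have ei := emp_integrable h hN0
  simp_rw [integral_add (ei _) (ei _), integral_const_mul]
  rw [QInt_eq]; unfold GQ
  field_simp
end

section
variable (B : Vd d → MV d) [hC : CK B]

lemma ww_div (v v' : Vd d) (h : ‖v'‖ ≤ ‖v‖) : |ww v - ww v'| ≤ ‖v - v'‖ * ww v := by
  unfold ww
  have h1 := norm_sub_norm_le v v'
  have h0 := norm_nonneg v'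
  rw [abs_of_nonneg (by nlinarith)]
  have : (‖v‖ - ‖v'‖) * (‖v‖ + ‖v'‖) ≤ ‖v - v'‖ * (1 + ‖v‖ ^ 2) :=
    mul_le_mul h1 (by nlinarith [sq_nonneg (‖v‖ - 1)]) li (norm_nonneg _)
  nlinarith

lemma FP_test {f : FV d} (hf : f ∈ FP d) : (fun v => f v / 3) ∈ testF d := by
  have hw : ∀ v : Vd d, 0 < ww v := fun v => by have := ww_one v; linarith
  refine ⟨fun v => ?_, fun v v' => ?_⟩
  · have := hf.1 v
    change |f v / 3 / ww v| ≤ 1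
    rw [abs_div, abs_div, abs_of_pos (hw v), div_le_one (hw v)]
    norm_num
    have := abs_nonneg (f v)
    linarith
  · change |f v / 3 / ww v - f v' / 3 / ww v'| ≤ ‖v - v'‖
    wlog h : ‖v'‖ ≤ ‖v‖ generalizing v v'
    · rw [abs_sub_comm, norm_sub_rev]; exact this v' v (le_of_not_ge h)
    have e : f v / 3 / ww v - f v' / 3 / ww v' = ((f v - f v') + f v' / ww v' * (ww v' - ww v)) / (3 * ww v) := by
      have := (hw v).ne'
      have := (hw v').ne'
      field_simp
      ring
    have hww : ww v' ≤ ww v := by unfold ww; gcongr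
    rw [e, abs_div, abs_of_pos (by have := hw v; positivity : 0 < 3 * ww v), div_le_iff₀ (by have := hw v; positivity)]
    have h1 := hf.2 v v'
    have h2 : |f v' / ww v'| ≤ 1 := by
      rw [abs_div, abs_of_pos (hw v'), div_le_one (hw v')]; exact hf.1 v'
    have h3 : |f v' / ww v' * (ww v' - ww v)| ≤ 1 * (‖v - v'‖ * ww v) := by
      rw [abs_mul, abs_sub_comm (ww v')]; exact mul_le_mul h2 (ww_div v v' h) (abs_nonneg _) zero_le_one
    refine (abs_add_le _ _).trans ?_
    nlinarith [norm_nonneg (v - v')]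

lemma test_FP {f : FV d} (hf : f ∈ testF d) : f ∈ FP d := by
  have hw : ∀ v : Vd d, 0 < ww v := fun v => by have := ww_one v; linarith
  have h1 : ∀ v, |f v / ww v| ≤ 1 := hf.1
  have h2 : ∀ v v', |f v / ww v - f v' / ww v'| ≤ ‖v - v'‖ := hf.2
  refine ⟨fun v => ?_, fun v v' => ?_⟩
  · have := h1 v
    rwa [abs_div, abs_of_pos (hw v), div_le_one (hw v)] at this
  · wlog h : ‖v'‖ ≤ ‖v‖ generalizing v v'
    · rw [abs_sub_comm, norm_sub_rev, add_comm]; exact this v' v (le_of_not_ge h)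
    have e : f v - f v' = (f v / ww v - f v' / ww v') * ww v' + f v / ww v * (ww v - ww v') := by
      have := (hw v).ne'
      have := (hw v').ne'
      field_simp
      ring
    rw [e]
    refine (abs_add_le _ _).trans ?_
    rw [abs_mul, abs_mul, abs_of_pos (hw v')]
    have a1 := mul_le_mul_of_nonneg_right (h2 v v') (hw v').le
    have a2 := mul_le_mul (h1 v) (ww_div v v' h) (abs_nonneg _) zero_le_one
    linarith

lemma meas_of_FP {α : Type*} [MeasurableSpace α] {ν : α → MV d} (hp : ∀ a, IsProbabilityMeasure (ν a))
    (h : ∀ f ∈ FP d, Measurable fun a => ∫ v, f v ∂(ν a)) : Measurable ν := by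
  have hgen : (inferInstance : MeasurableSpace (Vd d)) = MeasurableSpace.generateFrom {s : Set (Vd d) | IsClosed s} := by
    rw [BorelSpace.measurable_eq (α := Vd d), borel_eq_generateFrom_isClosed]
  refine Measurable.measure_of_isPiSystem_of_isProbabilityMeasure hgen isPiSystem_isClosed fun F hF => ?_
  have dp : ∀ n : ℕ, (0:ℝ) < 1 / ((n:ℝ) + 1) := fun n => Nat.one_div_pos_of_nat
  refine measurable_of_tendsto_metrizable (f := fun n a => ∫⁻ v, (thickenedIndicator (dp n) F v : ℝ≥0∞) ∂(ν a)) (fun n => ?_)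
    (tendsto_pi_nhds.2 fun a => tendsto_lintegral_thickenedIndicator_of_isClosed (ν a) hF dp tendsto_one_div_add_atTop_nhds_zero_nat)
  set th : FV d := fun v => (thickenedIndicator (dp n) F v : ℝ) with hth
  have t1 : ∀ v, 0 ≤ th v ∧ th v ≤ 1 := fun v => ⟨NNReal.coe_nonneg _, NNReal.coe_le_one.2 (thickenedIndicator_le_one (dp n) F v)⟩
  have tl : ∀ v v', |th v - th v'| ≤ (n + 1) * ‖v - v'‖ := fun v v' => by
    have := (lipschitzWith_thickenedIndicator (dp n) F).dist_le_mul v v'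
    rw [NNReal.dist_eq, dist_eq_norm, NNReal.coe_inv, Real.coe_toNNReal _ (dp n).le] at this
    exact this.trans_eq (by rw [one_div, inv_inv])
  have hFP : (fun v => th v / (n + 1)) ∈ FP d := by
    have hn : (0:ℝ) < n + 1 := by positivity
    refine ⟨fun v => ?_, fun v v' => ?_⟩
    · rw [abs_div, abs_of_nonneg (t1 v).1, abs_of_pos hn, div_le_iff₀ hn]
      have := (t1 v).2
      have := ww_one v
      nlinarith
    · rw [← sub_div, abs_div, abs_of_pos hn, div_le_iff₀ hn]
      refine (tl v v').trans ?_
      have h1 := ww_one v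
      have h2 := ww_one v'
      have : ‖v - v'‖ * 1 ≤ ‖v - v'‖ * (ww v + ww v') := by gcongr; linarith
      nlinarith
  have hc : Continuous th := NNReal.continuous_coe.comp (thickenedIndicator (dp n) F).continuous
  have e : (fun a => ∫⁻ v, (thickenedIndicator (dp n) F v : ℝ≥0∞) ∂(ν a)) = fun a => ENNReal.ofReal ((n + 1) * ∫ v, th v / (n + 1) ∂(ν a)) := by
    funext a
    rw [integral_div, mul_div_cancel₀ _ (by positivity : (n:ℝ) + 1 ≠ 0), ofReal_integral_eq_lintegral_ofReal
      (Integrable.of_bound hc.aestronglyMeasurable 1 (ae_of_all _ fun v => by rw [Real.norm_of_nonneg (t1 v).1]; exact (t1 v).2)) (ae_of_all _ fun v => (t1 v).1)]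
    exact lintegral_congr fun v => by rw [hth]; simp
  rw [e]
  exact ((h _ hFP).const_mul _).ennreal_ofReal

lemma joint_meas {Ω : Type*} [MeasurableSpace Ω] {X : ℝ → Ω → ℝ} (hm : ∀ t, Measurable (X t))
    (hr : ∀ ω t, ContinuousWithinAt (fun s => X s ω) (Ici t) t) : Measurable fun z : ℝ × Ω => X z.1 z.2 := by
  refine measurable_of_tendsto_metrizable (f := fun (n : ℕ) (z : ℝ × Ω) => X ((⌈z.1 * (n + 1)⌉ : ℝ) / (n + 1)) z.2) (fun n => ?_) (tendsto_pi_nhds.2 fun z => ?_)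
  · have h1 : Measurable fun y : Ω × ℤ => X ((y.2 : ℝ) / (n + 1)) y.1 := measurable_from_prod_countable_left fun k => hm ((k:ℝ) / (n + 1))
    exact h1.comp (measurable_snd.prodMk (Int.measurable_ceil.comp (measurable_fst.mul_const ((n:ℝ) + 1))))
  · refine (hr z.2 z.1).tendsto.comp (tendsto_nhdsWithin_iff.2 ⟨?_, Eventually.of_forall fun n => ?_⟩)
    · have h1 : Tendsto (fun n : ℕ => z.1 + 1 / ((n:ℝ) + 1)) atTop (nhds (z.1 + 0)) := tendsto_const_nhds.add tendsto_one_div_add_atTop_nhds_zero_nat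
      rw [add_zero] at h1
      refine tendsto_of_tendsto_of_tendsto_of_le_of_le tendsto_const_nhds h1 (fun n => ?_) (fun n => ?_)
      · simp only
        rw [le_div_iff₀ po]; exact Int.le_ceil _
      · simp only
        rw [div_le_iff₀ po, add_mul, one_div, inv_mul_cancel₀ po]
        exact (Int.ceil_lt_add_one _).le
    · rw [mem_Ici, le_div_iff₀ po]; exact Int.le_ceil _

section
variable {B}
variable {Ω : Type*} {m : MeasurableSpace Ω} {P : Measure Ω} {𝓕 : Filtration ℝ m} {N : ℕ} {μp : ℝ → Ω → MV d}

lemma kac_prob (h : IsKacProcess B N P 𝓕 μp) (t : ℝ) (ω : Ω) : IsProbabilityMeasure (μp t ω) := (h.mem t ω).1.1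

lemma kac_adapt (h : IsKacProcess B N P 𝓕 μp) (t : ℝ) : Measurable[𝓕 t] (μp t) := by
  refine @meas_of_FP d Ω (𝓕 t) (μp t) (kac_prob h t) fun f hf => ?_
  have := (h.adapted _ (FP_test hf) t).mul_const 3
  simp only [integral_div] at this
  simpa using this

lemma kac_rc (h : IsKacProcess B N P 𝓕 μp) {f : FV d} (hf : f ∈ FP d) (ω : Ω) (t : ℝ) :
    ContinuousWithinAt (fun s => ∫ v, f v ∂(μp s ω)) (Ici t) t := by
  have := (h.rightCont ω _ (FP_test hf) t).mul_const 3
  simp only [integral_div] at this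
  simpa using this

lemma kac_joint (h : IsKacProcess B N P 𝓕 μp) : Measurable fun z : ℝ × Ω => μp z.1 z.2 :=
  meas_of_FP (fun z => kac_prob h z.1 z.2) fun f hf => joint_meas (X := fun t ω => ∫ v, f v ∂(μp t ω))
    (fun t => int_meas ((kac_adapt h t).mono (𝓕.le t) le_rfl) (fun a => kac_prob h t a) (h := fun _ v => f v) ((FP.cont hf).measurable.comp measurable_snd))
    (fun ω t => kac_rc h hf ω t)

lemma kac_path (h : IsKacProcess B N P 𝓕 μp) (ω : Ω) : Measurable fun t => μp t ω :=
  (kac_joint h).comp (measurable_id.prodMk measurable_const)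

lemma emp_IU {ν : MV d} (h : ν ∈ empiricalSphere d N) (q : ℝ) : IU q ν :=
  emp_integrable h (by have := emp_N h; omega) _

lemma emp_mU {ν : MV d} (h : ν ∈ empiricalSphere d N) {q : ℝ} (hq : 0 ≤ q) : mU q ν ≤ (1 + N) ^ q := by
  have := h.1.1
  have h1 : (1:ℝ) ≤ N := by have := emp_N h; exact_mod_cast (by omega : 1 ≤ N)
  refine (integral_mono_ae (emp_IU h q) (integrable_const ((1 + (N:ℝ)) ^ q)) ((emp_ball h).mono fun v hv => ?_)).trans_eq (by simp)
  have : ‖v‖ ≤ N := by nlinarith [norm_nonneg v]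
  simp only; gcongr

lemma kac_GP (h : IsKacProcess B N P 𝓕 μp) {p T : ℝ} (hp : 0 ≤ p) (hT : 0 ≤ T) (ω : Ω) : GP p T (fun t => μp t ω) where
  m := kac_path h ω
  s t := (h.mem t ω).1
  i := ae_of_all _ fun s => emp_IU (h.mem s ω) _
  k := ii_of_le hT (mU_meas (kac_path h ω) (fun t => (h.mem t ω).1) _) (intervalIntegrable_const (c := (1 + (N:ℝ)) ^ (p + 1)))
    (ae_of_all _ fun s => by rw [abs_of_nonneg (mU_nonneg _ _)]; exact emp_mU (h.mem s ω) li)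
end
end

section
variable (B : Vd d → MV d) [hC : CK B]

section
variable {Ω : Type*} {m : MeasurableSpace Ω} {P : Measure Ω} [IsProbabilityMeasure P] {𝓕 : Filtration ℝ m}

lemma mart_orth {M : ℝ → Ω → ℝ} (hM : Martingale M 𝓕 P) {s t c : ℝ} (hst : s ≤ t) {Y : Ω → ℝ}
    (hY : Measurable[𝓕 s] Y) (hb : ∀ ω, |Y ω| ≤ c) : ∫ ω, Y ω * (M t ω - M s ω) ∂P = 0 := by
  have hg : Integrable (M t - M s) P := (hM.integrable t).sub (hM.integrable s)
  have h1 := condExp_stronglyMeasurable_mul_of_bound (𝓕.le s) hY.stronglyMeasurable hg c (ae_of_all _ hb)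
  have h2 : P[M t - M s | 𝓕 s] =ᵐ[P] 0 := by
    refine (condExp_sub (hM.integrable t) (hM.integrable s) _).trans ?_
    filter_upwards [hM.condExp_ae_eq hst, hM.condExp_ae_eq (le_refl s)] with ω a b
    simp [a, b]
  change ∫ ω, (Y * (M t - M s)) ω ∂P = 0
  rw [← integral_condExp (𝓕.le s), integral_congr_ae (g := fun _ => (0:ℝ)) (by
    filter_upwards [h1, h2] with ω a b
    rw [a]; simp [b])]
  simp

lemma prim_sq {q : ℝ → ℝ} {t : ℝ} (hq : IntervalIntegrable q volume 0 t) :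
    (∫ s in 0..t, q s) ^ 2 = ∫ s in 0..t, 2 * ((∫ r in 0..s, q r) * q s) := by
  have T0 : (0:ℝ) ∈ uIcc 0 t := left_mem_uIcc
  have zAC := hq.absolutelyContinuousOnInterval_intervalIntegral T0
  have ftc := (zAC.fun_mul zAC).integral_deriv_eq_sub
  simp only [intervalIntegral.integral_same, mul_zero, sub_zero] at ftc
  rw [pow_two, ← ftc]
  refine intervalIntegral.integral_congr_ae ?_
  filter_upwards [hq.ae_hasDerivAt_integral] with x e1 hx
  have d1 := e1 (uIoc_subset_uIcc hx) 0 T0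
  rw [(d1.fun_mul d1).deriv]; ring

lemma primJ {a : ℝ → Ω → ℝ} (ha : Measurable fun z : ℝ × Ω => a z.1 z.2) :
    Measurable fun z : ℝ × Ω => ∫ r in Ioc 0 z.1, a r z.2 := by
  have h1 : Measurable fun y : (ℝ × Ω) × ℝ => (if 0 < y.2 ∧ y.2 ≤ y.1.1 then a y.2 y.1.2 else 0) :=
    Measurable.ite ((measurableSet_lt measurable_const measurable_snd).inter (measurableSet_le measurable_snd measurable_fst.fst))
      (ha.comp (measurable_snd.prodMk measurable_fst.snd)) measurable_const
  have h2 := (h1.stronglyMeasurable.integral_prod_right' (ν := volume)).measurable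
  convert h2 using 2 with z
  rw [← integral_indicator measurableSet_Ioc]
  exact integral_congr_ae (ae_of_all _ fun r => by simp [indicator, mem_Ioc])

theorem L2abs {X a γ : ℝ → Ω → ℝ} {c c' c'' t : ℝ} (ht : 0 ≤ t) (hX : Measurable fun z : ℝ × Ω => X z.1 z.2)
    (ha : Measurable fun z : ℝ × Ω => a z.1 z.2) (hγ : Measurable fun z : ℝ × Ω => γ z.1 z.2)
    (hXb : ∀ s ω, |X s ω| ≤ c) (hab : ∀ s ω, |a s ω| ≤ c') (hγb : ∀ s ω, |γ s ω| ≤ c'')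
    (hX0 : Measurable[𝓕 0] (X 0)) (haa : ∀ s, Measurable[𝓕 s] (a s))
    (hM : Martingale (fun t ω => X t ω - ∫ s in Ioc 0 t, a s ω) 𝓕 P)
    (hM2 : Martingale (fun t ω => (X t ω) ^ 2 - ∫ s in Ioc 0 t, (2 * X s ω * a s ω + γ s ω)) 𝓕 P) :
    Integrable (fun ω => (X t ω - X 0 ω - ∫ s in Ioc 0 t, a s ω) ^ 2) P ∧
    ∫ ω, (X t ω - X 0 ω - ∫ s in Ioc 0 t, a s ω) ^ 2 ∂P = ∫ ω, (∫ s in Ioc 0 t, γ s ω) ∂P := by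
  obtain ⟨ω0⟩ := nonempty_of_isProbabilityMeasure P
  have c0 := (abs_nonneg _).trans (hXb 0 ω0)
  have c'0 := (abs_nonneg _).trans (hab 0 ω0)
  set A : ℝ → Ω → ℝ := fun s ω => ∫ r in Ioc 0 s, a r ω with hA
  have mA : Measurable fun z : ℝ × Ω => A z.1 z.2 := primJ ha
  have sl : ∀ {f : ℝ → Ω → ℝ} (s : ℝ), (Measurable fun z : ℝ × Ω => f z.1 z.2) → Measurable (f s) :=
    fun s h => h.comp (measurable_const.prodMk measurable_id)
  have st : ∀ {f : ℝ → Ω → ℝ} (ω : Ω), (Measurable fun z : ℝ × Ω => f z.1 z.2) → Measurable (fun s => f s ω) :=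
    fun ω h => h.comp (measurable_id.prodMk measurable_const)
  have Ab : ∀ s ∈ Icc 0 t, ∀ ω, |A s ω| ≤ c' * t := fun s hs ω => by
    have := norm_setIntegral_le_of_norm_le_const (μ := volume) (s := Ioc 0 s) (f := fun r => a r ω) (C := c') (by simp) (fun r _ => hab r ω)
    rw [Real.norm_eq_abs] at this
    refine this.trans ?_
    simp only [Measure.real, Real.volume_Ioc, sub_zero, ENNReal.toReal_ofReal hs.1]
    exact mll hs.2 c'0
  set Z : ℝ → Ω → ℝ := fun s ω => X s ω - X 0 ω - A s ω with hZ
  have mX0 : Measurable fun z : ℝ × Ω => X 0 z.2 := (sl 0 hX).comp measurable_snd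
  have mZ : Measurable fun z : ℝ × Ω => Z z.1 z.2 := (hX.sub mX0).sub mA
  set b := 2 * c + c' * t
  have Zb : ∀ s ∈ Icc 0 t, ∀ ω, |Z s ω| ≤ b := fun s hs ω => by
    have h1 := abs_le.1 (hXb s ω)
    have h2 := abs_le.1 (hXb 0 ω)
    have h3 := abs_le.1 (Ab s hs ω)
    exact abs_le.2 ⟨by simp only [hZ, b]; linarith, by simp only [hZ, b]; linarith⟩
  have tI : t ∈ Icc 0 t := ⟨ht, le_rfl⟩
  have iP : ∀ {f : Ω → ℝ} (k : ℝ), Measurable f → (∀ ω, |f ω| ≤ k) → Integrable f P :=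
    fun k h1 h2 => Integrable.of_bound h1.aestronglyMeasurable k (ae_of_all _ h2)
  have iv : ∀ {f : ℝ → ℝ} (k : ℝ), Measurable f → (∀ s ∈ Icc 0 t, |f s| ≤ k) → IntegrableOn f (Ioc 0 t) :=
    fun k h1 h2 => Integrable.of_bound h1.aestronglyMeasurable k ((ae_restrict_iff' measurableSet_Ioc).2 (ae_of_all _ fun s hs => h2 s (Ioc_subset_Icc_self hs)))
  have path : ∀ ω, Z t ω ^ 2 = ((X t ω) ^ 2 - ∫ s in Ioc 0 t, (2 * X s ω * a s ω + γ s ω)) - (X 0 ω) ^ 2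
      - 2 * (X 0 ω * Z t ω) + (∫ s in Ioc 0 t, γ s ω) + 2 * ∫ s in Ioc 0 t, a s ω * (Z s ω - Z t ω) := by
    intro ω
    have ia : IntegrableOn (fun s => a s ω) (Ioc 0 t) := iv c' (st ω ha) fun s _ => hab s ω
    have iXa : IntegrableOn (fun s => 2 * X s ω * a s ω) (Ioc 0 t) := iv (2 * c * c') (((st ω hX).const_mul 2).mul (st ω ha)) fun s _ => by
      rw [abs_mul, abs_mul, abs_two]; gcongr <;> apply_assumption
    have iAa : IntegrableOn (fun s => 2 * (A s ω * a s ω)) (Ioc 0 t) := iv (2 * (c' * t * c')) (((st ω mA).mul (st ω ha)).const_mul 2) fun s hs => by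
      rw [abs_mul, abs_mul, abs_two]; gcongr
      · exact Ab s hs ω
      · exact hab s ω
    have e1 : (A t ω) ^ 2 = ∫ s in Ioc 0 t, 2 * (A s ω * a s ω) := by
      have := prim_sq (q := fun s => a s ω) ((intervalIntegrable_iff_integrableOn_Ioc_of_le ht).2 ia)
      rw [intervalIntegral.integral_of_le ht, intervalIntegral.integral_of_le ht] at this
      refine this.trans (setIntegral_congr_fun measurableSet_Ioc fun s hs => ?_)
      rw [intervalIntegral.integral_of_le hs.1.le]
    have iγ : IntegrableOn (fun s => γ s ω) (Ioc 0 t) := iv c'' (st ω hγ) fun s _ => hγb s ω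
    have e2 : 2 * ∫ s in Ioc 0 t, a s ω * (Z s ω - Z t ω) = (∫ s in Ioc 0 t, 2 * X s ω * a s ω) - (∫ s in Ioc 0 t, 2 * (A s ω * a s ω))
        - 2 * (X 0 ω + Z t ω) * A t ω := by
      rw [← integral_const_mul, hA, ← integral_const_mul, ← integral_sub iXa iAa, ← integral_sub (f := fun s => 2 * X s ω * a s ω - 2 * (A s ω * a s ω)) (iXa.sub iAa) (ia.const_mul _)]
      exact integral_congr_ae (ae_of_all _ fun s => by simp only [hZ]; ring)
    rw [e2, ← e1, integral_add iXa iγ]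
    have : X t ω = X 0 ω + Z t ω + A t ω := by simp only [hZ]; ring
    rw [this]; ring
  have m1 : Integrable (fun ω => (X t ω) ^ 2 - ∫ s in Ioc 0 t, (2 * X s ω * a s ω + γ s ω)) P := hM2.integrable t
  have i0 : Integrable (fun ω => X 0 ω ^ 2) P := iP (c ^ 2) ((sl 0 hX).pow_const 2) fun ω => by rw [abs_pow]; gcongr; exact hXb 0 ω
  have E1 : ∫ ω, ((X t ω) ^ 2 - ∫ s in Ioc 0 t, (2 * X s ω * a s ω + γ s ω)) ∂P = ∫ ω, X 0 ω ^ 2 ∂P := by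
    have := mart_orth hM2 ht (Y := fun _ => (1:ℝ)) measurable_const (c := 1) (by simp)
    simp only [one_mul, Ioc_self, Measure.restrict_empty, integral_zero_measure, sub_zero] at this
    rw [integral_sub m1 i0] at this
    linarith
  have i3 : Integrable (fun ω => X 0 ω * Z t ω) P := iP (c * b) ((sl 0 hX).mul (sl t mZ)) fun ω => by
    rw [abs_mul]; gcongr
    · exact hXb 0 ω
    · exact Zb t tI ω
  have E3 : ∫ ω, X 0 ω * Z t ω ∂P = 0 := by
    have := mart_orth hM ht hX0 (hXb 0)
    simp only [Ioc_self, Measure.restrict_empty, integral_zero_measure, sub_zero] at this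
    refine Eq.trans ?_ this
    exact integral_congr_ae (ae_of_all _ fun ω => by simp only [hZ, hA]; ring)
  have mg : Measurable fun z : Ω × ℝ => a z.2 z.1 * (Z z.2 z.1 - Z t z.1) :=
    (ha.comp measurable_swap).mul ((mZ.comp measurable_swap).sub ((sl t mZ).comp measurable_fst))
  have ig : Integrable (fun z : Ω × ℝ => a z.2 z.1 * (Z z.2 z.1 - Z t z.1)) (P.prod (volume.restrict (Ioc 0 t))) := by
    refine Integrable.of_bound mg.aestronglyMeasurable (c' * (b + b)) ?_
    have hae : ∀ᵐ z ∂(P.prod (volume.restrict (Ioc 0 t))), z.2 ∈ Ioc 0 t := by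
      refine Measure.quasiMeasurePreserving_snd.ae (p := fun s => s ∈ Ioc 0 t) (ae_restrict_mem measurableSet_Ioc)
    filter_upwards [hae] with z hz
    rw [norm_mul]
    refine mul_le_mul (hab _ _) ((norm_sub_le _ _).trans (add_le_add (Zb _ (Ioc_subset_Icc_self hz) _) (Zb t tI _))) (norm_nonneg _) c'0
  have E4 : ∫ ω, (∫ s in Ioc 0 t, a s ω * (Z s ω - Z t ω)) ∂P = 0 := by
    rw [integral_integral_swap (f := fun ω s => a s ω * (Z s ω - Z t ω)) ig]
    refine (setIntegral_congr_fun (g := fun _ => (0:ℝ)) measurableSet_Ioc fun s hs => ?_).trans (by simp)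
    simp only
    have := mart_orth hM hs.2 (haa s) (hab s)
    rw [← neg_eq_zero, ← integral_neg, ← this]
    exact integral_congr_ae (ae_of_all _ fun ω => by simp only [hZ, hA]; ring)
  have i4 : Integrable (fun ω => ∫ s in Ioc 0 t, a s ω * (Z s ω - Z t ω)) P := ig.integral_prod_left
  have i5 : Integrable (fun ω => ∫ s in Ioc 0 t, γ s ω) P :=
    iP (c'' * t) (sl (f := fun t ω => ∫ s in Ioc 0 t, γ s ω) t (primJ hγ)) fun ω => by
      have := norm_setIntegral_le_of_norm_le_const (μ := volume) (s := Ioc 0 t) (f := fun r => γ r ω) (C := c'') (by simp) (fun r _ => hγb r ω)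
      simpa [Measure.real, Real.volume_Ioc, ht] using this
  change Integrable (fun ω => Z t ω ^ 2) P ∧ ∫ ω, Z t ω ^ 2 ∂P = _
  refine ⟨iP (b ^ 2) ((sl t mZ).pow_const 2) fun ω => by rw [abs_pow]; gcongr; exact Zb t tI ω, ?_⟩
  have isub : ∀ {f g : Ω → ℝ}, Integrable f P → Integrable g P → Integrable (fun x => f x - g x) P := fun h k => h.sub k
  have q1 := isub m1 i0
  have q2 := isub q1 (i3.const_mul 2)
  have q3 := q2.fun_add i5
  rw [integral_congr_ae (ae_of_all _ path), integral_add q3 (i4.const_mul 2), integral_add q2 i5, integral_sub q1 (i3.const_mul 2),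
    integral_sub m1 i0, integral_const_mul, integral_const_mul, E1, E3, E4]
  ring
end
end

section
variable (B : Vd d → MV d) [hC : CK B]

lemma GQ_nonneg (f : FV d) (ν : MV d) : 0 ≤ GQ B f ν :=
  integral_nonneg fun _ => integral_nonneg fun _ => integral_nonneg fun _ => sq_nonneg _

lemma GQ_sum {N : ℕ} {ν : MV d} (h : ν ∈ empiricalSphere d N) {ι : Type*} (s : Finset ι) {f : ι → FV d}
    (hf : ∀ i, Measurable (f i)) {c q : ℝ} (hc : 0 ≤ c) (hq : 0 ≤ q) (hb : ∀ v, ∑ i ∈ s, (f i v) ^ 2 ≤ c * (jb v) ^ q) :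
    ∑ i ∈ s, GQ B (f i) ν ≤ 32 * c * (2 * 2 ^ q + 1) * mU (q + 1) ν := by
  have hN : N ≠ 0 := by have := emp_N h; omega
  have hi := fun f => emp_integrable h hN f
  have hLB : ∀ i ∈ s, LB (f i) := fun i his => ⟨hf i, fun R => ⟨1 + c * (1 + R) ^ q, fun v hv => by
    have h1 : (f i v) ^ 2 ≤ c * (1 + R) ^ q := ((Finset.single_le_sum (f := fun i => (f i v) ^ 2) (fun _ _ => sq_nonneg _) his).trans (hb v)).trans (by gcongr)
    rw [← sq_abs] at h1
    nlinarith [sq_nonneg (|f i v| - 1)]⟩⟩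
  have hsq : ∀ i ∈ s, ∀ v vs, Integrable (fun σ => (Dl (f i) v vs σ) ^ 2) (B (v - vs)) := fun i his v vs => by
    obtain ⟨k, hk⟩ := Dl_bdd (hLB i his) v vs
    exact B_integrable B ((Dl_meas1 (hf i) v vs).pow_const 2) (c := k ^ 2) fun σ hσ => by rw [abs_pow]; have := hk σ hσ; gcongr
  set A := 4 * c * (2 * 2 ^ q + 1) with hA
  have A0 : 0 ≤ A := by positivity
  have pt : ∀ v vs : Vd d, ∑ i ∈ s, ∫ σ, (Dl (f i) v vs σ) ^ 2 ∂(B (v - vs)) ≤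
      A * ((jb v) ^ (q + 1) * (jb vs) + (jb v) * (jb vs) ^ (q + 1)) := fun v vs => by
    rw [← integral_finsetSum _ fun i his => hsq i his v vs]
    refine (B_int_le B (integrable_finsetSum _ fun i his => hsq i his v vs) (c := A * ((jb v) ^ q + (jb vs) ^ q)) fun σ hσ => ?_).trans ?_
    · have h1 : ∀ i ∈ s, (Dl (f i) v vs σ) ^ 2 ≤ 4 * ((f i (postV v vs σ)) ^ 2 + (f i (postVs v vs σ)) ^ 2 + (f i v) ^ 2 + (f i vs) ^ 2) := fun i _ => by
        unfold Dl
        generalize f i (postV v vs σ) = x, f i (postVs v vs σ) = y, f i v = z, f i vs = w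
        nlinarith [sq_nonneg (x - y), sq_nonneg (x + z), sq_nonneg (x + w), sq_nonneg (y + z), sq_nonneg (y + w), sq_nonneg (z - w)]
      refine (Finset.sum_le_sum h1).trans ?_
      rw [← Finset.mul_sum, Finset.sum_add_distrib, Finset.sum_add_distrib, Finset.sum_add_distrib]
      have e1 := (hb _).trans (mll (U_post hq (postV_le hσ v vs)) hc)
      have e2 := (hb _).trans (mll (U_post hq (postVs_le hσ v vs)) hc)
      have e3 := hb v
      have e4 := hb vs
      rw [hA]; linarith
    · have := mul_le_mul_of_nonneg_right (norm_sub_le_U v vs) (show 0 ≤ A * ((jb v) ^ q + (jb vs) ^ q) by positivity)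
      refine this.trans_eq ?_
      rw [U_succ, U_succ]; ring
  have e1 : ∑ i ∈ s, GQ B (f i) ν = ∫ v, ∫ vs, ∑ i ∈ s, ∫ σ, (Dl (f i) v vs σ) ^ 2 ∂(B (v - vs)) ∂ν ∂ν := by
    simp only [GQ]
    rw [← integral_finsetSum _ fun i _ => hi _]
    refine integral_congr_ae (ae_of_all _ fun v => ?_)
    simp only
    rw [← integral_finsetSum _ fun i _ => hi _]
  rw [e1]
  have e2 : ∀ v : Vd d, ∫ vs, A * ((jb v) ^ (q + 1) * (jb vs) + (jb v) * (jb vs) ^ (q + 1)) ∂ν =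
      A * ((jb v) ^ (q + 1) * mU 1 ν + (jb v) * mU (q + 1) ν) := fun v => by
    rw [integral_const_mul, integral_add (hi _) (hi _), integral_const_mul, integral_const_mul]
    simp only [mU, Real.rpow_one]
  refine (integral_mono (hi _) (hi _) fun v => (integral_mono (hi _) (hi _) (pt v)).trans_eq (e2 v)).trans ?_
  rw [integral_const_mul, integral_add (hi _) (hi _), integral_mul_const, integral_mul_const]
  have e3 : ∫ v, (jb v) ∂ν = mU 1 ν := by simp only [mU, Real.rpow_one]
  rw [e3]
  change A * (mU (q + 1) ν * mU 1 ν + mU 1 ν * mU (q + 1) ν) ≤ _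
  have := BS_mU1 h.1
  have := mll this (mul_nonneg A0 (mU_nonneg (q + 1) ν))
  rw [show 32 * c * (2 * 2 ^ q + 1) = 8 * A by rw [hA]; ring]
  linarith

lemma GQ_meas {α : Type*} [MeasurableSpace α] {μ : α → MV d}
    (hμ : Measurable μ) (hp : ∀ a, IsProbabilityMeasure (μ a)) {f : FV d} (hf : Measurable f) :
    Measurable fun a => GQ B f (μ a) := by
  refine int_meas hμ hp (h := fun a v => ∫ vs, ∫ σ, (Dl f v vs σ) ^ 2 ∂(B (v - vs)) ∂(μ a)) ?_
  have h1 := B_meas B (u := fun z : Vd d × Vd d => z.1 - z.2) fp (h := fun z σ => (Dl f z.1 z.2 σ) ^ 2) ((Dl_meas hf).pow_const 2)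
  exact int_meas (α := α × Vd d) (μ := fun z => μ z.1) (hμ.comp measurable_fst) (fun z => hp _)
    (h := fun z vs => ∫ σ, (Dl f z.2 vs σ) ^ 2 ∂(B (z.2 - vs)))
    (h1.comp ((measurable_snd.comp measurable_fst).prodMk measurable_snd))

/-- martingale part -/
def MM (ν : ℝ → MV d) (t : ℝ) (f : FV d) : ℝ := ∫ v, f v ∂(ν t) - JJ B ν t f

section
variable {Ω : Type*} {m : MeasurableSpace Ω} {P : Measure Ω} {𝓕 : Filtration ℝ m} {N : ℕ} {μp : ℝ → Ω → MV d}

lemma MM_eq {t : ℝ} (ht : 0 ≤ t) (f : FV d) (ω : Ω) : MM B (μp · ω) t f =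
    ∫ v, f v ∂(μp t ω) - ∫ v, f v ∂(μp 0 ω) - ∫ s in Ioc 0 t, QInt B f (μp s ω) (μp s ω) := by
  rw [MM, JJ, intervalIntegral.integral_of_le ht]; ring

lemma kac_mart (h : IsKacProcess B N P 𝓕 μp) {f : FV d} {c : ℝ} (hf : Measurable f) (hb : ∀ v, |f v| ≤ c) :
    Martingale (fun t ω => ∫ v, f v ∂(μp t ω) - ∫ s in Ioc 0 t, QInt B f (μp s ω) (μp s ω)) 𝓕 P := by
  have c0 := (abs_nonneg _).trans (hb 0)
  have := h.martingale (cl c f) (cl_meas c hf) ⟨c, cl_bd c0 f⟩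
  convert this using 4 with t ω
  · have := kac_prob h t ω
    exact (cl_eq hf hb _).symm
  · exact integral_congr_ae (ae_of_all _ fun s => (kacGen_id B (h.mem s _) hf hb).symm)

lemma kac_mart2 (h : IsKacProcess B N P 𝓕 μp) {f : FV d} {c : ℝ} (hf : Measurable f) (hb : ∀ v, |f v| ≤ c) :
    Martingale (fun t ω => (∫ v, f v ∂(μp t ω)) ^ 2 - ∫ s in Ioc 0 t,
      (2 * (∫ v, f v ∂(μp s ω)) * QInt B f (μp s ω) (μp s ω) + (N : ℝ)⁻¹ * GQ B f (μp s ω))) 𝓕 P := by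
  have c0 := (abs_nonneg _).trans (hb 0)
  have := h.martingale (fun ν => (cl c f ν) ^ 2) ((cl_meas c hf).pow_const 2) ⟨c ^ 2, fun ν => by
    rw [abs_pow]; have := cl_bd c0 f ν; gcongr⟩
  convert this using 4 with t ω
  · have := kac_prob h t ω
    rw [cl_eq hf hb]
  · exact integral_congr_ae (ae_of_all _ fun s => (kacGen_sq B (h.mem s _) hf hb).symm)

lemma f_le_U {f : FV d} {c : ℝ} (hb : ∀ v, |f v| ≤ c) {q : ℝ} (hq : 0 ≤ q) (v : Vd d) : |f v| ≤ c * (jb v) ^ q :=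
  (hb v).trans (le_mul_of_one_le_right ((abs_nonneg _).trans (hb v)) (one_le_U v hq))

lemma kac_Qb (h : IsKacProcess B N P 𝓕 μp) {f : FV d} (hf : Measurable f) {c q : ℝ} (hc : 0 ≤ c) (hq : 0 ≤ q)
    (hb : ∀ v, |f v| ≤ c * (jb v) ^ q) (s : ℝ) (ω : Ω) :
    |QInt B f (μp s ω) (μp s ω)| ≤ c * (2 * 2 ^ q + 1) * 8 * mU (q + 1) (μp s ω) := by
  have := kac_prob h s ω
  have i := fun r => emp_IU (h.mem s ω) r
  refine (cQ_prod B hf hc hq hb (i _) (i _)).2.2.trans ?_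
  have h1 := BS_mU1 (h.mem s ω).1
  have h2 := mU_nonneg (q + 1) (μp s ω)
  rw [mul_assoc _ 8]
  exact mul_le_mul_of_nonneg_left (by nlinarith) po

theorem kac_L2 [IsProbabilityMeasure P] (h : IsKacProcess B N P 𝓕 μp) {f : FV d} {c : ℝ} (hf : Measurable f) (hb : ∀ v, |f v| ≤ c) {t : ℝ} (ht : 0 ≤ t) :
    Integrable (fun ω => (MM B (μp · ω) t f) ^ 2) P ∧
    ∫ ω, (MM B (μp · ω) t f) ^ 2 ∂P = (N : ℝ)⁻¹ * ∫ ω, (∫ s in Ioc 0 t, GQ B f (μp s ω)) ∂P := by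
  have c0 := (abs_nonneg _).trans (hb 0)
  have hj := kac_joint h
  have mu : ∀ s ω, mU (0 + 1) (μp s ω) ≤ 4 := fun s ω => by rw [zero_add]; exact BS_mU1 (h.mem s ω).1
  have := L2abs (X := fun t ω => ∫ v, f v ∂(μp t ω)) (a := fun s ω => QInt B f (μp s ω) (μp s ω))
    (γ := fun s ω => (N : ℝ)⁻¹ * GQ B f (μp s ω)) (c := c) (c' := c * (2 * 2 ^ (0:ℝ) + 1) * 8 * 4) (c'' := (N:ℝ)⁻¹ * (32 * c ^ 2 * (2 * 2 ^ (0:ℝ) + 1) * 4)) ht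
    (int_meas hj (fun z => kac_prob h z.1 z.2) (h := fun _ v => f v) (hf.comp measurable_snd))
    (Q_meas B hj (fun z => kac_prob h z.1 z.2) hf) ((GQ_meas B hj (fun z => kac_prob h z.1 z.2) hf).const_mul _)
    (fun s ω => by have := kac_prob h s ω; simpa using norm_integral_le_of_norm_le_const (μ := μp s ω) (f := f) (ae_of_all _ hb))
    (fun s ω => (kac_Qb B h hf c0 le_rfl (f_le_U hb le_rfl) s ω).trans (mll (mu s ω) po))
    (fun s ω => by
      rw [abs_of_nonneg (mul_nonneg po (GQ_nonneg B _ _))]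
      have := GQ_sum B (h.mem s ω) (Finset.univ : Finset Unit) (f := fun _ => f) (fun _ => hf) (c := c ^ 2) (q := 0) (sq_nonneg c) le_rfl (fun v => by
        simp only [Finset.univ_unique, Finset.sum_const, Finset.card_singleton, one_smul, Real.rpow_zero, mul_one]
        rw [← sq_abs]; have := hb v; gcongr)
      simp only [Finset.univ_unique, Finset.sum_const, Finset.card_singleton, one_smul] at this
      exact mll (this.trans (mll (mu s ω) po)) po)
    (@int_meas Ω _ (𝓕 0) _ _ (kac_adapt h 0) (fun a => kac_prob h 0 a) (fun _ v => f v) (hf.comp measurable_snd))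
    (fun s => @Q_meas d B _ Ω (𝓕 s) _ (kac_adapt h s) (fun a => kac_prob h s a) f hf)
    (kac_mart B h hf hb) (kac_mart2 B h hf hb)
  simp only [MM_eq B ht]
  refine ⟨this.1, this.2.trans ?_⟩
  rw [← integral_const_mul]
  simp only [integral_const_mul]
end
end

section
variable (B : Vd d → MV d) [hC : CK B]
section
variable {Ω : Type*} {m : MeasurableSpace Ω} {P : Measure Ω} {𝓕 : Filtration ℝ m} {N : ℕ} {μp : ℝ → Ω → MV d}

lemma kac_abs [IsProbabilityMeasure P] (h : IsKacProcess B N P 𝓕 μp) {f : FV d} {c : ℝ} (hf : Measurable f) (hb : ∀ v, |f v| ≤ c)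
    {δ : ℝ} (hδ : 0 ≤ δ) (𝓖 : Filtration ℕ m) (h𝓖 : ∀ k : ℕ, 𝓖 k = 𝓕 (k * δ)) :
    Submartingale (fun (k : ℕ) ω => |MM B (μp · ω) (k * δ) f|) 𝓖 P := by
  have hm := kac_mart B h hf hb
  have m1 : Martingale (fun (k : ℕ) ω => ∫ v, f v ∂(μp (k * δ) ω) - ∫ s in Ioc 0 (k * δ), QInt B f (μp s ω) (μp s ω)) 𝓖 P := by
    refine ⟨fun k => ?_, fun i j hij => ?_⟩
    · rw [h𝓖]; exact hm.1 (k * δ)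
    · rw [h𝓖]; exact hm.2 _ _ (by gcongr)
  have m2 := m1.sub (martingale_const_fun 𝓖 P (m1.1 0) (m1.integrable 0))
  refine (congrArg (fun z => Submartingale z 𝓖 P) (funext fun k => funext fun ω => ?_)).mp (m2.submartingale.sup m2.neg.submartingale)
  have := MM_eq B (μp := μp) (show 0 ≤ (k:ℝ) * δ by positivity) f ω
  simp only [Pi.sub_apply, Pi.sup_apply, Pi.neg_apply, abs, this, Nat.cast_zero, zero_mul, Ioc_self, Measure.restrict_empty, integral_zero_measure]
  congr 1 <;> ring

/-- dyadic fractions of `T` -/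
def dyT (T t : ℝ) : Prop := ∃ n k : ℕ, k ≤ 2 ^ n ∧ t = k * (T / 2 ^ n)

lemma dyT.mem {T t : ℝ} (hT : 0 ≤ T) (h : dyT T t) : t ∈ Icc 0 T := by
  obtain ⟨n, k, hk, rfl⟩ := h
  refine ⟨by positivity, ?_⟩
  have : (k : ℝ) ≤ 2 ^ n := by exact_mod_cast hk
  calc (k : ℝ) * (T / 2 ^ n) ≤ 2 ^ n * (T / 2 ^ n) := by gcongr
    _ = T := by field_simp

theorem kac_max [IsProbabilityMeasure P] (h : IsKacProcess B N P 𝓕 μp) {ι : Type*} (s : Finset ι) {f : ι → FV d} {b c : ι → ℝ}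
    (hf : ∀ i, Measurable (f i)) (hb : ∀ i v, |f i v| ≤ b i) (hc : ∀ i, 0 ≤ c i) {T a : ℝ} (hT : 0 ≤ T) (ha : 0 < a) :
    P {ω | ∃ t, dyT T t ∧ a ≤ ∑ i ∈ s, c i * |MM B (μp · ω) t (f i)|} ≤
      ENNReal.ofReal ((∫ ω, ∑ i ∈ s, c i * |MM B (μp · ω) T (f i)| ∂P) / a) := by
  set S : ℝ → Ω → ℝ := fun t ω => ∑ i ∈ s, c i * |MM B (μp · ω) t (f i)| with hS
  set E : ℕ → Set Ω := fun n => {ω | ∃ k : ℕ, k ≤ 2 ^ n ∧ a ≤ S (k * (T / 2 ^ n)) ω} with hE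
  have hU : {ω | ∃ t, dyT T t ∧ a ≤ S t ω} = ⋃ n, E n := by
    ext ω; simp only [mem_ofPred_eq, mem_iUnion, hE, dyT]
    constructor
    · rintro ⟨t, ⟨n, k, hk, rfl⟩, h⟩; exact ⟨n, k, hk, h⟩
    · rintro ⟨n, k, hk, h⟩; exact ⟨_, ⟨n, k, hk, rfl⟩, h⟩
  have hmono : Monotone E := monotone_nat_of_le_succ fun n ω => by
    rintro ⟨k, hk, h⟩
    refine ⟨2 * k, by rw [pow_succ]; omega, ?_⟩
    rwa [show ((2 * k : ℕ) : ℝ) * (T / 2 ^ (n + 1)) = k * (T / 2 ^ n) by push_cast; rw [pow_succ]; field_simp]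
  change P {ω | ∃ t, dyT T t ∧ a ≤ S t ω} ≤ _
  rw [hU, hmono.measure_iUnion]
  refine iSup_le fun n => ?_
  have hδ : 0 ≤ T / 2 ^ n := by positivity
  let 𝓖 : Filtration ℕ m := ⟨fun k => 𝓕 (k * (T / 2 ^ n)), fun i j hij => 𝓕.mono (by gcongr), fun k => 𝓕.le _⟩
  have hsub : Submartingale (fun (k : ℕ) ω => S (k * (T / 2 ^ n)) ω) 𝓖 P := by
    simp only [hS]
    have hi := fun i => (kac_abs B h (hf i) (hb i) hδ 𝓖 (fun _ => rfl)).smul_nonneg (hc i)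
    clear_value 𝓖
    clear_value S E
    clear hS hE hU hmono
    classical
    induction s using Finset.induction_on with
    | empty => simp only [Finset.sum_empty]; exact (martingale_zero ℝ 𝓖 P).submartingale
    | insert i s his ih =>
      simp only [Finset.sum_insert his]
      exact (hi i).add (ih)
  have hS0 : ∀ t ω, 0 ≤ S t ω := fun t ω => Finset.sum_nonneg fun i _ => mul_nonneg (hc i) (abs_nonneg _)
  have hmax := maximal_ineq hsub (fun k ω => hS0 _ ω) (ε := a.toNNReal) (2 ^ n)
  have hTT : ((2 ^ n : ℕ) : ℝ) * (T / 2 ^ n) = T := by push_cast; field_simp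
  rw [hTT] at hmax
  have hST : Integrable (S T) P := by have := hsub.integrable (2 ^ n); rwa [hTT] at this
  have hset : E n ⊆ {ω | (a.toNNReal : ℝ) ≤ (Finset.range (2 ^ n + 1)).sup' Finset.nonempty_range_add_one fun k => S (k * (T / 2 ^ n)) ω} := by
    rintro ω ⟨k, hk, h⟩
    simp only [mem_ofPred_eq, Real.coe_toNNReal a ha.le, Finset.le_sup'_iff]
    exact ⟨k, by simp; omega, h⟩
  rw [ENNReal.ofReal_div_of_pos ha, ENNReal.le_div_iff_mul_le (by left; simpa using ha) (by left; simp), mul_comm]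
  calc ENNReal.ofReal a * P (E n) ≤ _ := mul_le_mul_right (measure_mono hset) _
    _ ≤ _ := hmax
    _ ≤ _ := ENNReal.ofReal_le_ofReal (setIntegral_le_integral hST (ae_of_all _ (hS0 T)))
end
end

section
variable (B : Vd d → MV d) [hC : CK B]

lemma emp_pov {p : ℝ} (hp : 2 < p) : ∃ A ≥ 0, ∃ c > 0, ∀ N : ℕ, ∀ ν ∈ empiricalSphere d N,
    QInt B (gK (p / 2 - 1) (N + 2)) ν ν ≤ A - c * mU (p + 1) ν := by
  obtain ⟨C, C0, c, c0, H⟩ := pov_Q B hp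
  set e := c / 2 ^ (p + 1) with he
  have e0 : 0 < e := by positivity
  refine ⟨c + C * (2 * C / e) ^ p, by positivity, e / 2, by positivity, fun N ν hν => ?_⟩
  have hN : N ≠ 0 := by have := emp_N hν; omega
  have hi := fun f => emp_integrable hν hN f
  have := hν.1.1
  have h1 := H (N + 2) po ν hν.1 (hi _)
  have h2 : ∫ v, hK p (N + 2) v ∂ν = ∫ v, ‖v‖ ^ (p + 1) ∂ν := integral_congr_ae (by
    filter_upwards [emp_ball hν] with v hv
    unfold hK; rw [indicator_of_mem (show v ∈ {v : Vd d | ‖v‖ ^ 2 + 2 ≤ (N:ℝ) + 2} by simpa using hv)])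
  have h3 := (IU_of_pow (q := p + 1) li (hi fun v => ‖v‖ ^ (p + 1))).2
  have h4 : C * mU p ν ≤ e / 2 * mU (p + 1) ν + C * (2 * C / e) ^ p := by
    have : ∀ v : Vd d, C * (jb v) ^ p ≤ e / 2 * (jb v) ^ (p + 1) + C * (2 * C / e) ^ p := fun v => by
      have u := U_pos v p
      rw [U_succ]
      rcases le_total (jb v) (2 * C / e) with h | h
      · have : C * (jb v) ^ p ≤ C * (2 * C / e) ^ p := by gcongr
        have : 0 ≤ e / 2 * ((jb v) * (jb v) ^ p) := by positivity
        nlinarith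
      · rw [div_le_iff₀ e0] at h
        have : 0 ≤ C * (2 * C / e) ^ p := by positivity
        nlinarith
    have := integral_mono (hi _) (hi _) this
    rwa [integral_const_mul, integral_add (hi _) (hi _), integral_const_mul, integral_const, probReal_univ, one_smul] at this
  rw [h2] at h1
  have h5 : e * mU (p + 1) ν ≤ c * (1 + ∫ v, ‖v‖ ^ (p + 1) ∂ν) := by
    have := mll h3 e0.le
    refine this.trans_eq ?_
    rw [he]; field_simp
  linarith

section
variable {Ω : Type*} {m : MeasurableSpace Ω} {P : Measure Ω} {𝓕 : Filtration ℝ m} {N : ℕ} {μp : ℝ → Ω → MV d}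

lemma kac_mUi [IsProbabilityMeasure P] (h : IsKacProcess B N P 𝓕 μp) {q : ℝ} (hq : 0 ≤ q) (t : ℝ) : Integrable (fun ω => ∫ s in Ioc 0 t, mU q (μp s ω)) P := by
  have hm := int_meas (kac_joint h) (fun z => kac_prob h z.1 z.2) (h := fun _ v => (jb v) ^ q) (by unfold Function.uncurry; fun_prop)
  refine Integrable.of_bound (C := (1 + (N:ℝ)) ^ q * volume.real (Ioc 0 t)) ((primJ (a := fun s ω => mU q (μp s ω)) hm).comp (measurable_const (a := t).prodMk measurable_id)).aestronglyMeasurable (ae_of_all _ fun ω => ?_)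
  refine norm_setIntegral_le_of_norm_le_const measure_Ioc_lt_top fun s _ => ?_
  rw [Real.norm_of_nonneg (mU_nonneg _ _)]; exact emp_mU (h.mem s ω) hq

lemma kac_mean [IsProbabilityMeasure P] (h : IsKacProcess B N P 𝓕 μp) {f : FV d} {c : ℝ} (hf : Measurable f) (hb : ∀ v, |f v| ≤ c)
    {t : ℝ} (ht : 0 ≤ t) : Integrable (fun ω => MM B (μp · ω) t f) P ∧ ∫ ω, MM B (μp · ω) t f ∂P = 0 := by
  have hm := kac_mart B h hf hb
  have e : (fun ω => MM B (μp · ω) t f) = fun ω => (∫ v, f v ∂(μp t ω) - ∫ s in Ioc 0 t, QInt B f (μp s ω) (μp s ω)) -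
      (∫ v, f v ∂(μp 0 ω) - ∫ s in Ioc 0 0, QInt B f (μp s ω) (μp s ω)) := by
    funext ω; rw [MM_eq B ht]; simp only [Ioc_self, Measure.restrict_empty, integral_zero_measure]; ring
  rw [e]
  refine ⟨(hm.integrable t).sub (hm.integrable 0), ?_⟩
  rw [integral_sub (hm.integrable t) (hm.integrable 0)]
  have := hm.setIntegral_eq ht (s := univ) MeasurableSet.univ
  simp only [Measure.restrict_univ] at this
  rw [this, sub_self]
end

theorem kac_mom {p lam T ε : ℝ} (hp : 2 < p) (hl : 0 ≤ lam) (hT : 0 ≤ T) (hε : 0 < ε) : ∃ M ≥ 1,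
    ∀ {Ω : Type} {m : MeasurableSpace Ω} {P : Measure Ω} [IsProbabilityMeasure P] {𝓕 : Filtration ℝ m} {N : ℕ} {μp : ℝ → Ω → MV d},
    IsKacProcess B N P 𝓕 μp → (∀ ω, momentL p (μp 0 ω) ≤ ENNReal.ofReal lam) →
    ∫ ω, (∫ s in Ioc 0 T, mU (p + 1) (μp s ω)) ∂P ≤ M ∧
    P {ω | ¬ (∫ s in Ioc 0 T, mU (p + 1) (μp s ω) ≤ M ∧ ∀ t, dyT T t → mU p (μp t ω) ≤ M)} ≤ ENNReal.ofReal ε := by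
  obtain ⟨A, A0, c, c0, H⟩ := emp_pov B hp
  set D := lam + A * T with hD
  have D0 : 0 ≤ D := by positivity
  set a := 2 * D / ε + 1 with ha
  have a0 : 0 < a := by positivity
  refine ⟨1 + (D + a) / c + 2 ^ p * (1 + D + a), by have : 0 ≤ (D + a) / c + 2 ^ p * (1 + D + a) := by positivity
                                                    linarith, fun {Ω m P _ 𝓕 N μp} h h0 => ?_⟩
  have hK : (0:ℝ) ≤ (N:ℝ) + 2 := by positivity
  have hr : 0 < p / 2 - 1 := by linarith
  set g : FV d := gK (p / 2 - 1) (N + 2)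
  have gm : Measurable g := (gK_cont hr).measurable
  have gb : ∀ v, |g v| ≤ _ := gK_bd hr hK
  have hi := fun t ω f => emp_integrable (h.mem t ω) (by have := emp_N (h.mem t ω); omega) f
  have key : ∀ t ∈ Icc 0 T, ∀ ω, ∫ v, ‖v‖ ^ p ∂(μp t ω) + c * ∫ s in Ioc 0 t, mU (p + 1) (μp s ω) ≤ D + MM B (μp · ω) t g := fun t ht ω => by
    have n : ∀ t, ∫ v, g v ∂(μp t ω) = ∫ v, ‖v‖ ^ p ∂(μp t ω) - (N + 2 : ℝ) ^ (p / 2 - 1) := fun t => by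
      rw [int_gK hp hK (h.mem t ω).1 (hi t ω _)]
      congr 1
      refine integral_congr_ae ?_
      filter_upwards [emp_ball (h.mem t ω)] with v hv
      unfold fK psi
      rw [min_eq_left li]
      rcases eq_or_ne v 0 with rfl | hv
      · rw [norm_zero, Real.zero_rpow li]; simp
      · have : 0 < ‖v‖ := norm_pos_iff.2 hv
        rw [← Real.rpow_natCast, ← Real.rpow_mul this.le, ← Real.rpow_add this]
        congr 1; push_cast; ring
    rw [MM_eq B ht.1, n, n]
    have iu := (kac_GP h (p := p) li ht.1 ω).k
    have h1 : ∫ s in Ioc 0 t, QInt B g (μp s ω) (μp s ω) ≤ ∫ s in Ioc 0 t, (A - c * mU (p + 1) (μp s ω)) := by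
      have iu2 := (kac_GP h (p := 2) li ht.1 ω).qi B ht.1 le_rfl gm (c := (N + 2 : ℝ) ^ (p / 2 - 1) * (N + 2)) po (f_le_U gb nq)
      rw [intervalIntegrable_iff_integrableOn_Ioc_of_le ht.1] at iu iu2
      exact integral_mono iu2 ((integrable_const A).sub (iu.const_mul c)) fun s => H N _ (h.mem s ω)
    rw [intervalIntegrable_iff_integrableOn_Ioc_of_le ht.1] at iu
    rw [integral_sub (integrable_const A) (iu.const_mul c), integral_const, integral_const_mul] at h1
    simp only [MeasurableSet.univ, measureReal_restrict_apply, univ_inter, Real.volume_real_Ioc_of_le ht.1, sub_zero, smul_eq_mul] at h1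
    have h2 := (pow_of_momL li hl (h0 ω)).2
    have : t * A ≤ A * T := by nlinarith [ht.2]
    linarith
  have nn : ∀ t ω, 0 ≤ ∫ v, ‖v‖ ^ p ∂(μp t ω) := fun t ω => integral_nonneg fun v => by positivity
  have mm : ∀ t ω, 0 ≤ ∫ s in Ioc 0 t, mU (p + 1) (μp s ω) := fun t ω => integral_nonneg fun s => mU_nonneg _ _
  have TT : T ∈ Icc 0 T := ⟨hT, le_rfl⟩
  obtain ⟨k1, k2⟩ := kac_mean B h gm gb hT
  have hc : ∀ x y : ℝ, c * x ≤ y → x ≤ y / c := fun x y hxy => by rw [le_div_iff₀ c0]; linarith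
  have pc : 0 ≤ a / c := by positivity
  have pd : 0 ≤ 2 ^ p * (1 + D + a) := by positivity
  have pe : 0 ≤ (D + a) / c := by positivity
  constructor
  · have h1 : c * ∫ ω, (∫ s in Ioc 0 T, mU (p + 1) (μp s ω)) ∂P ≤ D := by
      rw [← integral_const_mul]
      refine (integral_mono ((kac_mUi B h li T).const_mul c) ((integrable_const D).fun_add k1) fun ω => ?_).trans_eq
        (by rw [integral_add (integrable_const D) k1, k2]; simp)
      exact (le_add_of_nonneg_left (nn T ω)).trans (key T TT ω)
    have := hc _ _ h1
    rw [add_div] at pe ⊢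
    linarith
  · have h1 := kac_max B h ({()} : Finset Unit) (f := fun _ => g) (b := fun _ => _) (c := fun _ => 1) (fun _ => gm) (fun _ => gb) (fun _ => zero_le_one) hT a0
    simp only [Finset.sum_singleton, one_mul] at h1
    refine (measure_mono fun ω hω => ?_).trans (h1.trans (ENNReal.ofReal_le_ofReal ?_))
    · by_contra hno
      simp only [mem_ofPred_eq, not_exists, not_and, not_le] at hno
      refine hω ⟨?_, fun t ht => ?_⟩
      · have h2 := key T TT ω
        have h3 := hno T ⟨0, 1, by simp, by simp⟩
        have := hc (∫ s in Ioc 0 T, mU (p + 1) (μp s ω)) (D + a) (by linarith [le_abs_self (MM B (μp · ω) T g), nn T ω])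
        linarith
      · have h2 := key t (ht.mem hT) ω
        have h3 := hno t ht
        have := kac_prob h t ω
        refine ((IU_of_pow li (hi t ω _)).2.trans (mul_le_mul_of_nonneg_left (b := 1 + ∫ v, ‖v‖ ^ p ∂(μp t ω)) (c := 1 + D + a) ?_ po)).trans li
        have := mul_nonneg c0.le (mm t ω)
        linarith [le_abs_self (MM B (μp · ω) t g)]
    · rw [div_le_iff₀ a0]
      have h2 : ∫ ω, |MM B (μp · ω) T g| ∂P ≤ 2 * D := by
        refine (integral_mono k1.abs ((integrable_const (2 * D)).fun_add k1) fun ω => ?_).trans_eq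
          (by rw [integral_add (integrable_const _) k1, k2]; simp)
        have := key T TT ω
        have := nn T ω
        have := mul_nonneg c0.le (mm T ω)
        change |_| ≤ 2 * D + MM B (μp · ω) T g
        rw [abs_le]; constructor <;> linarith
      have : ε * a = 2 * D + ε := by rw [ha]; field_simp
      linarith
end

/-- dyadic shell index -/
def jj (v : Vd d) : ℕ := Nat.log 2 ⌊1 + ‖v‖⌋₊

lemma jj_le (v : Vd d) : r2 ^ jj v ≤ 1 + ‖v‖ := by
  have h1 : 2 ^ jj v ≤ ⌊1 + ‖v‖⌋₊ := Nat.pow_log_le_self 2 (by have := Nat.le_floor (n := 1) (a := 1 + ‖v‖) (by simp); omega)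
  have h2 := Nat.floor_le (a := 1 + ‖v‖) po
  have h3 : ((2 ^ jj v : ℕ) : ℝ) ≤ ⌊1 + ‖v‖⌋₊ := by exact_mod_cast h1
  push_cast at h3; linarith

lemma jj_lt (v : Vd d) : 1 + ‖v‖ < 2 * r2 ^ jj v := by
  have h1 : ⌊1 + ‖v‖⌋₊ < 2 ^ (jj v + 1) := Nat.lt_pow_succ_log_self nq _
  have h2 := (Nat.floor_lt (a := 1 + ‖v‖) po).1 h1
  push_cast at h2; rw [pow_succ] at h2; linarith

/-- grid index -/
def zz (l : ℕ) (v : Vd d) (i : Fin d) : ℤ := ⌊v i * 2 ^ l / 2 ^ jj v⌋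

lemma zz_half (l : ℕ) (v : Vd d) : (fun i => zz (l + 1) v i / 2) = zz l v := by
  funext i
  unfold zz
  have e : v i * 2 ^ (l + 1) / 2 ^ jj v = 2 * (v i * 2 ^ l / 2 ^ jj v) := by rw [pow_succ]; ring
  rw [e]
  generalize v i * 2 ^ l / 2 ^ jj v = x
  symm
  rw [Int.floor_eq_iff]
  have h1 := Int.floor_le (2 * x)
  have h2 := Int.lt_floor_add_one (2 * x)
  have h3 : (2 * (⌊2 * x⌋ / 2 : ℤ) : ℝ) ≤ (⌊2 * x⌋ : ℤ) := by exact_mod_cast (by omega : 2 * (⌊2 * x⌋ / 2) ≤ ⌊2 * x⌋)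
  have h4 : ((⌊2 * x⌋ : ℤ) : ℝ) ≤ 2 * (⌊2 * x⌋ / 2 : ℤ) + 1 := by exact_mod_cast (by omega : ⌊2 * x⌋ ≤ 2 * (⌊2 * x⌋ / 2) + 1)
  constructor <;> linarith

/-- box of grid indices -/
def box (d l : ℕ) : Finset (Fin d → ℤ) := Fintype.piFinset fun _ => Finset.Icc (-2 ^ (l + 1)) (2 ^ (l + 1))

lemma zz_box (l : ℕ) (v : Vd d) : zz l v ∈ box d l := by
  rw [box, Fintype.mem_piFinset]
  intro i
  have h1 : |v i| ≤ ‖v‖ := PiLp.norm_apply_le v i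
  have h2 := jj_lt v
  have h3 : |v i * 2 ^ l / 2 ^ jj v| ≤ 2 ^ (l + 1) := by
    rw [abs_div, abs_mul, abs_of_nonneg (show (0:ℝ) ≤ 2 ^ l by positivity), abs_of_nonneg (show (0:ℝ) ≤ 2 ^ jj v by positivity), div_le_iff₀ po, pow_succ]
    have : |v i| ≤ 2 * 2 ^ jj v := by linarith
    calc |v i| * 2 ^ l ≤ (2 * 2 ^ jj v) * 2 ^ l := by gcongr
      _ = _ := by ring
  rw [abs_le] at h3
  rw [Finset.mem_Icc, zz]
  refine ⟨Int.le_floor.2 (by push_cast; exact h3.1), ?_⟩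
  have : ((⌊v i * 2 ^ l / 2 ^ jj v⌋ : ℤ) : ℝ) ≤ ((2 ^ (l + 1) : ℤ) : ℝ) := (Int.floor_le _).trans (by push_cast; exact h3.2)
  exact_mod_cast this

lemma box_card (d l : ℕ) : ((box d l).card : ℝ) ≤ 5 ^ d * (2 ^ l) ^ d := by
  rw [box, Fintype.card_piFinset]
  simp only [Int.card_Icc, Finset.prod_const, Finset.card_univ, Fintype.card_fin]
  push_cast
  rw [← mul_pow]
  refine pow_le_pow_left₀ po ?_ d
  have h0 : (0:ℤ) ≤ 2 ^ (l + 1) := by positivity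
  have h1 : (((2:ℤ) ^ (l + 1) + 1 - -2 ^ (l + 1)).toNat : ℤ) = 2 ^ (l + 1) + 1 - -2 ^ (l + 1) := Int.toNat_of_nonneg li
  have h2 : (((2:ℤ) ^ (l + 1) + 1 - -2 ^ (l + 1)).toNat : ℝ) = 2 ^ (l + 1) + 1 - -2 ^ (l + 1) := by exact_mod_cast h1
  rw [h2, pow_succ]
  have : (1:ℝ) ≤ 2 ^ l := one_le_pow₀ nq
  linarith

/-- grid points -/
def co (l j : ℕ) (z : Fin d → ℤ) : Vd d := WithLp.toLp 2 fun i => 2 ^ j / 2 ^ l * (z i : ℝ)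

lemma norm_le_coord {x : Vd d} {c : ℝ} (h : ∀ i, |x i| ≤ c) : ‖x‖ ≤ d * c := by
  rcases Nat.eq_zero_or_pos d with rfl | hd
  · have : x = 0 := Subsingleton.elim _ _
    simp [this]
  have c0 := (abs_nonneg _).trans (h ⟨0, hd⟩)
  have h1 : (1:ℝ) ≤ d := by exact_mod_cast hd
  rw [EuclideanSpace.norm_eq, Real.sqrt_le_left po]
  calc ∑ i, ‖x i‖ ^ 2 ≤ ∑ _i : Fin d, c ^ 2 := Finset.sum_le_sum fun i _ => by have := h i; rw [Real.norm_eq_abs]; gcongr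
    _ = d * c ^ 2 := by simp
    _ ≤ (d * c) ^ 2 := by nlinarith [sq_nonneg c]

lemma co_norm {l : ℕ} (j : ℕ) {z : Fin d → ℤ} (h : z ∈ box d l) : 1 + ‖co l j z‖ ≤ (2 * d + 2) * 2 ^ j := by
  have h1 : ‖co l j z‖ ≤ d * (2 * 2 ^ j) := norm_le_coord fun i => by
    rw [box, Fintype.mem_piFinset] at h
    have := h i
    rw [Finset.mem_Icc] at this
    have h2 : |(z i : ℝ)| ≤ 2 ^ (l + 1) := abs_le.2 ⟨by exact_mod_cast this.1, by exact_mod_cast this.2⟩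
    change |2 ^ j / 2 ^ l * (z i : ℝ)| ≤ _
    rw [abs_mul, abs_of_nonneg po]
    calc r2 ^ j / 2 ^ l * |(z i : ℝ)| ≤ 2 ^ j / 2 ^ l * 2 ^ (l + 1) := by gcongr
      _ = _ := by rw [pow_succ]; field_simp
  have : (1:ℝ) ≤ 2 ^ j := one_le_pow₀ nq
  linarith

lemma box_half {l : ℕ} {z : Fin d → ℤ} (h : z ∈ box d (l + 1)) : (fun i => z i / 2) ∈ box d l := by
  rw [box, Fintype.mem_piFinset] at h ⊢
  intro i
  have := h i
  rw [Finset.mem_Icc] at this ⊢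
  rw [pow_succ 2 (l + 1)] at this
  generalize (2:ℤ) ^ (l + 1) = y at *
  omega

lemma co_half (l j : ℕ) (z : Fin d → ℤ) : ‖co (l + 1) j z - co l j (fun i => z i / 2)‖ ≤ d * (2 ^ j / 2 ^ (l + 1)) := norm_le_coord fun i => by
  change |2 ^ j / 2 ^ (l + 1) * (z i : ℝ) - 2 ^ j / 2 ^ l * ((z i / 2 : ℤ) : ℝ)| ≤ _
  have e : 2 ^ j / 2 ^ (l + 1) * (z i : ℝ) - 2 ^ j / 2 ^ l * ((z i / 2 : ℤ) : ℝ) = 2 ^ j / 2 ^ (l + 1) * ((z i % 2 : ℤ) : ℝ) := by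
    have : (z i : ℝ) = 2 * ((z i / 2 : ℤ) : ℝ) + ((z i % 2 : ℤ) : ℝ) := by exact_mod_cast (Int.mul_ediv_add_emod (z i) 2).symm
    rw [this, pow_succ]; field_simp; ring
  rw [e, abs_mul, abs_of_nonneg po]
  refine mul_le_of_le_one_right po ?_
  rcases Int.emod_two_eq_zero_or_one (z i) with h | h <;> rw [h] <;> simp

lemma co_near (l : ℕ) (v : Vd d) : ‖v - co l (jj v) (zz l v)‖ ≤ d * (2 ^ jj v / 2 ^ l) := norm_le_coord fun i => by
  change |v i - 2 ^ jj v / 2 ^ l * ((⌊v i * 2 ^ l / 2 ^ jj v⌋ : ℤ) : ℝ)| ≤ _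
  have e : v i = 2 ^ jj v / 2 ^ l * (v i * 2 ^ l / 2 ^ jj v) := by field_simp
  nth_rewrite 1 [e]
  rw [← mul_sub, abs_mul, abs_of_nonneg po]
  refine mul_le_of_le_one_right po ?_
  rw [abs_le]; constructor <;> linarith [Int.floor_le (v i * 2 ^ l / 2 ^ jj v), Int.lt_floor_add_one (v i * 2 ^ l / 2 ^ jj v)]

/-- chaining constant -/
def cc (d : ℕ) : ℝ := 2 * (d + 1) * (2 * d + 2) ^ 3

lemma cc_pos : 0 < cc d := by unfold cc; positivity

lemma F3_near {R : ℝ} {g : FV d} (hg : g ∈ F3 d R) {v v' : Vd d} {j l : ℕ} (h : ‖v - v'‖ ≤ d * (2 ^ j / 2 ^ l))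
    (h1 : 1 + ‖v‖ ≤ (2 * d + 2) * 2 ^ j) (h2 : 1 + ‖v'‖ ≤ (2 * d + 2) * 2 ^ j) : |g v - g v'| ≤ cc d * (2 ^ j) ^ 4 / 2 ^ l := by
  refine (hg.2.1 v v').trans ?_
  have h0 : (d:ℝ) ≤ d + 1 := by linarith
  calc ‖v - v'‖ * ((jb v) ^ 3 + (1 + ‖v'‖) ^ 3) ≤ ((d + 1) * (2 ^ j / 2 ^ l)) * (((2 * d + 2) * 2 ^ j) ^ 3 + ((2 * d + 2) * 2 ^ j) ^ 3) := by
        gcongr; exact h.trans (by gcongr)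
    _ = _ := by unfold cc; ring

/-- chaining coefficients -/
def bb (g : FV d) (l j : ℕ) (z : Fin d → ℤ) : ℝ :=
  match l with
  | 0 => g (co 0 j z)
  | l + 1 => g (co (l + 1) j z) - g (co l j fun i => z i / 2)

lemma bb_le {R : ℝ} {g : FV d} (hg : g ∈ F3 d R) {l : ℕ} (j : ℕ) {z : Fin d → ℤ} (hz : z ∈ box d l) :
    |bb g l j z| ≤ cc d * (2 ^ j) ^ 4 / 2 ^ l := by
  cases l with
  | zero =>
    refine (hg.1 _).trans ?_
    have := co_norm j hz
    have h1 : (1:ℝ) ≤ 2 ^ j := one_le_pow₀ nq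
    calc (1 + ‖co 0 j z‖) ^ 3 ≤ ((2 * (d:ℝ) + 2) * 2 ^ j) ^ 3 := by gcongr
      _ = 1 * (2 * (d:ℝ) + 2) ^ 3 * ((2 ^ j) ^ 3 * 1) := by ring
      _ ≤ 2 * ((d:ℝ) + 1) * (2 * (d:ℝ) + 2) ^ 3 * ((2 ^ j) ^ 3 * 2 ^ j) := by gcongr; linarith [Nat.cast_nonneg (α := ℝ) d]
      _ = _ := by unfold cc; ring
  | succ l => exact F3_near hg (co_half l j z) (co_norm j hz) (co_norm j (box_half hz))

lemma bb_sum (g : FV d) (L : ℕ) (v : Vd d) : ∑ l ∈ Finset.range (L + 1), bb g l (jj v) (zz l v) = g (co L (jj v) (zz L v)) := by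
  induction L with
  | zero => simp [bb]
  | succ L ih => rw [Finset.sum_range_succ, ih, bb, zz_half]; ring

/-- cell indicators -/
def hh (q : (_ : ℕ × ℕ) × (Fin d → ℤ)) (v : Vd d) : ℝ := if jj v = q.1.2 ∧ zz q.1.1 v = q.2 then 1 else 0

/-- chaining index set -/
def QQ (d L J : ℕ) : Finset ((_ : ℕ × ℕ) × (Fin d → ℤ)) := (Finset.range (L + 1) ×ˢ Finset.range (J + 1)).sigma fun a => box d a.1

lemma hh_meas (q : (_ : ℕ × ℕ) × (Fin d → ℤ)) : Measurable (hh q) := by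
  have hj : Measurable (jj : Vd d → ℕ) := (measurable_from_top (f := Nat.log 2)).comp (Nat.measurable_floor.comp fp)
  have h2 : Measurable fun v : Vd d => r2 ^ jj v := (measurable_from_top (f := fun j : ℕ => r2 ^ j)).comp hj
  have hz : Measurable (zz q.1.1 : Vd d → Fin d → ℤ) := measurable_pi_iff.2 fun i => Int.measurable_floor.comp fp
  exact Measurable.ite ((hj (measurableSet_singleton _)).inter (hz (measurableSet_singleton _))) measurable_const measurable_const

lemma hh_bd (q : (_ : ℕ × ℕ) × (Fin d → ℤ)) (v : Vd d) : |hh q v| ≤ 1 := by unfold hh; split_ifs <;> simp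

lemma hh_box (a : ℕ × ℕ) (v : Vd d) (F : (Fin d → ℤ) → ℝ) : ∑ z ∈ box d a.1, F z * hh ⟨a, z⟩ v = if jj v = a.2 then F (zz a.1 v) else 0 := by
  unfold hh
  split_ifs with h
  · simp only [h, true_and, mul_ite, mul_one, mul_zero, Finset.sum_ite_eq, zz_box, if_true]
  · simp [h]

lemma chain {R Γ p : ℝ} {L J : ℕ} (hp : 0 ≤ p) (hJ : R + 1 < 2 ^ (J + 1)) (hΓ : ∀ j ≤ J, (r2 ^ j) ^ 4 ≤ Γ * (r2 ^ j) ^ p)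
    {g : FV d} (hg : g ∈ F3 d R) (v : Vd d) :
    |g v - ∑ q ∈ QQ d L J, bb g q.1.1 q.1.2 q.2 * hh q v| ≤ cc d * Γ / 2 ^ L * (jb v) ^ p := by
  have e : ∑ q ∈ QQ d L J, bb g q.1.1 q.1.2 q.2 * hh q v = if jj v ≤ J then g (co L (jj v) (zz L v)) else 0 := by
    rw [QQ, Finset.sum_sigma]
    simp only [hh_box]
    rw [Finset.sum_product, ← bb_sum g L v]
    simp only [Finset.sum_ite_eq, Finset.mem_range, Nat.lt_succ_iff]
    split_ifs <;> simp
  have c0 := cc_pos (d := d)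
  have u := jj_le v
  rw [e]
  split_ifs with h
  · refine (F3_near hg (co_near L v) ?_ (co_norm _ (zz_box L v))).trans ?_
    · have := jj_lt v
      have : (0:ℝ) ≤ 2 * d * 2 ^ jj v := by positivity
      linarith
    · have G0 : 0 ≤ Γ := by
        have := hΓ 0 (Nat.zero_le _); simp at this; linarith
      calc cc d * (2 ^ jj v) ^ 4 / 2 ^ L ≤ cc d * (Γ * (2 ^ jj v) ^ p) / 2 ^ L := by gcongr; exact hΓ _ h
        _ ≤ cc d * (Γ * (jb v) ^ p) / 2 ^ L := by gcongr
        _ = _ := by ring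
  · have G0 : 0 ≤ Γ := by
      have := hΓ 0 (Nat.zero_le _); simp at this; linarith
    rw [hg.2.2 v, sub_self, abs_zero]
    · positivity
    · have : r2 ^ (J + 1) ≤ 2 ^ jj v := pow_le_pow_right₀ nq (by omega)
      linarith

section
variable (B : Vd d → MV d) [hC : CK B]
section
variable {Ω : Type*} {m : MeasurableSpace Ω} {P : Measure Ω} {𝓕 : Filtration ℝ m} {N : ℕ} {μp : ℝ → Ω → MV d}

lemma MM_lin (h : IsKacProcess B N P 𝓕 μp) (ω : Ω) {t : ℝ} (ht : 0 ≤ t) {f g : FV d} (hf : Measurable f) (hg : Measurable g) {a b : ℝ} (c : ℝ)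
    (hfb : ∀ v, |f v| ≤ a * (jb v) ^ r2) (hgb : ∀ v, |g v| ≤ b * (jb v) ^ r2) (ha : 0 ≤ a) (hb : 0 ≤ b) :
    MM B (μp · ω) t (fun v => c * f v + g v) = c * MM B (μp · ω) t f + MM B (μp · ω) t g := by
  have hi := fun f => emp_integrable (h.mem t ω) (by have := emp_N (h.mem t ω); omega) f
  rw [MM, JJ_lin B (kac_GP h (p := 2) nq ht ω) ht le_rfl hf hg hfb hgb ha hb, integral_add (hi _) (hi _), integral_const_mul, MM, MM]; ring

lemma MM_zero (ν : ℝ → MV d) (t : ℝ) : MM B ν t (fun _ => 0) = 0 := by simp [MM, JJ, QInt]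

lemma MM_sum (h : IsKacProcess B N P 𝓕 μp) (ω : Ω) {t : ℝ} (ht : 0 ≤ t) {ι : Type*} (s : Finset ι) (b : ι → ℝ) {f : ι → FV d}
    (hf : ∀ i, Measurable (f i)) (hfb : ∀ i v, |f i v| ≤ 1) :
    MM B (μp · ω) t (fun v => ∑ i ∈ s, b i * f i v) = ∑ i ∈ s, b i * MM B (μp · ω) t (f i) := by
  classical
  induction s using Finset.induction_on with
  | empty => simp [MM_zero]
  | insert i s his ih =>
    simp only [Finset.sum_insert his]
    rw [MM_lin B h ω ht (hf i) (Finset.measurable_sum _ fun i _ => (hf i).const_mul _) (b i) (f_le_U (hfb i) nq)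
      (f_le_U (c := ∑ i ∈ s, |b i|) (fun v => ?_) nq) zero_le_one (Finset.sum_nonneg fun _ _ => abs_nonneg _), ih]
    refine (Finset.abs_sum_le_sum_abs _ _).trans (Finset.sum_le_sum fun i _ => ?_)
    rw [abs_mul]; exact mul_le_of_le_one_right (abs_nonneg _) (hfb i v)

lemma MM_bd (h : IsKacProcess B N P 𝓕 μp) (ω : Ω) {t T M p c : ℝ} (ht : t ∈ Icc 0 T) (hp : 0 ≤ p) (hc : 0 ≤ c) {f : FV d} (hf : Measurable f)
    (hb : ∀ v, |f v| ≤ c * (jb v) ^ p) (h1 : mU p (μp t ω) ≤ M) (h0 : mU p (μp 0 ω) ≤ M) (h2 : ∫ s in Ioc 0 T, mU (p + 1) (μp s ω) ≤ M) :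
    |MM B (μp · ω) t f| ≤ c * (2 + (2 * 2 ^ p + 1) * 8) * M := by
  rw [MM_eq B ht.1]
  have e1 := (abs_int_le_U hb (emp_IU (h.mem t ω) p)).trans (mll h1 hc)
  have e0 := (abs_int_le_U hb (emp_IU (h.mem 0 ω) p)).trans (mll h0 hc)
  have ik := (kac_GP h hp (ht.1.trans ht.2) ω).k
  rw [intervalIntegrable_iff_integrableOn_Ioc_of_le (ht.1.trans ht.2)] at ik
  have e2 : |∫ s in Ioc 0 t, QInt B f (μp s ω) (μp s ω)| ≤ c * (2 * 2 ^ p + 1) * 8 * M := by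
    have := norm_integral_le_of_norm_le (f := fun s => QInt B f (μp s ω) (μp s ω)) ((ik.mono_set (Ioc_subset_Ioc_right ht.2)).const_mul (c * (2 * 2 ^ p + 1) * 8))
      (ae_of_all _ fun s => kac_Qb B h hf hc hp hb s ω)
    rw [integral_const_mul] at this
    refine this.trans (mll (le_trans ?_ h2) po)
    exact setIntegral_mono_set ik (ae_of_all _ fun s => mU_nonneg _ _) (Ioc_subset_Ioc_right ht.2).eventuallyLE
  rw [abs_le] at *
  constructor <;> nlinarith

/-- chaining sum -/
def SS (L J : ℕ) (ν : ℝ → MV d) (t : ℝ) : ℝ := ∑ q ∈ QQ d L J, cc d * (2 ^ q.1.2) ^ 4 / 2 ^ q.1.1 * |MM B ν t (hh q)|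

lemma chainM (h : IsKacProcess B N P 𝓕 μp) (ω : Ω) {t T M p : ℝ} (ht : t ∈ Icc 0 T) (hp : 0 ≤ p)
    (h1 : mU p (μp t ω) ≤ M) (h0 : mU p (μp 0 ω) ≤ M) (h2 : ∫ s in Ioc 0 T, mU (p + 1) (μp s ω) ≤ M)
    {K Γ : ℝ} {L J : ℕ} (hK : 0 ≤ K) (hG : 0 ≤ Γ) (hJ : 2 * K + 1 < 2 ^ (J + 1)) (hΓ : ∀ j ≤ J, (r2 ^ j) ^ 4 ≤ Γ * (r2 ^ j) ^ p)
    {g : FV d} (hg : g ∈ F3 d (2 * K)) :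
    |MM B (μp · ω) t g| ≤ SS B L J (μp · ω) t + cc d * Γ / 2 ^ L * (2 + (2 * 2 ^ p + 1) * 8) * M := by
  set b : ((_ : ℕ × ℕ) × (Fin d → ℤ)) → ℝ := fun q => bb g q.1.1 q.1.2 q.2
  set f : FV d := fun v => ∑ q ∈ QQ d L J, b q * hh q v with hf
  have fm : Measurable f := Finset.measurable_sum _ fun q _ => (hh_meas q).const_mul _
  have gm := (F3.cont hg).measurable
  have fb : ∀ v, |f v| ≤ ∑ q ∈ QQ d L J, |b q| := fun v =>
    (Finset.abs_sum_le_sum_abs _ _).trans (Finset.sum_le_sum fun q _ => by rw [abs_mul]; exact mul_le_of_le_one_right (abs_nonneg _) (hh_bd q v))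
  have c0 := cc_pos (d := d)
  have b0 : 0 ≤ ∑ q ∈ QQ d L J, |b q| := Finset.sum_nonneg fun _ _ => abs_nonneg _
  have fb2 := f_le_U fb (q := 2) nq
  have gb2 := F3_U2 hK hg.1 hg.2.2
  have rb2 : ∀ v, |g v - f v| ≤ (1 + 2 * K + ∑ q ∈ QQ d L J, |b q|) * (jb v) ^ r2 := fun v => by
    rw [add_mul]; exact (abs_sub _ _).trans (add_le_add (gb2 v) (fb2 v))
  have e := MM_lin B h ω ht.1 fm (gm.sub fm) 1 fb2 rb2 b0 po
  have e1 : (fun v => 1 * f v + (g - f) v) = g := by funext v; simp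
  have e2 := MM_bd B h ω ht hp po (gm.sub fm) (chain hp hJ hΓ hg) h1 h0 h2
  have e3 : |MM B (μp · ω) t f| ≤ SS B L J (μp · ω) t := by
    rw [hf, MM_sum B h ω ht.1 _ b hh_meas hh_bd, SS]
    refine (Finset.abs_sum_le_sum_abs _ _).trans (Finset.sum_le_sum fun q hq => ?_)
    rw [abs_mul]
    exact mul_le_mul_of_nonneg_right (bb_le hg _ (Finset.mem_sigma.1 hq).2) (abs_nonneg _)
  rw [← e1, e, one_mul]
  exact (abs_add_le _ _).trans (add_le_add e3 e2)
end
end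

section
variable (B : Vd d → MV d) [hC : CK B]
section
variable {Ω : Type*} {m : MeasurableSpace Ω} {P : Measure Ω} {𝓕 : Filtration ℝ m} {N : ℕ} {μp : ℝ → Ω → MV d}

lemma kac_GQi [IsProbabilityMeasure P] (h : IsKacProcess B N P 𝓕 μp) {f : FV d} (hf : Measurable f) (hb : ∀ v, |f v| ≤ 1) (t : ℝ) :
    (∀ ω, IntegrableOn (fun s => GQ B f (μp s ω)) (Ioc 0 t)) ∧ Integrable (fun ω => ∫ s in Ioc 0 t, GQ B f (μp s ω)) P := by
  have hm := GQ_meas B (kac_joint h) (fun z => kac_prob h z.1 z.2) hf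
  have hbd : ∀ s ω, ‖GQ B f (μp s ω)‖ ≤ 32 * 1 * (2 * 2 ^ (0:ℝ) + 1) * (1 + (N:ℝ)) ^ ((0:ℝ) + 1) := fun s ω => by
    rw [Real.norm_of_nonneg (GQ_nonneg B f _)]
    have := GQ_sum B (h.mem s ω) {()} (f := fun _ => f) (fun _ => hf) zero_le_one (q := 0) le_rfl (fun v => by
      simpa [sq_le_one_iff_abs_le_one] using hb v)
    rw [Finset.sum_singleton] at this
    exact this.trans (mll (emp_mU (h.mem s ω) nq) po)
  constructor
  · intro ω
    exact IntegrableOn.of_bound measure_Ioc_lt_top ((hm.comp (measurable_id.prodMk (measurable_const (a := ω)))).aestronglyMeasurable) _ (ae_of_all _ fun s => hbd s ω)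
  · refine Integrable.of_bound (C := 32 * 1 * (2 * 2 ^ (0:ℝ) + 1) * (1 + (N:ℝ)) ^ ((0:ℝ) + 1) * volume.real (Ioc 0 t))
      ((primJ (a := fun s ω => GQ B f (μp s ω)) hm).comp (measurable_const (a := t).prodMk measurable_id)).aestronglyMeasurable (ae_of_all _ fun ω => ?_)
    exact norm_setIntegral_le_of_norm_le_const measure_Ioc_lt_top fun s _ => hbd s ω

lemma EL2 [IsProbabilityMeasure P] (h : IsKacProcess B N P 𝓕 μp) {ι : Type*} (s : Finset ι) {f : ι → FV d}
    (hf : ∀ i, Measurable (f i)) (hb : ∀ i v, |f i v| ≤ 1) {c q M T : ℝ} (hT : 0 ≤ T) (hc : 0 ≤ c) (hq : 0 ≤ q)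
    (hs : ∀ v, ∑ i ∈ s, (f i v) ^ 2 ≤ c * (jb v) ^ q) (hM : ∫ ω, (∫ s in Ioc 0 T, mU (q + 1) (μp s ω)) ∂P ≤ M) :
    ∑ i ∈ s, ∫ ω, (MM B (μp · ω) T (f i)) ^ 2 ∂P ≤ (N:ℝ)⁻¹ * (32 * c * (2 * 2 ^ q + 1) * M) := by
  have e : ∀ i ∈ s, ∫ ω, (MM B (μp · ω) T (f i)) ^ 2 ∂P = (N : ℝ)⁻¹ * ∫ ω, (∫ s in Ioc 0 T, GQ B (f i) (μp s ω)) ∂P :=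
    fun i _ => (kac_L2 B h (hf i) (hb i) hT).2
  rw [Finset.sum_congr rfl e, ← Finset.mul_sum]
  refine mll ?_ po
  rw [← integral_finsetSum _ fun i _ => (kac_GQi B h (hf i) (hb i) T).2]
  refine le_trans ?_ (mll hM po)
  rw [← integral_const_mul]
  refine integral_mono (integrable_finsetSum _ fun i _ => (kac_GQi B h (hf i) (hb i) T).2) ((kac_mUi B h li T).const_mul _) fun ω => ?_
  beta_reduce
  rw [← integral_finsetSum _ fun i _ => (kac_GQi B h (hf i) (hb i) T).1 ω, ← integral_const_mul]
  have ik := (kac_GP h hq hT ω).k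
  rw [intervalIntegrable_iff_integrableOn_Ioc_of_le hT] at ik
  exact integral_mono (integrable_finsetSum _ fun i _ => (kac_GQi B h (hf i) (hb i) T).1 ω) (ik.const_mul _) fun r => GQ_sum B (h.mem r ω) s hf hc hq hs

lemma hh_sq (a : ℕ × ℕ) {p : ℝ} (hp : 0 ≤ p) (v : Vd d) : ∑ z ∈ box d a.1, (hh ⟨a, z⟩ v) ^ 2 ≤ ((r2 ^ a.2) ^ p)⁻¹ * (jb v) ^ p := by
  have e : ∀ z, (hh ⟨a, z⟩ v) ^ 2 = 1 * hh ⟨a, z⟩ v := fun z => by unfold hh; split_ifs <;> norm_num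
  simp only [e]
  rw [hh_box a v fun _ => 1]
  split_ifs with hj
  · rw [← div_eq_inv_mul, le_div_iff₀ po, one_mul, ← hj]
    exact Real.rpow_le_rpow po (jj_le v) hp
  · positivity

lemma ES1 [IsProbabilityMeasure P] (h : IsKacProcess B N P 𝓕 μp) {M p T Γ η : ℝ} (hT : 0 ≤ T) (hp : 0 ≤ p) (hM0 : 0 ≤ M)
    (hM : ∫ ω, (∫ s in Ioc 0 T, mU (p + 1) (μp s ω)) ∂P ≤ M) (hG : 1 ≤ Γ) (a : ℕ × ℕ)
    (hΓ : (r2 ^ a.2) ^ 8 * ((r2 ^ a.2) ^ η) ^ 2 ≤ Γ * (r2 ^ a.2) ^ p) :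
    ∑ z ∈ box d a.1, cc d * (2 ^ a.2) ^ 4 / 2 ^ a.1 * ∫ ω, |MM B (μp · ω) T (hh ⟨a, z⟩)| ∂P ≤
      (√N)⁻¹ * (cc d * (5 ^ d + 32 * (2 * 2 ^ p + 1) * M) * Γ) * ((r2 ^ a.1) ^ ((d:ℝ) / 2) / 2 ^ a.1) * ((r2 ^ a.2) ^ η)⁻¹ := by
  have hN : 0 < (N:ℝ) := by
    obtain ⟨ω⟩ : Nonempty Ω := nonempty_of_isProbabilityMeasure P
    have := emp_N (h.mem 0 ω); exact_mod_cast (by omega : 0 < N)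
  have c0 := cc_pos (d := d)
  have hy : (r2 ^ a.1) ^ d = ((r2 ^ a.1) ^ ((d:ℝ) / 2)) ^ 2 := by
    rw [← Real.rpow_natCast ((r2 ^ a.1) ^ ((d:ℝ) / 2)) 2, ← Real.rpow_mul po, ← Real.rpow_natCast]; congr 1; push_cast; ring
  have hn : (N:ℝ) = √N ^ 2 := (Real.sq_sqrt hN.le).symm
  have e1 := EL2 B h (box d a.1) (f := fun z => hh ⟨a, z⟩) (fun z => hh_meas _) (fun z => hh_bd _) hT po hp (hh_sq a hp) hM
  have e2 := box_card d a.1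
  have sN : 0 < √N := Real.sqrt_pos.2 hN
  rw [hy] at e2
  rw [hn] at e1
  have y0 : (0:ℝ) < 2 ^ a.1 := by positivity
  have x0 : (0:ℝ) < 2 ^ a.2 := by positivity
  have b0 : (0:ℝ) < (r2 ^ a.1) ^ ((d:ℝ) / 2) := by positivity
  have X0 : (0:ℝ) < (r2 ^ a.2) ^ p := by positivity
  have E0 : (0:ℝ) < (r2 ^ a.2) ^ η := by positivity
  have q0 : (0:ℝ) ≤ 32 * (2 * 2 ^ p + 1) * M := by positivity
  have D0 : (0:ℝ) < 5 ^ d := by positivity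
  rw [show 32 * ((r2 ^ a.2) ^ p)⁻¹ * (2 * 2 ^ p + 1) * M = ((r2 ^ a.2) ^ p)⁻¹ * (32 * (2 * 2 ^ p + 1) * M) by ring] at e1
  generalize (32 * (2 * 2 ^ p + 1) * M) = G at *
  generalize hbn : (r2 ^ a.1) ^ ((d:ℝ) / 2) = b at *
  generalize (r2 ^ a.2) ^ p = X at *
  generalize (r2 ^ a.2) ^ η = e at *
  set x : ℝ := 2 ^ a.2
  set y : ℝ := 2 ^ a.1
  set A := √N
  generalize (5:ℝ) ^ d = D at *
  set s : ℝ := 1 / (A * b * x ^ 4 * e) with hs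
  have s0 : 0 < s := by positivity
  have e3 : ∀ z ∈ box d a.1, ∫ ω, |MM B (μp · ω) T (hh ⟨a, z⟩)| ∂P ≤ s / 2 + (1 / (2 * s)) * ∫ ω, (MM B (μp · ω) T (hh ⟨a, z⟩)) ^ 2 ∂P := fun z _ => by
    have i2 := (kac_L2 B h (hh_meas ⟨a, z⟩) (hh_bd _) hT).1
    rw [← integral_const_mul, show s / 2 = ∫ _ω, s / 2 ∂P by simp, ← integral_add (integrable_const _) (i2.const_mul _)]
    refine integral_mono (kac_mean B h (hh_meas _) (hh_bd _) hT).1.abs ((integrable_const _).fun_add (i2.const_mul _)) fun ω => ?_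
    beta_reduce
    rw [← sq_abs (MM B _ _ _)]
    generalize |MM B (μp · ω) T (hh ⟨a, z⟩)| = u
    rw [show s / 2 + 1 / (2 * s) * u ^ 2 = (s ^ 2 + u ^ 2) / (2 * s) by field_simp, le_div_iff₀ po]
    nlinarith [sq_nonneg (s - u)]
  rw [← Finset.mul_sum]
  have e4 := Finset.sum_le_sum e3
  rw [Finset.sum_add_distrib, ← Finset.mul_sum, Finset.sum_const, nsmul_eq_mul] at e4
  have e5 : ∑ z ∈ box d a.1, ∫ ω, |MM B (μp · ω) T (hh ⟨a, z⟩)| ∂P ≤ D * b ^ 2 * (s / 2) + 1 / (2 * s) * ((A ^ 2)⁻¹ * (X⁻¹ * G)) :=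
    e4.trans (add_le_add (mul_le_mul_of_nonneg_right e2 po) (mll e1 po))
  refine (mll e5 po).trans ?_
  have f1 : cc d * x ^ 4 / y * (D * b ^ 2 * (s / 2) + 1 / (2 * s) * ((A ^ 2)⁻¹ * (X⁻¹ * G))) =
      A⁻¹ * cc d * (b / y) * e⁻¹ * ((D + G * (x ^ 8 * e ^ 2 / X)) / 2) := by rw [hs]; field_simp
  have f2 : x ^ 8 * e ^ 2 / X ≤ Γ := by rwa [div_le_iff₀ X0]
  have f3 : (D + G * (x ^ 8 * e ^ 2 / X)) / 2 ≤ (D + G) * Γ := by nlinarith [mll f2 q0, mll hG D0.le, mul_nonneg q0 (zero_le_one.trans hG)]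
  rw [f1]
  refine (mll f3 po).trans (le_of_eq (by ring))

/-- the geometric scale sum -/
def YY (d L : ℕ) : ℝ := ∑ l ∈ Finset.range (L + 1), (r2 ^ l) ^ ((d:ℝ) / 2) / 2 ^ l

lemma YY_pos (d L : ℕ) : 0 < YY d L := Finset.sum_pos (fun l _ => by positivity) ⟨0, by simp⟩

lemma ES2 [IsProbabilityMeasure P] (h : IsKacProcess B N P 𝓕 μp) {M p T Γ η : ℝ} (hT : 0 ≤ T) (hp : 0 ≤ p) (hM0 : 0 ≤ M) (hη : 0 < η)
    (hM : ∫ ω, (∫ s in Ioc 0 T, mU (p + 1) (μp s ω)) ∂P ≤ M) (hG : 1 ≤ Γ) (L J : ℕ)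
    (hΓ : ∀ j ≤ J, (r2 ^ j) ^ 8 * ((r2 ^ j) ^ η) ^ 2 ≤ Γ * (r2 ^ j) ^ p) :
    ∫ ω, SS B L J (μp · ω) T ∂P ≤ (√N)⁻¹ * (cc d * (5 ^ d + 32 * (2 * 2 ^ p + 1) * M) * Γ) * YY d L * (1 - (2 ^ η)⁻¹)⁻¹ := by
  have c0 := cc_pos (d := d)
  unfold SS
  rw [integral_finsetSum _ fun q _ => ((kac_mean B h (hh_meas _) (hh_bd _) hT).1.abs.const_mul _)]
  simp only [integral_const_mul]
  rw [QQ, Finset.sum_sigma]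
  refine (Finset.sum_le_sum fun a ha => ES1 B h hT hp hM0 hM hG a (hΓ a.2 ?_)).trans ?_
  · simp only [Finset.mem_product, Finset.mem_range] at ha; omega
  rw [Finset.sum_product]
  simp only [← Finset.mul_sum]
  rw [← Finset.sum_mul, ← Finset.mul_sum]
  refine mll ?_ (mul_nonneg po (YY_pos d L).le)
  have r1 : (2 ^ η)⁻¹ < (1:ℝ) := inv_lt_one_of_one_lt₀ (Real.one_lt_rpow nq hη)
  have e : ∀ j : ℕ, ((r2 ^ j) ^ η)⁻¹ = ((2 ^ η)⁻¹) ^ j := fun j => by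
    rw [inv_pow, ← Real.rpow_natCast, ← Real.rpow_natCast, ← Real.rpow_mul nq, ← Real.rpow_mul nq, mul_comm]
  simp only [e]
  rw [← tsum_geometric_of_lt_one po r1]
  exact (summable_geometric_of_lt_one po r1).sum_le_tsum _ fun _ _ => by positivity
end
end

lemma dy_ext {T b : ℝ} {F : ℝ → ℝ} (hT : 0 ≤ T) (hF : ∀ t ∈ Icc 0 T, ContinuousWithinAt F (Icc t T) t) (h : ∀ t, dyT T t → F t ≤ b) :
    ∀ t ∈ Icc 0 T, F t ≤ b := by
  intro t ht
  rcases eq_or_lt_of_le ht.2 with rfl | hlt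
  · exact h t ⟨0, 1, by simp, by simp⟩
  have T0 : 0 < T := ht.1.trans_lt hlt
  set u : ℕ → ℝ := fun n => ((⌊t * 2 ^ n / T⌋₊ + 1 : ℕ) : ℝ) * (T / 2 ^ n) with hu
  have u1 : ∀ n, t ≤ u n := fun n => by
    have := (Nat.lt_floor_add_one (t * 2 ^ n / T)).le
    rw [div_le_iff₀ T0] at this
    simp only [hu]; push_cast
    rw [← mul_div_assoc, le_div_iff₀ po]; exact this
  have u2 : ∀ n, u n ≤ t + T / 2 ^ n := fun n => by
    have := Nat.floor_le (a := t * 2 ^ n / T) (by have := ht.1; positivity)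
    simp only [hu]; push_cast
    rw [add_mul, one_mul]
    have h2 := mul_le_mul_of_nonneg_right this (show 0 ≤ T / 2 ^ n by positivity)
    rw [show t * 2 ^ n / T * (T / 2 ^ n) = t by field_simp] at h2; linarith
  have u3 : ∀ n, dyT T (u n) := fun n => ⟨n, _, Nat.succ_le_of_lt ((Nat.floor_lt (by have := ht.1; positivity)).2 (by
    push_cast; rw [div_lt_iff₀ T0, mul_comm]; exact mul_lt_mul_of_pos_left hlt po)), rfl⟩
  have lim : Tendsto u atTop (nhds t) := by
    refine tendsto_of_tendsto_of_tendsto_of_le_of_le tendsto_const_nhds ?_ u1 u2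
    have := (tendsto_pow_atTop_nhds_zero_of_lt_one (r := r2⁻¹) nq nq).const_mul T
    have h2 := this.const_add t
    simp only [mul_zero, add_zero, inv_pow] at h2
    exact h2
  have lim2 : Tendsto u atTop (nhdsWithin t (Icc t T)) :=
    tendsto_nhdsWithin_iff.2 ⟨lim, Eventually.of_forall fun n => ⟨u1 n, ((u3 n).mem hT).2⟩⟩
  exact le_of_tendsto ((hF t ht).tendsto.comp lim2) (Eventually.of_forall fun n => h _ (u3 n))

lemma F3_scale {K : ℝ} (hK : 0 ≤ K) {g : FV d} (hg : g ∈ F3 d (2 * K)) : (fun v => g v / (4 + 4 * K)) ∈ FP d := by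
  have c0 : 0 < 4 + 4 * K := by linarith
  have hw : ∀ v : Vd d, (jb v) ^ 2 ≤ 2 * ww v := fun v => by unfold ww; nlinarith [sq_nonneg (‖v‖ - 1)]
  have h1 : ∀ v, |g v| ≤ (4 + 4 * K) * ww v := fun v => by
    have := F3_U2 hK hg.1 hg.2.2 v
    rw [Real.rpow_two] at this
    nlinarith [hw v, ww_one v]
  have h3 : ∀ v : Vd d, ‖v‖ ≤ 2 * K + 1 → (jb v) ^ 3 ≤ (4 + 4 * K) * ww v := fun v h => by
    have h2 := hw v
    have := ww_one v
    have n := norm_nonneg v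
    calc (jb v) ^ 3 = (jb v) * (jb v) ^ 2 := by ring
      _ ≤ (2 + 2 * K) * (2 * ww v) := mul_le_mul li h2 po li
      _ = _ := by ring
  refine ⟨fun v => ?_, ?_⟩
  · rw [abs_div, abs_of_pos c0, div_le_iff₀ c0, mul_comm]; exact h1 v
  have key : ∀ v v' : Vd d, ‖v‖ ≤ ‖v'‖ → |g v / (4 + 4 * K) - g v' / (4 + 4 * K)| ≤ ‖v - v'‖ * (ww v + ww v') := by
    intro v v' hvv
    rw [← sub_div, abs_div, abs_of_pos c0, div_le_iff₀ c0]
    have w := ww_one v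
    have w' := ww_one v'
    rcases le_or_gt ‖v'‖ (2 * K + 1) with h | h
    · refine (hg.2.1 v v').trans ?_
      rw [mul_assoc]
      refine mll ?_ (norm_nonneg _)
      linarith [h3 v (hvv.trans h), h3 v' h]
    · rw [hg.2.2 v' li, sub_zero]
      rcases le_or_gt ‖v‖ (2 * K) with h' | h'
      · have n : 1 ≤ ‖v - v'‖ := by have := norm_sub_norm_le v' v; rw [norm_sub_rev] at this; linarith
        have := h1 v
        have e : (4 + 4 * K) * ww v ≤ (4 + 4 * K) * (ww v + ww v') := by gcongr; linarith
        nlinarith [mul_nonneg (sub_nonneg.2 n) (show 0 ≤ (4 + 4 * K) * (ww v + ww v') by positivity)]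
      · rw [hg.2.2 v h', abs_zero]; positivity
  intro v v'
  rcases le_total ‖v‖ ‖v'‖ with h | h
  · exact key v v' h
  · have := key v' v h
    rwa [abs_sub_comm, norm_sub_rev, add_comm (ww v')] at this

lemma FP_cut {K : ℝ} (hK : 1 ≤ K) {f : FV d} (hf : f ∈ FP d) : (fun v => f v * cut K v / 2) ∈ F3 d (2 * K) := by
  have K0 : 0 < K := by linarith
  have hw : ∀ v : Vd d, ww v ≤ (jb v) ^ 3 := fun v => by
    have n := norm_nonneg v
    unfold ww; nlinarith [pow_nonneg n 3, pow_nonneg n 2]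
  refine ⟨fun v => ?_, fun v v' => ?_, fun v h => by simp [cut_eq_zero K0 h.le]⟩
  · rw [abs_div, abs_mul, abs_of_nonneg (cut_nonneg K v), abs_two]
    have h2 := mul_le_mul (hf.1 v) (cut_le_one K v) (cut_nonneg K v) (by have := ww_one v; linarith)
    have := hw v; have := ww_one v; linarith
  · have w := ww_one v
    have w' := ww_one v'
    have n := norm_nonneg (v - v')
    have e : f v * cut K v / 2 - f v' * cut K v' / 2 = ((f v - f v') * cut K v + f v' * (cut K v - cut K v')) / 2 := by ring
    have a1 : |(f v - f v') * cut K v| ≤ ‖v - v'‖ * (ww v + ww v') := by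
      rw [abs_mul, abs_of_nonneg (cut_nonneg K v)]
      exact (mul_le_of_le_one_right (abs_nonneg _) (cut_le_one K v)).trans (hf.2 v v')
    have a2 : |f v' * (cut K v - cut K v')| ≤ ww v' * ‖v - v'‖ := by
      rw [abs_mul]
      exact mul_le_mul (hf.1 v') ((cut_lip K0 v v').trans (div_le_self n hK)) (abs_nonneg _) li
    rw [e, abs_div, abs_two, div_le_iff₀ nq]
    refine (abs_add_le _ _).trans ?_
    have h3 := mll (add_le_add (hw v) (hw v')) n
    nlinarith [mul_nonneg n (zero_le_one.trans w)]

lemma FP_tail {K p : ℝ} (hK : 1 ≤ K) (hp : 2 ≤ p) {f : FV d} (hf : f ∈ FP d) (v : Vd d) :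
    |f v * (1 - cut K v)| ≤ K ^ (2 - p) * (jb v) ^ p := by
  have K0 : 0 < K := by linarith
  have n := norm_nonneg v
  rcases le_or_gt ‖v‖ K with h | h
  · rw [cut_eq_one K0 h]; simp; positivity
  · rw [abs_mul, abs_of_nonneg (a := 1 - cut K v) (by have := cut_le_one K v; linarith)]
    refine (mul_le_of_le_one_right (abs_nonneg _) (by have := cut_nonneg K v; linarith)).trans ?_
    have h1 := FP.leU hf v
    rw [one_mul] at h1
    refine h1.trans ?_
    have h2 : (jb v) ^ r2 = (jb v) ^ (2 - p) * (jb v) ^ p := by rw [← Real.rpow_add po]; congr 1; ring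
    rw [h2]
    exact mul_le_mul_of_nonneg_right (Real.rpow_le_rpow_of_nonpos K0 li li) po

section
lemma Wd_bdd {μ ν : MV d} (hμ : μ ∈ boltzmannSphere d) (hν : ν ∈ boltzmannSphere d) :
    BddAbove (range fun f : testF d => (∫ v, (f : FV d) v ∂μ) - ∫ v, (f : FV d) v ∂ν) := by
  refine ⟨8, ?_⟩
  rintro _ ⟨f, rfl⟩
  have h1 := abs_int_le_U (FP.leU (test_FP f.2)) (BS_IU2 hμ)
  have h2 := abs_int_le_U (FP.leU (test_FP f.2)) (BS_IU2 hν)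
  have := BS_mU2 hμ
  have := BS_mU2 hν
  rw [abs_le] at h1 h2
  change (∫ v, (f : FV d) v ∂μ) - ∫ v, (f : FV d) v ∂ν ≤ 8
  linarith

lemma Wd_FP {μ ν : MV d} (hμ : μ ∈ boltzmannSphere d) (hν : ν ∈ boltzmannSphere d) {f : FV d} (hf : f ∈ FP d) :
    ∫ v, f v ∂μ - ∫ v, f v ∂ν ≤ 3 * Wdist μ ν := by
  have := le_ciSup (Wd_bdd hμ hν) ⟨_, FP_test hf⟩
  simp only [integral_div] at this
  change _ ≤ Wdist μ ν at this
  linarith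

lemma Wd_nonneg {μ ν : MV d} (hμ : μ ∈ boltzmannSphere d) (hν : ν ∈ boltzmannSphere d) : 0 ≤ Wdist μ ν := by
  have := Wd_FP hμ hν FP_zero
  simp at this; exact this

variable (B : Vd d → MV d) [hC : CK B]
section
variable {Ω : Type*} {m : MeasurableSpace Ω} {P : Measure Ω} {𝓕 : Filtration ℝ m} {N : ℕ} {μp : ℝ → Ω → MV d}

lemma MM_rc (h : IsKacProcess B N P 𝓕 μp) (ω : Ω) {f : FV d} (hm : Measurable f) {a c : ℝ} (ha : a ≠ 0) (hc : 0 ≤ c)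
    (hf : (fun v => f v / a) ∈ FP d) (hb : ∀ v, |f v| ≤ c * (jb v) ^ r2) {T : ℝ} (hT : 0 ≤ T) :
    ∀ t ∈ Icc 0 T, ContinuousWithinAt (fun t => |MM B (μp · ω) t f|) (Icc t T) t := by
  intro t ht
  have h1 := ((kac_rc h hf ω t).mul_const a).mono (Icc_subset_Ici_self : Icc t T ⊆ Ici t)
  simp only [integral_div, div_mul_cancel₀ _ ha] at h1
  have i := (kac_GP h (p := 2) nq hT ω).qi B hT le_rfl hm hc hb
  have h2 := intervalIntegral.continuousOn_primitive_interval' i left_mem_uIcc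
  rw [uIcc_of_le hT] at h2
  have h3 := (h2 t ht).mono (Icc_subset_Icc_left ht.1)
  exact (h1.sub (h3.const_add _)).abs

lemma det {κ : ℝ} (hL : IsLipschitzKernel B κ) (h : IsKacProcess B N P 𝓕 μp) (ω : Ω) {T M p : ℝ} (hp : 2 < p) (hT : 0 ≤ T) (hM1 : 1 ≤ M)
    {μ : ℝ → MV d} (hs : IsBoltzmannSolution B μ) (hsb : LocBddMomentFrom p 0 μ)
    (h2 : ∫ s in Ioc 0 T, mU (p + 1) (μp s ω) ≤ M) (h1 : ∀ t, dyT T t → mU p (μp t ω) ≤ M)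
    {K b : ℝ} (hK : 1 ≤ K) (hb0 : 0 ≤ b) (hb : ∀ g ∈ F3 d (2 * K), ∀ t, dyT T t → |MM B (μp · ω) t g| ≤ b)
    {A : ℝ} (hA : A = M + ∫ s in 0..T, mU (p + 1) (μ (max s 0))) :
    ∀ t ∈ Icc 0 T, Wdist (μp t ω) (μ t) ≤ (2 + (2 + (2 * 2 ^ p + 1) * 8) * M + (3 + (16 + 2 * κ) * A + 64 * A) * Real.exp ((12 + 2 * κ) * A)) *
      (Wdist (μp 0 ω) (μ 0) + b + K ^ (2 - p)) := by
  have hκ := hL.1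
  have K0 : 0 < K := by linarith
  set ν : ℝ → MV d := fun s => μp s ω with hν
  set σ : ℝ → MV d := fun s => μ (max s 0) with hσ
  have gν := kac_GP h (p := p) li hT ω
  have gσ := sol_GP B hp hT hs hsb
  have σeq : ∀ t, 0 ≤ t → σ t = μ t := fun t ht => by simp only [hσ, max_eq_left ht]
  have d0 : dyT T 0 := ⟨0, 0, by simp, by simp⟩
  have hbt : ∀ g ∈ F3 d (2 * K), ∀ t ∈ Icc 0 T, |MM B ν t g| ≤ b := fun g hg =>
    dy_ext hT (MM_rc B h ω (F3.cont hg).measurable (show (4 + 4 * K) ≠ 0 by positivity) (show 0 ≤ 1 + 2 * K by positivity) (F3_scale K0.le hg) (F3_U2 K0.le hg.1 hg.2.2) hT) (hb g hg)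
  have hft : ∀ f ∈ FP d, ∀ t ∈ Icc 0 T, |MM B ν t f| ≤ 2 * b + K ^ (2 - p) * (2 + (2 * 2 ^ p + 1) * 8) * M := fun f hf => by
    have fm := (FP.cont hf).measurable
    have cm := (cut_cont K (d := d)).measurable
    refine dy_ext hT (MM_rc B h ω fm one_ne_zero zero_le_one (by simpa using hf) (FP.leU hf) hT) fun t ht => ?_
    have gc := FP_cut hK hf
    have e := MM_lin B h ω (ht.mem hT).1 (F3.cont gc).measurable (g := fun v => f v * (1 - cut K v)) fp 2 (F3_U2 K0.le gc.1 gc.2.2) (b := 1) (fun v => ?_) po zero_le_one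
    · have e1 : (fun v => 2 * (f v * cut K v / 2) + f v * (1 - cut K v)) = f := by funext v; ring
      rw [e1] at e
      change MM B ν t f = _ at e
      rw [e]
      refine (abs_add_le _ _).trans (add_le_add ?_ ?_)
      · rw [abs_mul, abs_two]; exact mll (hb _ gc t ht) nq
      · exact MM_bd B h ω (ht.mem hT) li po fp (FP_tail hK hp.le hf) (h1 t ht) (h1 0 d0) h2
    · rw [abs_mul, abs_of_nonneg (a := 1 - cut K v) (by have := cut_le_one K v; linarith)]
      exact (mul_le_of_le_one_right (abs_nonneg _) (by have := cut_nonneg K v; linarith)).trans (FP.leU hf v)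
  intro t ht
  have W0 : 0 ≤ Wdist (μp 0 ω) (μ 0) := Wd_nonneg (gν.s 0) (hs.1 0 le_rfl)
  have k0 : 0 ≤ K ^ (2 - p) := by positivity
  have isum : IntervalIntegrable (fun s => mU (p + 1) (ν s) + mU (p + 1) (σ s)) volume 0 T := gν.k.add gσ.k
  have isumt : IntervalIntegrable (fun s => mU (p + 1) (ν s) + mU (p + 1) (σ s)) volume 0 t := (gν.mono ht.1 ht.2).k.add (gσ.mono ht.1 ht.2).k
  have i3 : IntervalIntegrable (fun s => mU 3 (ν s) + mU 3 (σ s)) volume 0 t := ((gν.mono ht.1 ht.2).k3 ht.1 hp.le).add ((gσ.mono ht.1 ht.2).k3 ht.1 hp.le)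
  have Ib : ∫ s in 0..t, (mU (p + 1) (ν s) + mU (p + 1) (σ s)) ≤ A := by
    calc _ ≤ ∫ s in 0..T, (mU (p + 1) (ν s) + mU (p + 1) (σ s)) := by
          rw [intervalIntegral.integral_of_le ht.1, intervalIntegral.integral_of_le hT]
          rw [intervalIntegrable_iff_integrableOn_Ioc_of_le hT] at isum
          exact setIntegral_mono_set isum (ae_of_all _ fun s => add_nonneg (mU_nonneg _ _) (mU_nonneg _ _)) (Ioc_subset_Ioc_right ht.2).eventuallyLE
      _ ≤ A := by
          rw [intervalIntegral.integral_add gν.k gσ.k, intervalIntegral.integral_of_le hT, hA]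
          exact add_le_add_left h2 _
  have m3 : ∀ᵐ s ∂(volume.restrict (Ioc 0 t)), mU 3 (ν s) + mU 3 (σ s) ≤ mU (p + 1) (ν s) + mU (p + 1) (σ s) := by
    filter_upwards [(gν.mono ht.1 ht.2).i, (gσ.mono ht.1 ht.2).i] with s a1 a2
    exact add_le_add (mU_mono li a1) (mU_mono li a2)
  have J1 : ∫ s in 0..t, (12 + 2 * κ) * (mU 3 (ν s) + mU 3 (σ s)) ≤ (12 + 2 * κ) * A := by
    rw [intervalIntegral.integral_const_mul]
    refine mll (le_trans ?_ Ib) li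
    exact intervalIntegral.integral_mono_ae_restrict ht.1 i3 isumt (by rwa [restrict_Ioc_eq_restrict_Icc] at m3)
  have J2 : ∫ s in 0..t, ((16 + 2 * κ) * (mU 3 (ν s) + mU 3 (σ s)) * b + 64 * K ^ (2 - p) * (mU (p + 1) (ν s) + mU (p + 1) (σ s))) ≤
      ((16 + 2 * κ) * b + 64 * K ^ (2 - p)) * A := by
    refine le_trans ?_ (mll Ib po)
    rw [← intervalIntegral.integral_const_mul]
    refine intervalIntegral.integral_mono_ae_restrict ht.1 (((i3.const_mul _).mul_const _).add (isumt.const_mul _)) (isumt.const_mul _) ?_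
    rw [restrict_Ioc_eq_restrict_Icc] at m3
    filter_upwards [m3] with s a
    have := mll a (show 0 ≤ (16 + 2 * κ) * b by positivity)
    nlinarith
  have A0 : 0 ≤ A := by
    refine le_trans ?_ Ib
    exact intervalIntegral.integral_nonneg ht.1 fun s _ => add_nonneg (mU_nonneg _ _) (mU_nonneg _ _)
  have : Nonempty (testF d) := ⟨⟨_, FP_test FP_zero⟩⟩
  refine ciSup_le fun f => ?_
  have hf := test_FP f.2
  have st := stability B hL (ν := ν) (μ := σ) hp.le hK ht.1 hb0 (gν.mono ht.1 ht.2) (gσ.mono ht.1 ht.2)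
    (fun f hf s hs' => sol_eq B hp hs'.1 hs hsb hf) (fun g hg s hs' => (le_abs_self _).trans (hbt g hg s ⟨hs'.1, hs'.2.trans ht.2⟩))
    (fun f hf => by rw [σeq 0 le_rfl]; exact Wd_FP (gν.s 0) (hs.1 0 le_rfl) hf) hf
  have mf := (le_abs_self _).trans (hft f hf t ht)
  rw [MM] at mf
  rw [σeq t ht.1] at st
  have E := Real.exp_pos ((12 + 2 * κ) * A)
  have st2 := st.trans (mul_le_mul (add_le_add_right J2 _) (Real.exp_le_exp.2 J1) (Real.exp_pos _).le po)
  have fin : 2 * b + K ^ (2 - p) * (2 + (2 * 2 ^ p + 1) * 8) * M + (3 * Wdist (μp 0 ω) (μ 0) + ((16 + 2 * κ) * b + 64 * K ^ (2 - p)) * A) * Real.exp ((12 + 2 * κ) * A) ≤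
      (2 + (2 + (2 * 2 ^ p + 1) * 8) * M + (3 + (16 + 2 * κ) * A + 64 * A) * Real.exp ((12 + 2 * κ) * A)) * (Wdist (μp 0 ω) (μ 0) + b + K ^ (2 - p)) := by
    have D0 : 0 ≤ (2 + (2 * 2 ^ p + 1) * 8) * M := by positivity
    rw [mul_assoc (K ^ (2 - p))]
    have q0 : 0 ≤ 16 + 2 * κ := by linarith
    generalize (2 + (2 * 2 ^ p + 1) * 8) * M = D at D0 ⊢
    generalize 16 + 2 * κ = q at q0 ⊢
    generalize Real.exp ((12 + 2 * κ) * A) = e at E ⊢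
    generalize K ^ (2 - p) = k at k0 ⊢
    generalize Wdist (μp 0 ω) (μ 0) = W at W0 ⊢
    have : 0 ≤ 2 * W + 2 * k + D * (W + b) + e * (3 * (b + k) + q * A * (W + k) + 64 * A * (W + b)) := by positivity
    linear_combination this
  linarith
end
end

section
variable (B : Vd d → MV d) [hC : CK B]

theorem abs_main {κ p lam T ε η : ℝ} (hL : IsLipschitzKernel B κ) (hp : 2 < p) (hT : 0 ≤ T) (hε : 0 < ε) (hε1 : ε ≤ 1) (hη : 0 < η)
    {μ : ℝ → MV d} (hs : IsBoltzmannSolution B μ) (hsb : LocBddMomentFrom p 0 μ) : ∃ C ≥ 0,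
    ∀ (Ω : Type) (m : MeasurableSpace Ω) (P : Measure Ω), IsProbabilityMeasure P → ∀ (𝓕 : Filtration ℝ m) (N : ℕ) (μp : ℝ → Ω → MV d),
    IsKacProcess B N P 𝓕 μp → (∀ ω, momentL p (μp 0 ω) ≤ ENNReal.ofReal lam) →
    ∀ (K Γ : ℝ) (J L : ℕ), 1 ≤ K → 1 ≤ Γ → 2 * K + 1 < 2 ^ (J + 1) →
    (∀ j ≤ J, (r2 ^ j) ^ 8 * ((r2 ^ j) ^ η) ^ 2 ≤ Γ * (r2 ^ j) ^ p) →
    ENNReal.ofReal (1 - ε) < P {ω | ∀ t ∈ Icc (0:ℝ) T, Wdist (μp t ω) (μ t) ≤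
      C * (Wdist (μp 0 ω) (μ 0) + (Γ * ((√N)⁻¹ * YY d L + (2 ^ L)⁻¹) + K ^ (2 - p)))} := by
  obtain ⟨M, M1, HM⟩ := kac_mom B (lam := max lam 0) (ε := ε / 4) hp (le_max_right _ _) hT po
  set A : ℝ := M + ∫ s in 0..T, mU (p + 1) (μ (max s 0)) with hA
  have hκ := hL.1
  have A0 : 0 ≤ A := add_nonneg li (intervalIntegral.integral_nonneg hT fun s _ => mU_nonneg _ _)
  set C1 : ℝ := 2 + (2 + (2 * 2 ^ p + 1) * 8) * M + (3 + (16 + 2 * κ) * A + 64 * A) * Real.exp ((12 + 2 * κ) * A) with hC1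
  have C10 : 0 ≤ C1 := by positivity
  have c0 := cc_pos (d := d)
  set H : ℝ := (1 - (2 ^ η)⁻¹)⁻¹ with hH
  have H0 : 0 < H := inv_pos.2 (sub_pos.2 (inv_lt_one_of_one_lt₀ (Real.one_lt_rpow nq hη)))
  set C2 : ℝ := 4 / ε * (cc d * (5 ^ d + 32 * (2 * 2 ^ p + 1) * M)) * H with hC2
  have C20 : 0 < C2 := by positivity
  set C3 : ℝ := cc d * (2 + (2 * 2 ^ p + 1) * 8) * M with hC3
  have C30 : 0 ≤ C3 := by positivity
  refine ⟨C1 * (1 + C2 + C3), by positivity, ?_⟩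
  intro Ω m P _ 𝓕 N μp h hl K Γ J L hK hG hJ hΓ
  have hN : 0 < (N:ℝ) := by
    obtain ⟨ω⟩ : Nonempty Ω := nonempty_of_isProbabilityMeasure P
    have := emp_N (h.mem 0 ω); exact_mod_cast (by omega : 0 < N)
  obtain ⟨HE, HB⟩ := HM h (fun ω => (hl ω).trans (ENNReal.ofReal_le_ofReal (le_max_left _ _)))
  have sN : 0 < √(N:ℝ) := Real.sqrt_pos.2 hN
  have y0 := YY_pos d L
  have G0 : 0 < Γ := by linarith
  set a : ℝ := C2 * (Γ * ((√N)⁻¹ * YY d L)) with ha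
  have a0 : 0 < a := by positivity
  have es := ES2 B h hT li li hη HE hG L J hΓ
  have mx := kac_max B h (QQ d L J) (f := hh) (b := fun _ => 1) (c := fun q => cc d * (2 ^ q.1.2) ^ 4 / 2 ^ q.1.1) hh_meas hh_bd (fun q => by positivity) hT a0
  have mx2 : P {ω | ∃ t, dyT T t ∧ a ≤ SS B L J (μp · ω) t} ≤ ENNReal.ofReal (ε / 4) := by
    refine mx.trans (ENNReal.ofReal_le_ofReal ?_)
    rw [div_le_iff₀ a0]
    refine es.trans (le_of_eq ?_)
    rw [ha, hC2, ← hH]; field_simp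
  set bad1 := {ω | ¬ (∫ s in Ioc 0 T, mU (p + 1) (μp s ω) ≤ M ∧ ∀ t, dyT T t → mU p (μp t ω) ≤ M)}
  set bad2 := {ω | ∃ t, dyT T t ∧ a ≤ SS B L J (μp · ω) t}
  set good := {ω | ∀ t ∈ Icc (0:ℝ) T, Wdist (μp t ω) (μ t) ≤
      C1 * (1 + C2 + C3) * (Wdist (μp 0 ω) (μ 0) + (Γ * ((√N)⁻¹ * YY d L + (2 ^ L)⁻¹) + K ^ (2 - p)))} with hgood
  have cover : univ ⊆ good ∪ (bad1 ∪ bad2) := by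
    intro ω _
    by_cases w1 : ω ∈ bad1
    · exact Or.inr (Or.inl w1)
    by_cases w2 : ω ∈ bad2
    · exact Or.inr (Or.inr w2)
    left
    obtain ⟨g1, g2⟩ := not_not.1 w1
    have g3 : ∀ t, dyT T t → SS B L J (μp · ω) t < a := fun t ht => not_le.1 fun h' => w2 ⟨t, ht, h'⟩
    have hb : ∀ g ∈ F3 d (2 * K), ∀ t, dyT T t → |MM B (μp · ω) t g| ≤ a + C3 * (Γ * (2 ^ L)⁻¹) := fun g hg t ht => by
      refine (chainM B h ω (ht.mem hT) li (g2 t ht) (g2 0 ⟨0, 0, by simp, by simp⟩) g1 (L := L) li G0.le hJ (fun j hj => ?_) hg).trans (add_le_add (g3 t ht).le (le_of_eq ?_))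
      · refine le_trans ?_ (hΓ j hj)
        have x1 : (1:ℝ) ≤ 2 ^ j := one_le_pow₀ nq
        have x2 : (1:ℝ) ≤ ((r2 ^ j) ^ η) ^ 2 := one_le_pow₀ (Real.one_le_rpow x1 hη.le)
        calc (r2 ^ j) ^ 4 ≤ (2 ^ j) ^ 8 := pow_le_pow_right₀ x1 nq
          _ ≤ _ := le_mul_of_one_le_right po x2
      · rw [hC3]; ring
    intro t ht
    refine (det B hL h ω hp hT M1 hs hsb g1 g2 hK po hb hA t ht).trans ?_
    rw [← hC1, mul_assoc C1]
    refine mll ?_ C10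
    have W0 : 0 ≤ Wdist (μp 0 ω) (μ 0) := Wd_nonneg (h.mem 0 ω).1 (hs.1 0 le_rfl)
    have u0 : 0 ≤ Γ * ((√N)⁻¹ * YY d L) := by positivity
    have u1 : 0 ≤ Γ * (2 ^ L)⁻¹ := by positivity
    have k0 : 0 ≤ K ^ (2 - p) := by positivity
    rw [mul_add Γ, ha]
    generalize Γ * ((√N)⁻¹ * YY d L) = u at *
    generalize Γ * (2 ^ L)⁻¹ = v at *
    generalize K ^ (2 - p) = k at *
    have : 0 ≤ (C2 + C3) * Wdist (μp 0 ω) (μ 0) + (1 + C3) * u + (1 + C2) * v + (C2 + C3) * k := by positivity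
    linear_combination this
  have h1 : 1 ≤ P good + ENNReal.ofReal (ε / 2) := by
    calc (1:ℝ≥0∞) = P univ := measure_univ.symm
      _ ≤ P good + (P bad1 + P bad2) := (measure_mono cover).trans ((measure_union_le _ _).trans (by gcongr; exact measure_union_le _ _))
      _ ≤ P good + (ENNReal.ofReal (ε / 4) + ENNReal.ofReal (ε / 4)) := by gcongr
      _ = _ := by rw [← ENNReal.ofReal_add po po]; congr 2; ring
  by_contra hc
  have h2 := h1.trans (add_le_add_left (not_lt.1 hc) _)
  rw [← ENNReal.ofReal_add li po, ← ENNReal.ofReal_one, ENNReal.ofReal_le_ofReal_iff li] at h2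
  linarith

/-- conclusion shape -/
def Concl (p lam T ε : ℝ) (μ : ℝ → MV d) (R : ℕ → ℝ) : Prop := ∃ C : ℝ, 0 ≤ C ∧
    ∀ (Ω : Type) (m : MeasurableSpace Ω) (P : Measure Ω), IsProbabilityMeasure P → ∀ (𝓕 : Filtration ℝ m) (N : ℕ) (μp : ℝ → Ω → MV d),
    IsKacProcess B N P 𝓕 μp → (∀ ω, momentL p (μp 0 ω) ≤ ENNReal.ofReal lam) →
    ENNReal.ofReal (1 - ε) < P {ω | ∀ t ∈ Icc (0:ℝ) T, Wdist (μp t ω) (μ t) ≤ C * (Wdist (μp 0 ω) (μ 0) + R N)}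

theorem abs_R {κ p lam T ε η : ℝ} (hL : IsLipschitzKernel B κ) (hp : 2 < p) (hT : 0 ≤ T) (hε : 0 < ε) (hε1 : ε ≤ 1) (hη : 0 < η)
    {μ : ℝ → MV d} (hs : IsBoltzmannSolution B μ) (hsb : LocBddMomentFrom p 0 μ) {R : ℕ → ℝ} {D : ℝ} (hD : 0 ≤ D)
    (H : ∀ N : ℕ, 2 ≤ N → 0 ≤ R N ∧ ∃ (K Γ : ℝ) (J L : ℕ), 1 ≤ K ∧ 1 ≤ Γ ∧ 2 * K + 1 < 2 ^ (J + 1) ∧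
      (∀ j ≤ J, (r2 ^ j) ^ 8 * ((r2 ^ j) ^ η) ^ 2 ≤ Γ * (r2 ^ j) ^ p) ∧
      Γ * ((√N)⁻¹ * YY d L + (2 ^ L)⁻¹) + K ^ (2 - p) ≤ D * R N) : Concl B p lam T ε μ R := by
  obtain ⟨C, C0, h⟩ := abs_main B (lam := lam) hL hp hT hε hε1 hη hs hsb
  refine ⟨C * (1 + D), by positivity, fun Ω m P _ 𝓕 N μp hk hl => ?_⟩
  obtain ⟨ω⟩ : Nonempty Ω := nonempty_of_isProbabilityMeasure P
  obtain ⟨R0, K, Γ, J, L, h1, h2, h3, h4, h5⟩ := H N (emp_N (hk.mem 0 ω))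
  refine (h Ω m P ‹_› 𝓕 N μp hk hl K Γ J L h1 h2 h3 h4).trans_le (measure_mono fun ω hω t ht => (hω t ht).trans ?_)
  rw [mul_assoc]
  refine mll ?_ C0
  have W0 : 0 ≤ Wdist (μp 0 ω) (μ 0) := Wd_nonneg (hk.mem 0 ω).1 (hs.1 0 le_rfl)
  nlinarith [mul_nonneg hD W0]
end

lemma par8 {p : ℝ} (hp : 8 < p) {K : ℝ} (J : ℕ) : ∀ j ≤ J, (r2 ^ j) ^ 8 * ((r2 ^ j) ^ ((p - 8) / 2)) ^ 2 ≤ 1 * (r2 ^ j) ^ p := by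
  intro j _
  have x0 : (0:ℝ) < 2 ^ j := by positivity
  rw [one_mul, ← Real.rpow_natCast _ 8, ← Real.rpow_natCast _ 2, ← Real.rpow_mul x0.le, ← Real.rpow_add x0]
  apply le_of_eq; congr 1; push_cast; ring

lemma near {x : ℝ} (hx : 1 ≤ x) : ∃ n : ℕ, r2 ^ n ≤ x ∧ x < 2 ^ (n + 1) ∧ (r2 ^ n)⁻¹ ≤ 2 * x⁻¹ := by
  obtain ⟨n, h1, h2⟩ := exists_nat_pow_near hx (one_lt_two (α := ℝ))
  refine ⟨n, h1, h2, ?_⟩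
  rw [← div_eq_mul_inv, inv_le_comm₀ po po, inv_div, div_le_iff₀ nq, ← pow_succ]; exact h2.le

lemma sqrt_inv {N : ℝ} (hN : 0 < N) : (√N)⁻¹ = N ^ (-(1/2) : ℝ) := by rw [Real.sqrt_eq_rpow, Real.rpow_neg hN.le]

lemma par_d3 {p : ℝ} (hp : 8 < p) (hd : 3 ≤ d) : ∃ D ≥ (0:ℝ), ∀ N : ℕ, 2 ≤ N → 0 ≤ (N:ℝ) ^ (-(1:ℝ) / d) ∧ ∃ (K Γ : ℝ) (J L : ℕ), 1 ≤ K ∧ 1 ≤ Γ ∧ 2 * K + 1 < 2 ^ (J + 1) ∧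
      (∀ j ≤ J, (r2 ^ j) ^ 8 * ((r2 ^ j) ^ ((p - 8) / 2)) ^ 2 ≤ Γ * (r2 ^ j) ^ p) ∧
      Γ * ((√N)⁻¹ * YY d L + (2 ^ L)⁻¹) + K ^ (2 - p) ≤ D * (N:ℝ) ^ (-(1:ℝ) / d) := by
  have d3 : (3:ℝ) ≤ d := by exact_mod_cast hd
  set r : ℝ := 2 ^ ((d:ℝ) / 2 - 1) with hr
  have r1 : 1 < r := Real.one_lt_rpow nq li
  have r10 : 0 < r - 1 := by linarith
  refine ⟨r / (r - 1) + 3, by positivity, fun N hN => ⟨by positivity, ?_⟩⟩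
  have N1 : (1:ℝ) ≤ N := by exact_mod_cast (by omega : 1 ≤ N)
  have N0 : (0:ℝ) < N := by linarith
  obtain ⟨J, -, hJ, -⟩ := near (x := 2 * N + 1) li
  obtain ⟨L, hL1, -, hL2⟩ := near (x := (N:ℝ) ^ (1 / (d:ℝ))) (Real.one_le_rpow N1 po)
  refine ⟨N, 1, J, L, N1, le_rfl, hJ, par8 hp (K := 1) J, ?_⟩
  rw [← Real.rpow_neg N0.le, show -(1 / (d:ℝ)) = -1 / d by ring] at hL2
  have e : YY d L ≤ r / (r - 1) * (N:ℝ) ^ (1 / 2 - 1 / (d:ℝ)) := by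
    have t : ∀ l : ℕ, (r2 ^ l) ^ ((d:ℝ) / 2) / 2 ^ l = r ^ l := fun l => by
      rw [hr, ← Real.rpow_natCast _ l, ← Real.rpow_natCast (2 ^ ((d:ℝ) / 2 - 1)) l, ← Real.rpow_mul nq, ← Real.rpow_mul nq, ← Real.rpow_sub nq]
      congr 1; ring
    rw [YY, Finset.sum_congr rfl fun l _ => t l, geom_sum_eq r1.ne']
    have q : r ^ L ≤ (N:ℝ) ^ (1 / 2 - 1 / (d:ℝ)) := by
      calc r ^ L = (r2 ^ L) ^ ((d:ℝ) / 2 - 1) := by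
            rw [hr, ← Real.rpow_natCast, ← Real.rpow_natCast, ← Real.rpow_mul nq, ← Real.rpow_mul nq, mul_comm]
        _ ≤ ((N:ℝ) ^ (1 / (d:ℝ))) ^ ((d:ℝ) / 2 - 1) := Real.rpow_le_rpow po hL1 li
        _ = _ := by rw [← Real.rpow_mul N0.le]; congr 1; field_simp
    rw [div_mul_eq_mul_div]
    refine div_le_div_of_nonneg_right ?_ r10.le
    rw [pow_succ]
    nlinarith [mll q (by linarith : 0 ≤ r)]
  have e2 : (√N)⁻¹ * YY d L ≤ r / (r - 1) * (N:ℝ) ^ (-(1:ℝ) / d) := by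
    refine (mll e po).trans (le_of_eq ?_)
    rw [sqrt_inv N0, mul_left_comm, ← Real.rpow_add N0]; congr 2; ring
  have e3 : (N:ℝ) ^ (2 - p) ≤ (N:ℝ) ^ (-(1:ℝ) / d) := by
    refine Real.rpow_le_rpow_of_exponent_le N1 ?_
    rw [le_div_iff₀ li]; nlinarith
  linarith

lemma par_d2 {p : ℝ} (hp : 8 < p) (hd : d = 2) : ∃ D ≥ (0:ℝ), ∀ N : ℕ, 2 ≤ N → 0 ≤ (N:ℝ) ^ (-(1:ℝ) / 2) * Real.log N ∧ ∃ (K Γ : ℝ) (J L : ℕ), 1 ≤ K ∧ 1 ≤ Γ ∧ 2 * K + 1 < 2 ^ (J + 1) ∧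
      (∀ j ≤ J, (r2 ^ j) ^ 8 * ((r2 ^ j) ^ ((p - 8) / 2)) ^ 2 ≤ Γ * (r2 ^ j) ^ p) ∧
      Γ * ((√N)⁻¹ * YY d L + (2 ^ L)⁻¹) + K ^ (2 - p) ≤ D * ((N:ℝ) ^ (-(1:ℝ) / 2) * Real.log N) := by
  have l2 : 0 < Real.log 2 := Real.log_pos nq
  refine ⟨5 / Real.log 2, by positivity, fun N hN => ?_⟩
  have N2 : r2 ≤ N := by exact_mod_cast hN
  have N1 : (1:ℝ) ≤ N := by linarith
  have N0 : (0:ℝ) < N := by linarith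
  have lN : Real.log 2 ≤ Real.log N := Real.log_le_log nq N2
  refine ⟨mul_nonneg po li, ?_⟩
  obtain ⟨J, -, hJ, -⟩ := near (x := 2 * N + 1) li
  obtain ⟨L, hL1, -, hL2⟩ := near (x := (N:ℝ) ^ (1 / 2 : ℝ)) (Real.one_le_rpow N1 po)
  refine ⟨N, 1, J, L, N1, le_rfl, hJ, par8 hp (K := 1) J, ?_⟩
  rw [← Real.rpow_neg N0.le, show -(1 / 2 : ℝ) = -1 / 2 by ring] at hL2
  have e : YY d L = L + 1 := by
    rw [YY, hd]
    have : ∀ l : ℕ, (r2 ^ l) ^ (((2:ℕ):ℝ) / 2) / 2 ^ l = 1 := fun l => by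
      rw [show ((2:ℕ):ℝ) / 2 = 1 by norm_num, Real.rpow_one, div_self po]
    simp [this]
  have e1 : L * Real.log 2 ≤ Real.log N := by
    have := Real.log_le_log po hL1
    rw [Real.log_pow, Real.log_rpow N0] at this; linarith
  have e3 : (N:ℝ) ^ (2 - p) ≤ (N:ℝ) ^ (-(1:ℝ) / 2) := Real.rpow_le_rpow_of_exponent_le N1 li
  rw [e, sqrt_inv N0, show -(1 / 2 : ℝ) = -1 / 2 by ring]
  have x0 : 0 < (N:ℝ) ^ (-(1:ℝ) / 2) := by positivity
  generalize (N:ℝ) ^ (-(1:ℝ) / 2) = x at *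
  rw [div_mul_eq_mul_div, le_div_iff₀ l2]
  have : x * ((L:ℝ) + 4) * Real.log 2 ≤ 5 * (x * Real.log N) := by nlinarith
  nlinarith

lemma par_gen {p : ℝ} (hp : 2 < p) (hd : 2 ≤ d) : ∃ α > (0:ℝ), ∃ D ≥ (0:ℝ), ∀ N : ℕ, 2 ≤ N → 0 ≤ (N:ℝ) ^ (-α) ∧ ∃ (K Γ : ℝ) (J L : ℕ), 1 ≤ K ∧ 1 ≤ Γ ∧ 2 * K + 1 < 2 ^ (J + 1) ∧
      (∀ j ≤ J, (r2 ^ j) ^ 8 * ((r2 ^ j) ^ (1 / 2 : ℝ)) ^ 2 ≤ Γ * (r2 ^ j) ^ p) ∧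
      Γ * ((√N)⁻¹ * YY d L + (2 ^ L)⁻¹) + K ^ (2 - p) ≤ D * (N:ℝ) ^ (-α) := by
  have d2 : r2 ≤ d := by exact_mod_cast hd
  have q2 : 0 < p - 2 := by linarith
  refine ⟨min (1 / (4 * d) : ℝ) ((p - 2) / (36 * d)), lt_min po po, 3 ^ 10 + 1, by positivity, fun N hN => ⟨by positivity, ?_⟩⟩
  have N1 : (1:ℝ) ≤ N := by exact_mod_cast (by omega : 1 ≤ N)
  have N0 : (0:ℝ) < N := by linarith
  set K : ℝ := (N:ℝ) ^ (1 / (36 * d) : ℝ) with hK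
  have K1 : 1 ≤ K := Real.one_le_rpow N1 po
  obtain ⟨J, hJ0, hJ, -⟩ := near (x := 2 * K + 1) li
  obtain ⟨L, hL1, -, hL2⟩ := near (x := (N:ℝ) ^ (1 / (2 * d) : ℝ)) (Real.one_le_rpow N1 po)
  rw [← Real.rpow_neg N0.le] at hL2
  refine ⟨K, (2 * K + 1) ^ 9, J, L, K1, one_le_pow₀ li, hJ, fun j hj => ?_, ?_⟩
  · have x1 : (1:ℝ) ≤ 2 ^ j := one_le_pow₀ nq
    have x2 : r2 ^ j ≤ 2 * K + 1 := (pow_le_pow_right₀ nq hj).trans hJ0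
    rw [← Real.sqrt_eq_rpow, Real.sq_sqrt po, ← pow_succ]
    exact (pow_le_pow_left₀ po x2 9).trans (le_mul_of_one_le_right po (Real.one_le_rpow x1 li))
  · have y : YY d L ≤ (N:ℝ) ^ (1 / 4 : ℝ) := by
      calc YY d L ≤ ∑ l ∈ Finset.range (L + 1), (r2 ^ L) ^ ((d:ℝ) / 2 - 1) := by
            refine Finset.sum_le_sum fun l hl => ?_
            rw [← Real.rpow_sub_one po]
            exact Real.rpow_le_rpow po (pow_le_pow_right₀ nq (by simp at hl; omega)) li
        _ = ((L + 1 : ℕ) : ℝ) * (r2 ^ L) ^ ((d:ℝ) / 2 - 1) := by simp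
        _ ≤ r2 ^ L * (r2 ^ L) ^ ((d:ℝ) / 2 - 1) := by
            gcongr; exact_mod_cast Nat.succ_le_of_lt L.lt_two_pow_self
        _ = (r2 ^ L) ^ ((d:ℝ) / 2) := by rw [Real.rpow_sub_one po]; field_simp
        _ ≤ ((N:ℝ) ^ (1 / (2 * d) : ℝ)) ^ ((d:ℝ) / 2) := Real.rpow_le_rpow po hL1 li
        _ = _ := by rw [← Real.rpow_mul N0.le]; congr 1; field_simp; norm_num
    have y2 : (√N)⁻¹ * YY d L ≤ (N:ℝ) ^ (-(1 / (2 * d)) : ℝ) := by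
      refine (mll y po).trans ?_
      rw [sqrt_inv N0, ← Real.rpow_add N0]
      refine Real.rpow_le_rpow_of_exponent_le N1 ?_
      have : (1:ℝ) / (2 * d) ≤ 1 / 4 := by rw [div_le_div_iff₀ po nq]; linarith
      linarith
    have g : (2 * K + 1) ^ 9 ≤ 3 ^ 9 * (N:ℝ) ^ (1 / (4 * d) : ℝ) := by
      calc (2 * K + 1) ^ 9 ≤ (3 * K) ^ 9 := pow_le_pow_left₀ po li 9
        _ = _ := by rw [mul_pow, hK, ← Real.rpow_natCast ((N:ℝ) ^ _) 9, ← Real.rpow_mul N0.le]; congr 2; field_simp; norm_num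
    have a1 : (N:ℝ) ^ (-(1 / (4 * d)) : ℝ) ≤ (N:ℝ) ^ (-min (1 / (4 * d) : ℝ) ((p - 2) / (36 * d)) : ℝ) :=
      Real.rpow_le_rpow_of_exponent_le N1 (neg_le_neg (min_le_left _ _))
    have a2 : K ^ (2 - p) ≤ (N:ℝ) ^ (-min (1 / (4 * d) : ℝ) ((p - 2) / (36 * d)) : ℝ) := by
      rw [hK, ← Real.rpow_mul N0.le]
      refine Real.rpow_le_rpow_of_exponent_le N1 ((le_of_eq ?_).trans (neg_le_neg (min_le_right _ _)))
      field_simp; ring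
    have b : (2 * K + 1) ^ 9 * ((√N)⁻¹ * YY d L + (2 ^ L)⁻¹) ≤ 3 ^ 10 * (N:ℝ) ^ (-(1 / (4 * d)) : ℝ) := by
      have y0 := YY_pos d L
      refine (mul_le_mul g (add_le_add y2 hL2) po po).trans (le_of_eq ?_)
      rw [show -(1 / (4 * d) : ℝ) = 1 / (4 * d) + -(1 / (2 * d)) by field_simp; norm_num, Real.rpow_add N0]; ring
    linarith

end KacP

/-- Theorem 10.1 (convergence of the Kac process to the Boltzmann equation). -/
theorem kac_converges_to_boltzmann
    (d : ℕ) (hd : 2 ≤ d) (B : Vd d → Measure (Vd d)) (κ : ℝ)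
    (hB : IsCollisionKernel B) (hBL : IsLipschitzKernel B κ)
    (p : ℝ) (hp : 2 < p)
    (μ0 : Measure (Vd d)) (hμ0 : μ0 ∈ boltzmannSphere d)
    (hμ0p : momentL p μ0 ≠ ⊤)
    (μsol : ℝ → Measure (Vd d)) (hsol0 : μsol 0 = μ0)
    (hsol : IsBoltzmannSolution B μsol) (hsolbdd : LocBddMomentFrom p 0 μsol)
    (ε : ℝ) (hε0 : 0 < ε) (hε1 : ε ≤ 1)
    (lam : ℝ) (hlam : momentL p μ0 ≤ ENNReal.ofReal lam)
    (T : ℝ) (hT : 0 ≤ T) :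
    (∃ α : ℝ, 0 < α ∧ ∃ C : ℝ, 0 ≤ C ∧
      ∀ (Ω : Type) (m : MeasurableSpace Ω) (P : Measure Ω),
        IsProbabilityMeasure P →
      ∀ (𝓕 : MeasureTheory.Filtration ℝ m) (N : ℕ) (μp : ℝ → Ω → Measure (Vd d)),
        IsKacProcess B N P 𝓕 μp →
        (∀ ω, momentL p (μp 0 ω) ≤ ENNReal.ofReal lam) →
        ENNReal.ofReal (1 - ε) <
          P {ω | ∀ t ∈ Set.Icc (0:ℝ) T,
            Wdist (μp t ω) (μsol t) ≤
              C * (Wdist (μp 0 ω) (μsol 0) + (N : ℝ) ^ (-α))}) ∧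
    (8 < p → 3 ≤ d → ∃ C : ℝ, 0 ≤ C ∧
      ∀ (Ω : Type) (m : MeasurableSpace Ω) (P : Measure Ω),
        IsProbabilityMeasure P →
      ∀ (𝓕 : MeasureTheory.Filtration ℝ m) (N : ℕ) (μp : ℝ → Ω → Measure (Vd d)),
        IsKacProcess B N P 𝓕 μp →
        (∀ ω, momentL p (μp 0 ω) ≤ ENNReal.ofReal lam) →
        ENNReal.ofReal (1 - ε) <
          P {ω | ∀ t ∈ Set.Icc (0:ℝ) T,
            Wdist (μp t ω) (μsol t) ≤
              C * (Wdist (μp 0 ω) (μsol 0) + (N : ℝ) ^ (-(1:ℝ)/d))}) ∧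
    (8 < p → d = 2 → ∃ C : ℝ, 0 ≤ C ∧
      ∀ (Ω : Type) (m : MeasurableSpace Ω) (P : Measure Ω),
        IsProbabilityMeasure P →
      ∀ (𝓕 : MeasureTheory.Filtration ℝ m) (N : ℕ) (μp : ℝ → Ω → Measure (Vd d)),
        IsKacProcess B N P 𝓕 μp →
        (∀ ω, momentL p (μp 0 ω) ≤ ENNReal.ofReal lam) →
        ENNReal.ofReal (1 - ε) <
          P {ω | ∀ t ∈ Set.Icc (0:ℝ) T,
            Wdist (μp t ω) (μsol t) ≤
              C * (Wdist (μp 0 ω) (μsol 0) +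
                (N : ℝ) ^ (-(1:ℝ)/2) * Real.log N)}) := by
  have : KacP.CK B := ⟨hd, hB⟩
  refine ⟨?_, fun h8 h3 => ?_, fun h8 h2 => ?_⟩
  · obtain ⟨α, α0, D, D0, H⟩ := KacP.par_gen hp hd
    exact ⟨α, α0, KacP.abs_R B (R := fun N : ℕ => (N : ℝ) ^ (-α)) hBL hp hT hε0 hε1
      (η := 1 / 2) (by norm_num) hsol hsolbdd D0 H⟩
  · obtain ⟨D, D0, H⟩ := KacP.par_d3 h8 h3
    exact KacP.abs_R B (R := fun N : ℕ => (N : ℝ) ^ (-(1:ℝ)/d)) hBL hp hT hε0 hε1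
      (η := (p - 8) / 2) (by linarith) hsol hsolbdd D0 H
  · obtain ⟨D, D0, H⟩ := KacP.par_d2 h8 h2
    exact KacP.abs_R B (R := fun N : ℕ => (N : ℝ) ^ (-(1:ℝ)/2) * Real.log N) hBL hp hT hε0 hε1
      (η := (p - 8) / 2) (by linarith) hsol hsolbdd D0 H
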